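/- Every irreducible component of codimension one of the zero locus Z(B_F^a) of the Bernstein–Sato ideal is a hyperplane with nonnegative integer slope coefficients and positive integer constant term. Precisely: if V ⊆ ℂ^r is an irreducible component (for the Zariski topology) of Z(B_F^a) that is the zero locus of a single irreducible polynomial in ℂ[s_1,…,s_r] (equivalently, V has codimension one), then there exist natural numbers l_1,…,l_r ∈ ℕ, not all zero, and a positive integer c such that V = {α ∈ ℂ^r : l_1·α_1 + ⋯ + l_r·α_r + c = 0}. (This is the part of the paper's main Theorem, where l_j = ord_E(f_j) and c = k_E + c' for a log resolution, that is expressible without resolution data: the slopes are natural numbers and the constant term is a positive integer.) -/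

import Mathlib

open MvPolynomial MeasureTheory

noncomputable section

/-- The polynomial ring `K0[x_1,…,x_n,s_1,…,s_r]`, with the `x`-variables indexed by
`Sum.inl` and the `s`-variables indexed by `Sum.inr`. -/
abbrev XS (K0 : Type) [Field K0] (n r : ℕ) : Type := MvPolynomial (Fin n ⊕ Fin r) K0

/-- The fraction field of `K0[x,s]`; the localization `K0[x,s][1/f]` sits inside it, and the
smallest `∇`-stable submodule generated by an element is the same computed in either. -/
abbrev Frac (K0 : Type) [Field K0] (n r : ℕ) : Type := FractionRing (XS K0 n r)

variable (K0 : Type) [Field K0] (n r : ℕ)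

/-- Embedding of `K0[x_1,…,x_n]` into `K0[x,s]`. -/
def px (p : MvPolynomial (Fin n) K0) : XS K0 n r := rename Sum.inl p

/-- Embedding of `K0[s_1,…,s_r]` into `K0[x,s]`. -/
def ps (p : MvPolynomial (Fin r) K0) : XS K0 n r := rename Sum.inr p

/-- The canonical map from `K0[x,s]` to its fraction field. -/
def toF (p : XS K0 n r) : Frac K0 n r := algebraMap _ _ p

/-- The partial derivative `∂/∂x_i`, extended to the fraction field of `K0[x,s]` via the
quotient rule applied to a representative fraction (the formula is independent of the chosen
representative, so this is the unique derivation extending `pderiv (Sum.inl i)`). -/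
def DX (i : Fin n) (q : Frac K0 n r) : Frac K0 n r :=
  let h := IsFractionRing.div_surjective (A := XS K0 n r) q
  (toF K0 n r (pderiv (Sum.inl i) h.choose) * toF K0 n r h.choose_spec.choose -
      toF K0 n r h.choose * toF K0 n r (pderiv (Sum.inl i) h.choose_spec.choose)) /
    toF K0 n r h.choose_spec.choose ^ 2

/-- The logarithmic twist `∑_j s_j · (∂f_j/∂x_i)/f_j` in the fraction field. -/
def twist (f : Fin r → MvPolynomial (Fin n) K0) (i : Fin n) : Frac K0 n r :=
  ∑ j, toF K0 n r (X (Sum.inr j)) * toF K0 n r (px K0 n r (pderiv i (f j))) /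
    toF K0 n r (px K0 n r (f j))

/-- The twisted partial derivative `∇_i(g·F^s) = (∂g/∂x_i + g·∑_j s_j (∂f_j/∂x_i)/f_j)·F^s`,
the formal action of `∂/∂x_i` on `g·f_1^{s_1}⋯f_r^{s_r}`; here `g·F^s` is identified with `g`. -/
def nabla (f : Fin r → MvPolynomial (Fin n) K0) (i : Fin n) (g : Frac K0 n r) : Frac K0 n r :=
  DX K0 n r i g + g * twist K0 n r f i

/-- The element `F^{s+a} = (f_1^{a_1}⋯f_r^{a_r})·F^s`, where `F^s` is identified with `1`. -/
def Fsa (f : Fin r → MvPolynomial (Fin n) K0) (a : Fin r → ℕ) : Frac K0 n r :=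
  toF K0 n r (∏ j, px K0 n r (f j) ^ a j)

/-- The smallest `K0[x,s]`-submodule containing `F^{s+a}` and stable under `∇_1,…,∇_n`,
realizing `𝒟[s]·F^{s+a}`. -/
def Na (f : Fin r → MvPolynomial (Fin n) K0) (a : Fin r → ℕ) :
    Submodule (XS K0 n r) (Frac K0 n r) :=
  sInf {N | Fsa K0 n r f a ∈ N ∧ ∀ i : Fin n, ∀ m ∈ N, nabla K0 n r f i m ∈ N}

/-- The Bernstein–Sato ideal `B_F^a = { b ∈ K0[s] : b·F^s ∈ N_a }` (as a set of polynomials). -/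
def BS (f : Fin r → MvPolynomial (Fin n) K0) (a : Fin r → ℕ) : Set (MvPolynomial (Fin r) K0) :=
  {b | toF K0 n r (ps K0 n r b) ∈ Na K0 n r f a}

/-- The zero locus `Z(B_F^a) ⊆ ℂ^r` of the Bernstein–Sato ideal. -/
def ZBS (f : Fin r → MvPolynomial (Fin n) ℂ) (a : Fin r → ℕ) : Set (Fin r → ℂ) :=
  {α | ∀ b ∈ BS ℂ n r f a, eval α b = 0}

end

noncomputable section

/-- A subset of `ℂ^r` is Zariski closed if it is the common zero locus of a set of
polynomials. -/
def zarClosed (r : ℕ) (S : Set (Fin r → ℂ)) : Prop :=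
  ∃ I : Set (MvPolynomial (Fin r) ℂ), S = {α | ∀ p ∈ I, eval α p = 0}

/-- A subset of `ℂ^r` is irreducible (for the Zariski topology) if it is nonempty and is not
covered by two Zariski closed sets unless it is contained in one of them. -/
def irredSet (r : ℕ) (V : Set (Fin r → ℂ)) : Prop :=
  V.Nonempty ∧ ∀ C₁ C₂ : Set (Fin r → ℂ), zarClosed r C₁ → zarClosed r C₂ →
    V ⊆ C₁ ∪ C₂ → (V ⊆ C₁ ∨ V ⊆ C₂)

namespace BernsteinSato

section Hilbert
variable {A : Type*} [Ring A]

/-- The left span of the powers `t ^ i`, `i < n`, over a subring. -/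
def powSpan (S : Subring A) (t : A) (n : ℕ) : Submodule S A :=
  Submodule.span S {x | ∃ i < n, x = t ^ i}

theorem powSpan_mono (S : Subring A) (t : A) {m n : ℕ} (h : m ≤ n) :
    powSpan S t m ≤ powSpan S t n :=
  Submodule.span_mono fun _ ⟨i, hi, hx⟩ => ⟨i, hi.trans_le h, hx⟩

theorem pow_mem_powSpan (S : Subring A) (t : A) {i n : ℕ} (h : i < n) :
    t ^ i ∈ powSpan S t n := Submodule.subset_span ⟨i, h, rfl⟩

theorem powSpan_succ_exists (S : Subring A) (t : A) {n : ℕ} {x : A}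
    (hx : x ∈ powSpan S t (n + 1)) : ∃ s : S, x - s * t ^ n ∈ powSpan S t n := by
  induction hx using Submodule.span_induction with
  | mem x h =>
    obtain ⟨i, hi, rfl⟩ := h
    rcases Nat.lt_succ_iff_lt_or_eq.mp hi with h | rfl
    · exact ⟨0, by simpa using pow_mem_powSpan S t h⟩
    · exact ⟨1, by simp⟩
  | zero => exact ⟨0, by simp⟩
  | add x y _ _ hx hy =>
    obtain ⟨s, hs⟩ := hx
    obtain ⟨s', hs'⟩ := hy
    refine ⟨s + s', ?_⟩
    have := add_mem hs hs'
    convert this using 1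
    push_cast
    noncomm_ring
  | smul a x _ hx =>
    obtain ⟨s, hs⟩ := hx
    refine ⟨a * s, ?_⟩
    have := Submodule.smul_mem _ a hs
    convert this using 1
    simp [Subring.smul_def, mul_sub, mul_assoc]

theorem mul_mem_powSpan {S : Subring A} {t : A} (hc : ∀ s ∈ S, t * s - s * t ∈ S) {n : ℕ} {x : A}
    (hx : x ∈ powSpan S t n) : t * x - x * t ∈ powSpan S t n := by
  induction hx using Submodule.span_induction with
  | mem x h =>
    obtain ⟨i, hi, rfl⟩ := h
    simp [← pow_succ, ← pow_succ']
  | zero => simp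
  | add x y _ _ hx hy =>
    have := add_mem hx hy
    convert this using 1
    noncomm_ring
  | smul a x h hx =>
    have h1 := Submodule.smul_mem _ a hx
    have h2 := Submodule.smul_mem _ (⟨_, hc a a.2⟩ : S) h
    have := add_mem h1 h2
    convert this using 1
    simp only [Subring.smul_def, smul_eq_mul]
    noncomm_ring

theorem mul_mem_powSpan_succ {S : Subring A} {t : A} {n : ℕ} {x : A}
    (hx : x ∈ powSpan S t n) : x * t ∈ powSpan S t (n + 1) := by
  induction hx using Submodule.span_induction with
  | mem x h =>
    obtain ⟨i, hi, rfl⟩ := h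
    rw [← pow_succ]
    exact pow_mem_powSpan S t (by omega)
  | zero => simp
  | add x y _ _ hx hy => rw [add_mul]; exact add_mem hx hy
  | smul a x h hx =>
    have h1 := Submodule.smul_mem _ a hx
    simpa only [Subring.smul_def, smul_eq_mul, mul_assoc] using h1

theorem t_mul_mem_powSpan {S : Subring A} {t : A} (hc : ∀ s ∈ S, t * s - s * t ∈ S) {n : ℕ} {x : A}
    (hx : x ∈ powSpan S t n) : t * x ∈ powSpan S t (n + 1) := by
  have := add_mem (powSpan_mono S t n.le_succ (mul_mem_powSpan hc hx)) (mul_mem_powSpan_succ hx)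
  simpa using this

theorem exists_mem_powSpan {G : Set A} {t : A}
    (hc : ∀ s ∈ Subring.closure G, t * s - s * t ∈ Subring.closure G) {x : A}
    (hx : x ∈ Subring.closure (insert t G)) : ∃ n, x ∈ powSpan (Subring.closure G) t n := by
  suffices h : ∀ y, (∃ n, y ∈ powSpan (Subring.closure G) t n) →
      ∃ n, x * y ∈ powSpan (Subring.closure G) t n by
    simpa using h 1 ⟨1, by simpa using pow_mem_powSpan (Subring.closure G) t (zero_lt_one)⟩
  induction hx using Subring.closure_induction with
  | mem x h =>
    rintro y ⟨n, hy⟩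
    rcases h with rfl | h
    · exact ⟨_, t_mul_mem_powSpan hc hy⟩
    · exact ⟨n, Submodule.smul_mem _ (⟨x, Subring.subset_closure h⟩ : Subring.closure G) hy⟩
  | zero => intro y _; exact ⟨0, by simp⟩
  | one => intro y h; simpa using h
  | add a b _ _ ha hb =>
    intro y h
    obtain ⟨m, hm⟩ := ha y h
    obtain ⟨n, hn⟩ := hb y h
    refine ⟨max m n, ?_⟩
    rw [add_mul]
    exact add_mem (powSpan_mono _ _ (le_max_left _ _) hm) (powSpan_mono _ _ (le_max_right _ _) hn)
  | neg a _ ha =>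
    intro y h
    obtain ⟨m, hm⟩ := ha y h
    exact ⟨m, by simpa using hm⟩
  | mul a b _ _ ha hb =>
    intro y h
    rw [mul_assoc]
    exact ha _ (hb _ h)

theorem commutator_mem_closure {G : Set A} {t : A}
    (hG : ∀ g ∈ G, t * g - g * t ∈ Subring.closure G) {s : A} (hs : s ∈ Subring.closure G) :
    t * s - s * t ∈ Subring.closure G := by
  induction hs using Subring.closure_induction with
  | mem x h => exact hG x h
  | zero => simp
  | one => simp
  | add a b _ _ ha hb => convert add_mem ha hb using 1; noncomm_ring
  | neg a _ ha => convert neg_mem ha using 1; noncomm_ring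
  | mul a b h h' ha hb =>
    convert add_mem (mul_mem ha h') (mul_mem h hb) using 1; noncomm_ring

/-- The ideal of leading coefficients in degree `n` of a left ideal of an extension generated
by `t`. -/
def leadIdeal {G : Set A} {t : A}
    (I : Ideal (Subring.closure (insert t G))) (n : ℕ) : Ideal (Subring.closure G) where
  carrier := {s | ∃ x ∈ I, (x : A) - s * t ^ n ∈ powSpan (Subring.closure G) t n}
  add_mem' := by
    rintro a b ⟨x, hx, hx'⟩ ⟨y, hy, hy'⟩
    refine ⟨x + y, add_mem hx hy, ?_⟩
    convert add_mem hx' hy' using 1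
    push_cast
    noncomm_ring
  zero_mem' := ⟨0, zero_mem _, by simp⟩
  smul_mem' := by
    rintro c s ⟨x, hx, hx'⟩
    refine ⟨⟨c, Subring.closure_mono (Set.subset_insert _ _) c.2⟩ * x, I.mul_mem_left _ hx, ?_⟩
    convert Submodule.smul_mem _ c hx' using 1
    simp only [Subring.smul_def, smul_eq_mul, Subring.coe_mul]
    noncomm_ring

theorem leadIdeal_mono {G : Set A} {t : A}
    (hc : ∀ s ∈ Subring.closure G, t * s - s * t ∈ Subring.closure G)
    {I J : Ideal (Subring.closure (insert t G))} (h : I ≤ J) {m n : ℕ} (hmn : m ≤ n) :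
    leadIdeal I m ≤ leadIdeal J n := by
  refine le_trans (b := leadIdeal J m) (fun s ⟨x, hx, hx'⟩ => ⟨x, h hx, hx'⟩) ?_
  induction hmn with
  | refl => exact le_rfl
  | step _ ih =>
    refine ih.trans ?_
    rintro s ⟨x, hx, hx'⟩
    refine ⟨⟨t, Subring.subset_closure (Set.mem_insert _ _)⟩ * x, J.mul_mem_left _ hx, ?_⟩
    rename_i k _
    have h1 := t_mul_mem_powSpan hc hx'
    have h2 := Submodule.smul_mem (powSpan (Subring.closure G) t (k + 1))
      (⟨_, hc s s.2⟩ : Subring.closure G) (pow_mem_powSpan _ t k.lt_succ_self)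
    convert add_mem h1 h2 using 1
    simp only [Subring.smul_def, smul_eq_mul, Subring.coe_mul, pow_succ']
    noncomm_ring

theorem le_of_leadIdeal_le {G : Set A} {t : A}
    (hc : ∀ s ∈ Subring.closure G, t * s - s * t ∈ Subring.closure G)
    {I J : Ideal (Subring.closure (insert t G))} (h : I ≤ J)
    (hl : ∀ n, leadIdeal J n ≤ leadIdeal I n) : J ≤ I := by
  have key : ∀ n, ∀ x ∈ J, (x : A) ∈ powSpan (Subring.closure G) t n → x ∈ I := by
    intro n
    induction n with
    | zero =>
      intro x _ hx
      have : (x : A) = 0 := by simpa [powSpan] using hx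
      have : x = 0 := by ext; simpa using this
      rw [this]; exact zero_mem _
    | succ n ih =>
      intro x hxJ hx
      obtain ⟨s, hs⟩ := powSpan_succ_exists _ _ hx
      obtain ⟨y, hy, hy'⟩ := hl n (show s ∈ leadIdeal J n from ⟨x, hxJ, hs⟩)
      have h1 : ((x - y : Subring.closure (insert t G)) : A) ∈ powSpan (Subring.closure G) t n := by
        convert sub_mem hs hy' using 1
        push_cast
        noncomm_ring
      have := add_mem (ih _ (sub_mem hxJ (h hy)) h1) hy
      simpa using this
  intro x hx
  obtain ⟨n, hn⟩ := exists_mem_powSpan hc x.2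
  exact key n x hx hn

/-- A noncommutative Hilbert basis theorem: adjoining to a left noetherian ring an element whose
commutators stay in the ring preserves left noetherianity. -/
theorem isNoetherianRing_closure_insert {G : Set A} {t : A}
    (hG : ∀ g ∈ G, t * g - g * t ∈ Subring.closure G)
    (hN : IsNoetherianRing (Subring.closure G)) :
    IsNoetherianRing (Subring.closure (insert t G)) := by
  have hc : ∀ s ∈ Subring.closure G, t * s - s * t ∈ Subring.closure G :=
    fun s hs => commutator_mem_closure hG hs
  have hN' := monotone_stabilizes_iff_noetherian.mpr hN
  refine monotone_stabilizes_iff_noetherian.mp fun f => ?_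
  obtain ⟨N, hNN⟩ := hN' ⟨fun m => leadIdeal (f m) m, fun a b h => leadIdeal_mono hc (f.2 h) h⟩
  choose p hp using fun n => hN' ⟨fun m => leadIdeal (f m) n,
    fun a b h => leadIdeal_mono hc (f.2 h) le_rfl⟩
  change ∀ m, N ≤ m → leadIdeal (f N) N = leadIdeal (f m) m at hNN
  change ∀ n m, p n ≤ m → leadIdeal (f (p n)) n = leadIdeal (f m) n at hp
  refine ⟨max N ((Finset.range N).sup p), fun m hm => le_antisymm (f.2 hm) ?_⟩
  refine le_of_leadIdeal_le hc (f.2 hm) fun n => ?_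
  set q := max N ((Finset.range N).sup p) with hq
  by_cases hn : n < N
  · have h1 : p n ≤ q := (Finset.le_sup (f := p) (Finset.mem_range.mpr hn)).trans (le_max_right _ _)
    rw [← hp n q h1, hp n m (h1.trans hm)]
  · push Not at hn
    calc leadIdeal (f m) n ≤ leadIdeal (f (max m n)) (max m n) :=
          leadIdeal_mono hc (f.2 (le_max_left _ _)) (le_max_right _ _)
      _ = leadIdeal (f N) N := (hNN _ (hn.trans (le_max_right _ _))).symm
      _ ≤ leadIdeal (f q) n := leadIdeal_mono hc (f.2 (le_max_left _ _)) hn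

end Hilbert

section Sequences
variable {M : Type*} [AddCommGroup M]

/-- Componentwise action on bi-infinite sequences. -/
def diag : AddMonoid.End M →+* AddMonoid.End (ℤ → M) where
  toFun s := { toFun := fun m k => s (m k), map_zero' := by ext; simp, map_add' := by intros; ext; simp }
  map_one' := rfl
  map_mul' _ _ := rfl
  map_zero' := rfl
  map_add' _ _ := rfl

@[simp] theorem diag_apply (s : AddMonoid.End M) (m : ℤ → M) (k : ℤ) : diag s m k = s (m k) := rfl

/-- The shift of bi-infinite sequences by `k`. -/
def shiftOp (k : ℤ) : AddMonoid.End (ℤ → M) where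
  toFun m l := m (l + k)
  map_zero' := rfl
  map_add' _ _ := rfl

@[simp] theorem shiftOp_apply (k : ℤ) (m : ℤ → M) (l : ℤ) : shiftOp k m l = m (l + k) := rfl

/-- Multiplication of the `k`-th entry by `p(k)`. -/
def polOp : Polynomial ℤ →+* AddMonoid.End (ℤ → M) where
  toFun p := { toFun := fun m k => p.eval k • m k, map_zero' := by ext; simp,
               map_add' := by intros; ext; simp }
  map_one' := AddMonoidHom.ext fun m => funext fun k => by
    change Polynomial.eval k 1 • m k = m k; simp
  map_mul' p q := AddMonoidHom.ext fun m => funext fun k => by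
    change Polynomial.eval k (p * q) • m k = Polynomial.eval k p • Polynomial.eval k q • m k
    rw [Polynomial.eval_mul, mul_smul]
  map_zero' := AddMonoidHom.ext fun m => funext fun k => by
    change Polynomial.eval k 0 • m k = 0; simp
  map_add' p q := AddMonoidHom.ext fun m => funext fun k => by
    change Polynomial.eval k (p + q) • m k = Polynomial.eval k p • m k + Polynomial.eval k q • m k
    rw [Polynomial.eval_add, add_smul]

@[simp] theorem polOp_apply (p : Polynomial ℤ) (m : ℤ → M) (l : ℤ) :
    polOp p m l = p.eval l • m l := rfl

theorem shiftOp_mul (k l : ℤ) : (shiftOp k * shiftOp l : AddMonoid.End (ℤ → M)) = shiftOp (k + l) := by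
  ext m i; simp [add_assoc]

theorem shiftOp_mul_polOp (k : ℤ) (p : Polynomial ℤ) :
    (shiftOp k * polOp p : AddMonoid.End (ℤ → M)) =
      polOp (p.comp (Polynomial.X + Polynomial.C k)) * shiftOp k := by
  ext m i; simp

theorem shiftOp_mul_diag (k : ℤ) (s : AddMonoid.End M) :
    shiftOp k * diag s = diag s * shiftOp k := by
  ext m i; simp

theorem polOp_mul_diag (p : Polynomial ℤ) (s : AddMonoid.End M) :
    polOp p * diag s = diag s * polOp p := by
  ext m i; simp

/-- The ring of band operators on sequences generated by a ring of operators, the shifts and the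
index operator. -/
def bandRing (S : Subring (AddMonoid.End M)) : Subring (AddMonoid.End (ℤ → M)) :=
  Subring.closure (insert (polOp Polynomial.X) (insert (shiftOp (-1)) (insert (shiftOp 1) (diag '' S))))

theorem closure_diag (S : Subring (AddMonoid.End M)) :
    Subring.closure (diag '' (S : Set (AddMonoid.End M))) = S.map diag := by
  rw [← Subring.coe_map, Subring.closure_eq]

theorem isNoetherianRing_bandRing (S : Subring (AddMonoid.End M)) [hS : IsNoetherianRing S] :
    IsNoetherianRing (bandRing S) := by
  have h0 : IsNoetherianRing (Subring.closure (diag '' (S : Set (AddMonoid.End M)))) := by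
    rw [closure_diag]
    refine isNoetherianRing_of_surjective S (S.map diag)
      ((diag.comp S.subtype).codRestrict (S.map diag) fun x => ⟨x, x.2, rfl⟩) ?_
    rintro ⟨_, x, hx, rfl⟩
    exact ⟨⟨x, hx⟩, rfl⟩
  refine isNoetherianRing_closure_insert ?_ (isNoetherianRing_closure_insert ?_
    (isNoetherianRing_closure_insert ?_ h0))
  · rintro g (rfl | rfl | ⟨s, hs, rfl⟩)
    · rw [shiftOp_mul_polOp]
      have : polOp Polynomial.X * shiftOp (-1) -
          polOp (Polynomial.X.comp (Polynomial.X + Polynomial.C (-1))) * shiftOp (-1) =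
            (shiftOp (-1) : AddMonoid.End (ℤ → M)) :=
        AddMonoidHom.ext fun m => funext fun k => by
          change (Polynomial.X : Polynomial ℤ).eval k • m (k + -1) -
            (Polynomial.X.comp (Polynomial.X + Polynomial.C (-1)) : Polynomial ℤ).eval k • m (k + -1) =
              m (k + -1)
          rw [← sub_smul]; simp
      rw [this]
      exact Subring.subset_closure (Set.mem_insert _ _)
    · rw [shiftOp_mul_polOp]
      have : polOp Polynomial.X * shiftOp 1 -
          polOp (Polynomial.X.comp (Polynomial.X + Polynomial.C 1)) * shiftOp 1 =
            -(shiftOp 1 : AddMonoid.End (ℤ → M)) :=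
        AddMonoidHom.ext fun m => funext fun k => by
          change (Polynomial.X : Polynomial ℤ).eval k • m (k + 1) -
            (Polynomial.X.comp (Polynomial.X + Polynomial.C 1) : Polynomial ℤ).eval k • m (k + 1) =
              -m (k + 1)
          rw [← sub_smul]; simp
      rw [this]
      exact neg_mem (Subring.subset_closure (Set.mem_insert_of_mem _ (Set.mem_insert _ _)))
    · rw [polOp_mul_diag, sub_self]; exact zero_mem _
  · rintro g (rfl | ⟨s, hs, rfl⟩)
    · rw [shiftOp_mul, shiftOp_mul, add_comm, sub_self]; exact zero_mem _
    · rw [shiftOp_mul_diag, sub_self]; exact zero_mem _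
  · rintro g ⟨s, hs, rfl⟩
    rw [shiftOp_mul_diag, sub_self]; exact zero_mem _

variable {S : Subring (AddMonoid.End M)}

theorem diag_mem_bandRing {s : AddMonoid.End M} (hs : s ∈ S) : diag s ∈ bandRing S :=
  Subring.subset_closure (by right; right; right; exact ⟨s, hs, rfl⟩)

theorem shiftOp_mem_bandRing (k : ℤ) : shiftOp k ∈ bandRing S := by
  have h1 : shiftOp 1 ∈ bandRing S := Subring.subset_closure (by right; right; left; rfl)
  have h2 : shiftOp (-1) ∈ bandRing S := Subring.subset_closure (by right; left; rfl)
  have h0 : (shiftOp 0 : AddMonoid.End (ℤ → M)) = 1 := by ext; simp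
  induction k using Int.induction_on with
  | zero => rw [h0]; exact one_mem _
  | succ k ih => rw [← shiftOp_mul]; exact mul_mem ih h1
  | pred k ih => rw [sub_eq_add_neg, ← shiftOp_mul]; exact mul_mem ih h2

theorem polOp_mem_bandRing (p : Polynomial ℤ) : polOp p ∈ bandRing S := by
  have h1 : polOp Polynomial.X ∈ bandRing S := Subring.subset_closure (by left; rfl)
  induction p using Polynomial.induction_on with
  | C a => simp
  | add p q hp hq => rw [map_add]; exact add_mem hp hq
  | monomial n a h => rw [pow_succ, ← mul_assoc, map_mul]; exact mul_mem h h1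

/-- Induction for the band ring. -/
theorem bandRing_induction {P : AddMonoid.End (ℤ → M) → Prop}
    (hdiag : ∀ s ∈ S, P (diag s)) (hshift : ∀ k, P (shiftOp k)) (hpol : ∀ p, P (polOp p))
    (hadd : ∀ a b, P a → P b → P (a + b)) (hneg : ∀ a, P a → P (-a))
    (hmul : ∀ a ∈ bandRing S, ∀ b ∈ bandRing S, P a → P b → P (a * b))
    {A : AddMonoid.End (ℤ → M)} (hA : A ∈ bandRing S) : P A := by
  induction hA using Subring.closure_induction with
  | mem x h =>
    rcases h with rfl | rfl | rfl | ⟨s, hs, rfl⟩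
    · exact hpol _
    · exact hshift _
    · exact hshift _
    · exact hdiag s hs
  | zero => simpa using hpol 0
  | one => simpa using hpol 1
  | add a b _ _ ha hb => exact hadd a b ha hb
  | neg a _ ha => exact hneg a ha
  | mul a b h h' ha hb => exact hmul a h b h' ha hb

theorem bandRing_band {A : AddMonoid.End (ℤ → M)} (hA : A ∈ bandRing S) :
    ∃ w : ℕ, (∀ (p : ℤ) (m : ℤ → M), (∀ k ≥ p, m k = 0) → ∀ k ≥ p + w, A m k = 0) ∧
      (∀ (p : ℤ) (m : ℤ → M), (∀ k ≤ p, m k = 0) → ∀ k ≤ p - w, A m k = 0) := by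
  refine bandRing_induction (S := S) (P := fun A => ∃ w : ℕ,
      (∀ (p : ℤ) (m : ℤ → M), (∀ k ≥ p, m k = 0) → ∀ k ≥ p + w, A m k = 0) ∧
      (∀ (p : ℤ) (m : ℤ → M), (∀ k ≤ p, m k = 0) → ∀ k ≤ p - w, A m k = 0)) ?_ ?_ ?_ ?_ ?_ ?_ hA
  · intro s hs
    exact ⟨0, fun p m h k hk => by simp [h k (by simpa using hk)],
      fun p m h k hk => by simp [h k (by simpa using hk)]⟩
  · intro l
    exact ⟨l.natAbs, fun p m h k hk => h _ (by omega), fun p m h k hk => h _ (by omega)⟩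
  · intro q
    exact ⟨0, fun p m h k hk => by simp [h k (by simpa using hk)],
      fun p m h k hk => by simp [h k (by simpa using hk)]⟩
  · intro a b ha hb
    obtain ⟨w, h1, h2⟩ := ha
    obtain ⟨w', h1', h2'⟩ := hb
    refine ⟨max w w', fun p m h k hk => ?_, fun p m h k hk => ?_⟩
    · change a m k + b m k = 0
      rw [h1 p m h k (by push_cast at hk; omega), h1' p m h k (by push_cast at hk; omega), add_zero]
    · change a m k + b m k = 0
      rw [h2 p m h k (by push_cast at hk; omega), h2' p m h k (by push_cast at hk; omega), add_zero]
  · intro a ha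
    obtain ⟨w, h1, h2⟩ := ha
    exact ⟨w, fun p m h k hk => neg_eq_zero.2 (h1 p m h k hk),
      fun p m h k hk => neg_eq_zero.2 (h2 p m h k hk)⟩
  · intro a _ b _ ha hb
    obtain ⟨w, h1, h2⟩ := ha
    obtain ⟨w', h1', h2'⟩ := hb
    refine ⟨w' + w, fun p m h k hk => ?_, fun p m h k hk => ?_⟩
    · exact h1 (p + w') _ (h1' p m h) k (by push_cast at hk; omega)
    · exact h2 (p - w') _ (h2' p m h) k (by push_cast at hk; omega)


/-- Additive maps from sequences to entries which are finite combinations of entries with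
coefficients in `S`. -/
def rows (S : Subring (AddMonoid.End M)) : AddSubgroup ((ℤ → M) →+ M) :=
  AddSubgroup.closure {φ | ∃ s ∈ S, ∃ l : ℤ, φ = AddMonoidHom.comp s (Pi.evalAddMonoidHom (fun _ => M) l)}

theorem eval_comp_mem_rows {A : AddMonoid.End (ℤ → M)} (hA : A ∈ bandRing S) (k : ℤ) :
    AddMonoidHom.comp (Pi.evalAddMonoidHom (fun _ => M) k) A ∈ rows S := by
  have key : ∀ {A : AddMonoid.End (ℤ → M)}, A ∈ bandRing S → ∀ φ ∈ rows S,
      AddMonoidHom.comp φ A ∈ rows S := by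
    intro A hA
    refine bandRing_induction (S := S) (P := fun A => ∀ φ ∈ rows S,
      AddMonoidHom.comp φ A ∈ rows S) ?_ ?_ ?_ ?_ ?_ ?_ hA
    · intro s hs φ hφ
      induction hφ using AddSubgroup.closure_induction with
      | mem x h =>
        obtain ⟨s', hs', l, rfl⟩ := h
        exact AddSubgroup.subset_closure ⟨s' * s, mul_mem hs' hs, l, rfl⟩
      | zero => exact zero_mem _
      | add x y _ _ hx hy => exact add_mem hx hy
      | neg x _ hx => exact neg_mem hx
    · intro k φ hφ
      induction hφ using AddSubgroup.closure_induction with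
      | mem x h =>
        obtain ⟨s', hs', l, rfl⟩ := h
        exact AddSubgroup.subset_closure ⟨s', hs', l + k, rfl⟩
      | zero => exact zero_mem _
      | add x y _ _ hx hy => exact add_mem hx hy
      | neg x _ hx => exact neg_mem hx
    · intro p φ hφ
      induction hφ using AddSubgroup.closure_induction with
      | mem x h =>
        obtain ⟨s', hs', l, rfl⟩ := h
        refine AddSubgroup.subset_closure ⟨s' * (p.eval l : ℤ), mul_mem hs' (intCast_mem _ _), l, ?_⟩
        ext m
        change s' (p.eval l • m l) = s' (((p.eval l : ℤ) : AddMonoid.End M) (m l))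
        simp
      | zero => exact zero_mem _
      | add x y _ _ hx hy => exact add_mem hx hy
      | neg x _ hx => exact neg_mem hx
    · intro a b ha hb φ hφ
      have : AddMonoidHom.comp φ (a + b) = AddMonoidHom.comp φ a + AddMonoidHom.comp φ b := by
        exact AddMonoidHom.comp_add φ a b
      rw [this]; exact add_mem (ha φ hφ) (hb φ hφ)
    · intro a ha φ hφ
      have : AddMonoidHom.comp φ (-a) = -(AddMonoidHom.comp φ a) := by
        apply AddMonoidHom.ext; intro m; exact map_neg φ _
      rw [this]; exact neg_mem (ha φ hφ)
    · intro a _ b _ ha hb φ hφ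
      exact hb _ (ha φ hφ)
  refine key hA _ (AddSubgroup.subset_closure ⟨1, one_mem _, k, rfl⟩)

theorem exists_forall_eq_of_mem_rows {φ : (ℤ → M) →+ M} (hφ : φ ∈ rows S) (n : ℤ) :
    ∃ s ∈ S, ∀ m, φ (Pi.single n m) = s m := by
  induction hφ using AddSubgroup.closure_induction with
  | mem x h =>
    obtain ⟨s', hs', l, rfl⟩ := h
    by_cases h : l = n
    · subst h; exact ⟨s', hs', fun m => congrArg s' (Pi.single_eq_same _ _)⟩
    · exact ⟨0, zero_mem _, fun m => (congrArg s' (Pi.single_eq_of_ne h _)).trans (map_zero s')⟩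
  | zero => exact ⟨0, zero_mem _, fun m => rfl⟩
  | add x y _ _ hx hy =>
    obtain ⟨s, hs, h⟩ := hx
    obtain ⟨s', hs', h'⟩ := hy
    exact ⟨s + s', add_mem hs hs', fun m => congrArg₂ (· + ·) (h m) (h' m)⟩
  | neg x _ hx =>
    obtain ⟨s, hs, h⟩ := hx
    exact ⟨-s, neg_mem hs, fun m => congrArg (- ·) (h m)⟩

theorem exists_mem_span_of_mem_rows {φ : (ℤ → M) →+ M} (hφ : φ ∈ rows S) :
    ∃ K : ℕ, ∀ m : ℤ → M, φ m ∈ Submodule.span S (m '' {l | |l| ≤ K}) := by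
  induction hφ using AddSubgroup.closure_induction with
  | mem x h =>
    obtain ⟨s', hs', l, rfl⟩ := h
    refine ⟨l.natAbs, fun m => ?_⟩
    exact Submodule.smul_mem _ (⟨s', hs'⟩ : S) (Submodule.subset_span ⟨l, by simp, rfl⟩)
  | zero => exact ⟨0, fun m => zero_mem _⟩
  | add x y _ _ hx hy =>
    obtain ⟨K, h⟩ := hx
    obtain ⟨K', h'⟩ := hy
    refine ⟨max K K', fun m => add_mem ?_ ?_⟩
    · exact Submodule.span_mono (Set.image_mono fun l hl => by simp at hl ⊢; left; exact hl) (h m)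
    · exact Submodule.span_mono (Set.image_mono fun l hl => by simp at hl ⊢; right; exact hl) (h' m)
  | neg x _ hx =>
    obtain ⟨K, h⟩ := hx
    exact ⟨K, fun m => neg_mem (h m)⟩

end Sequences

section Filtrations
variable {M : Type*} [AddCommGroup M]

/-- Band operators preserving the sequences supported in negative degrees. -/
def upperRing (S : Subring (AddMonoid.End M)) : Subring (AddMonoid.End (ℤ → M)) where
  carrier := {A | A ∈ bandRing S ∧ ∀ m : ℤ → M, (∀ k ≥ 0, m k = 0) → ∀ k ≥ 0, A m k = 0}
  mul_mem' ha hb := ⟨mul_mem ha.1 hb.1, fun m hm => ha.2 _ (hb.2 m hm)⟩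
  one_mem' := ⟨one_mem _, fun _ hm => hm⟩
  add_mem' ha hb := ⟨add_mem ha.1 hb.1, fun m hm k hk =>
    (congrArg₂ (· + ·) (ha.2 m hm k hk) (hb.2 m hm k hk)).trans (add_zero 0)⟩
  zero_mem' := ⟨zero_mem _, fun _ _ _ _ => rfl⟩
  neg_mem' ha := ⟨neg_mem ha.1, fun m hm k hk => neg_eq_zero.2 (ha.2 m hm k hk)⟩

/-- Band operators preserving the sequences supported in positive degrees. -/
def lowerRing (S : Subring (AddMonoid.End M)) : Subring (AddMonoid.End (ℤ → M)) where
  carrier := {A | A ∈ bandRing S ∧ ∀ m : ℤ → M, (∀ k ≤ 0, m k = 0) → ∀ k ≤ 0, A m k = 0}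
  mul_mem' ha hb := ⟨mul_mem ha.1 hb.1, fun m hm => ha.2 _ (hb.2 m hm)⟩
  one_mem' := ⟨one_mem _, fun _ hm => hm⟩
  add_mem' ha hb := ⟨add_mem ha.1 hb.1, fun m hm k hk =>
    (congrArg₂ (· + ·) (ha.2 m hm k hk) (hb.2 m hm k hk)).trans (add_zero 0)⟩
  zero_mem' := ⟨zero_mem _, fun _ _ _ _ => rfl⟩
  neg_mem' ha := ⟨neg_mem ha.1, fun m hm k hk => neg_eq_zero.2 (ha.2 m hm k hk)⟩

variable {S : Subring (AddMonoid.End M)}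

theorem diag_mem_upperRing {s : AddMonoid.End M} (hs : s ∈ S) : diag s ∈ upperRing S :=
  ⟨diag_mem_bandRing hs, fun m hm k hk => by rw [diag_apply, hm k hk, map_zero]⟩

theorem diag_mem_lowerRing {s : AddMonoid.End M} (hs : s ∈ S) : diag s ∈ lowerRing S :=
  ⟨diag_mem_bandRing hs, fun m hm k hk => by rw [diag_apply, hm k hk, map_zero]⟩

theorem polOp_mem_upperRing (p : Polynomial ℤ) : polOp p ∈ upperRing S :=
  ⟨polOp_mem_bandRing p, fun m hm k hk => by rw [polOp_apply, hm k hk, smul_zero]⟩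

theorem polOp_mem_lowerRing (p : Polynomial ℤ) : polOp p ∈ lowerRing S :=
  ⟨polOp_mem_bandRing p, fun m hm k hk => by rw [polOp_apply, hm k hk, smul_zero]⟩

theorem shiftOp_mem_upperRing {k : ℤ} (h : 0 ≤ k) : shiftOp k ∈ upperRing S :=
  ⟨shiftOp_mem_bandRing k, fun m hm l hl => hm _ (by omega)⟩

theorem shiftOp_mem_lowerRing {k : ℤ} (h : k ≤ 0) : shiftOp k ∈ lowerRing S :=
  ⟨shiftOp_mem_bandRing k, fun m hm l hl => hm _ (by omega)⟩

theorem polOp_mul_shiftOp_mem_upperRing {p : Polynomial ℤ} {k : ℤ}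
    (h : ∀ l, 0 ≤ l → l + k < 0 → p.eval l = 0) : polOp p * shiftOp k ∈ upperRing S := by
  refine ⟨mul_mem (polOp_mem_bandRing p) (shiftOp_mem_bandRing k), fun m hm l hl => ?_⟩
  change p.eval l • m (l + k) = 0
  by_cases h' : l + k < 0
  · rw [h l hl h', zero_smul]
  · rw [hm _ (by omega), smul_zero]

theorem polOp_mul_shiftOp_mem_lowerRing {p : Polynomial ℤ} {k : ℤ}
    (h : ∀ l, l ≤ 0 → 0 < l + k → p.eval l = 0) : polOp p * shiftOp k ∈ lowerRing S := by
  refine ⟨mul_mem (polOp_mem_bandRing p) (shiftOp_mem_bandRing k), fun m hm l hl => ?_⟩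
  change p.eval l • m (l + k) = 0
  by_cases h' : 0 < l + k
  · rw [h l hl h', zero_smul]
  · rw [hm _ (by omega), smul_zero]

/-- Every band operator is a sum of monomial ones. -/
theorem mem_closure_monomials {A : AddMonoid.End (ℤ → M)} (hA : A ∈ bandRing S) :
    A ∈ AddSubgroup.closure {B : AddMonoid.End (ℤ → M) | ∃ s ∈ S, ∃ p k,
      B = diag s * (polOp p * shiftOp k)} := by
  have h0 : (shiftOp 0 : AddMonoid.End (ℤ → M)) = 1 := by ext; simp
  refine bandRing_induction (S := S) (P := fun A => A ∈ AddSubgroup.closure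
    {B : AddMonoid.End (ℤ → M) | ∃ s ∈ S, ∃ p k, B = diag s * (polOp p * shiftOp k)})
    ?_ ?_ ?_ ?_ ?_ ?_ hA
  · exact fun s hs => AddSubgroup.subset_closure ⟨s, hs, 1, 0, by rw [map_one, h0, one_mul, mul_one]⟩
  · exact fun k => AddSubgroup.subset_closure ⟨1, one_mem _, 1, k, by rw [map_one, map_one, one_mul, one_mul]⟩
  · exact fun p => AddSubgroup.subset_closure ⟨1, one_mem _, p, 0, by rw [map_one, h0, one_mul, mul_one]⟩
  · exact fun a b ha hb => add_mem ha hb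
  · exact fun a ha => neg_mem ha
  · intro a _ b _ ha hb
    refine AddSubgroup.closure_induction₂ (p := fun a b _ _ => a * b ∈ AddSubgroup.closure
      {B : AddMonoid.End (ℤ → M) | ∃ s ∈ S, ∃ p k, B = diag s * (polOp p * shiftOp k)})
      ?_ ?_ ?_ ?_ ?_ ?_ ?_ ha hb
    · rintro _ _ ⟨s, hs, p, k, rfl⟩ ⟨s', hs', p', k', rfl⟩
      refine AddSubgroup.subset_closure ⟨s * s', mul_mem hs hs',
        p * p'.comp (Polynomial.X + Polynomial.C k), k + k', ?_⟩
      calc diag s * (polOp p * shiftOp k) * (diag s' * (polOp p' * shiftOp k'))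
          = diag s * polOp p * (shiftOp k * diag s') * polOp p' * shiftOp k' := by
            simp only [mul_assoc]
        _ = diag s * (polOp p * diag s') * (shiftOp k * polOp p') * shiftOp k' := by
            rw [shiftOp_mul_diag]; simp only [mul_assoc]
        _ = diag s * diag s' * (polOp p * polOp (p'.comp (Polynomial.X + Polynomial.C k))) *
              (shiftOp k * shiftOp k') := by
            rw [shiftOp_mul_polOp, polOp_mul_diag]; simp only [mul_assoc]
        _ = _ := by rw [shiftOp_mul, ← map_mul, ← map_mul, mul_assoc]
    · intro x _; simp
    · intro x _; simp
    · intro x y z _ _ _ h1 h2; rw [add_mul]; exact add_mem h1 h2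
    · intro x y z _ _ _ h1 h2; rw [mul_add]; exact add_mem h1 h2
    · intro x y _ _ h; exact neg_mem h
    · intro x y _ _ h; 
      have e : x * -y = -(x * y) := AddMonoidHom.ext fun m => map_neg x (y m)
      exact e ▸ neg_mem h

theorem exists_upperRing_apply_mem_span {A : AddMonoid.End (ℤ → M)} (hA : A ∈ upperRing S) :
    ∃ K : ℕ, ∀ u : ℤ → M, A u 0 ∈ Submodule.span S (u '' Set.Icc 0 (K : ℤ)) := by
  obtain ⟨K, hK⟩ := exists_mem_span_of_mem_rows (eval_comp_mem_rows hA.1 0)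
  refine ⟨K, fun u => ?_⟩
  have h1 : A u 0 = A (fun k => if 0 ≤ k then u k else 0) 0 := by
    have h2 := hA.2 (u - fun k => if 0 ≤ k then u k else 0)
      (fun k hk => by simp [show (0:ℤ) ≤ k from hk]) 0 le_rfl
    rw [map_sub, Pi.sub_apply, sub_eq_zero] at h2
    exact h2
  rw [h1]
  refine (Submodule.span_le.2 ?_) (hK _)
  rintro _ ⟨l, hl, rfl⟩
  by_cases h : 0 ≤ l
  · simp only [if_pos h]
    exact Submodule.subset_span ⟨l, ⟨h, (abs_le.1 hl).2⟩, rfl⟩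
  · simp only [if_neg h]; exact zero_mem _

theorem upperRing_lowerRing_apply {A : AddMonoid.End (ℤ → M)} (h0 : A ∈ upperRing S)
    (h1 : A ∈ lowerRing S) (u : ℤ → M) : ∃ s ∈ S, A u 0 = s (u 0) := by
  obtain ⟨s, hs, h⟩ := exists_forall_eq_of_mem_rows (eval_comp_mem_rows h0.1 0) 0
  refine ⟨s, hs, ?_⟩
  have hu : u = (fun k => if k < 0 then u k else 0) + Pi.single 0 (u 0) +
      fun k => if 0 < k then u k else 0 := by
    ext k
    rcases lt_trichotomy k 0 with hk | hk | hk
    · simp [hk, hk.ne, hk.not_gt]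
    · subst hk; simp
    · simp [hk, hk.ne', hk.not_gt]
  conv_lhs => rw [hu]
  rw [map_add, map_add, Pi.add_apply, Pi.add_apply,
    h0.2 _ (fun k hk => if_neg (by omega)) 0 le_rfl, h1.2 _ (fun k hk => if_neg (by omega)) 0 le_rfl,
    zero_add, add_zero]
  exact h (u 0)

end Filtrations

section Bounded
variable {M : Type*} [AddCommGroup M]

/-- Operators on sequences as a module over a ring of operators acting componentwise. -/
abbrev diagModule (S : Subring (AddMonoid.End M)) : Module S (AddMonoid.End (ℤ → M)) :=
  Module.compHom _ (diag.comp S.subtype)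

variable (S : Subring (AddMonoid.End M))

attribute [local instance] diagModule

theorem diag_smul_eq (s : S) (A : AddMonoid.End (ℤ → M)) : s • A = diag s.1 * A := rfl

/-- `upperRing` as a left module over the coefficient ring. -/
def upperModule : Submodule S (AddMonoid.End (ℤ → M)) where
  carrier := upperRing S
  add_mem' := add_mem
  zero_mem' := zero_mem _
  smul_mem' s _ h := mul_mem (diag_mem_upperRing s.2) h

/-- `lowerRing` as a left module over the coefficient ring. -/
def lowerModule : Submodule S (AddMonoid.End (ℤ → M)) where
  carrier := lowerRing S
  add_mem' := add_mem
  zero_mem' := zero_mem _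
  smul_mem' s _ h := mul_mem (diag_mem_lowerRing s.2) h

/-- Operators killing a given sequence. -/
def annModule (u : ℤ → M) : Submodule S (AddMonoid.End (ℤ → M)) where
  carrier := {A | A u = 0}
  add_mem' ha hb := (congrArg₂ (· + ·) ha hb).trans (add_zero 0)
  zero_mem' := rfl
  smul_mem' s A h := by
    change diag s.1 (A u) = 0
    rw [show A u = 0 from h, map_zero]

/-- Operators in `upperRing` mapping a given sequence to one whose entry at `0` is a combination of
the entries in `[0, K]`. -/
def boundedModule (u : ℤ → M) (K : ℕ) : Submodule S (AddMonoid.End (ℤ → M)) where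
  carrier := {A | A ∈ upperRing S ∧ A u 0 ∈ Submodule.span S (u '' Set.Icc 0 (K : ℤ))}
  add_mem' ha hb := ⟨add_mem ha.1 hb.1, add_mem ha.2 hb.2⟩
  zero_mem' := ⟨zero_mem _, zero_mem _⟩
  smul_mem' s _ h := ⟨mul_mem (diag_mem_upperRing s.2) h.1, Submodule.smul_mem _ s h.2⟩

variable {S}

theorem boundedModule_mono (u : ℤ → M) {K K' : ℕ} (h : K ≤ K') :
    boundedModule S u K ≤ boundedModule S u K' := fun A hA =>
  ⟨hA.1, Submodule.span_mono (Set.image_mono (Set.Icc_subset_Icc_right (by exact_mod_cast h))) hA.2⟩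

theorem exists_desc (w : ℕ) : ∃ p : Polynomial ℤ, p.Monic ∧ ∀ l : ℤ, 0 ≤ l → l < w → p.eval l = 0 := by
  refine ⟨∏ j ∈ Finset.range w, (Polynomial.X - Polynomial.C (j : ℤ)),
    Polynomial.monic_prod_of_monic _ _ fun j _ => Polynomial.monic_X_sub_C _, fun l h0 h1 => ?_⟩
  rw [Polynomial.eval_prod]
  exact Finset.prod_eq_zero (i := l.toNat) (by simp; omega) (by simp [h0])

theorem exists_finset_ann_le [IsNoetherianRing S] (u : ℤ → M) :
    ∃ E : Finset (AddMonoid.End (ℤ → M)), ∀ A ∈ bandRing S, A u = 0 →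
      A ∈ (upperModule S ⊓ annModule S u) ⊔ (lowerModule S ⊓ annModule S u) ⊔
        Submodule.span S (E : Set (AddMonoid.End (ℤ → M))) := by
  classical
  have := isNoetherianRing_bandRing S
  let J : Submodule (bandRing S) (bandRing S) :=
    { carrier := {A | A.1 u = 0}
      add_mem' := fun ha hb => (congrArg₂ (· + ·) ha hb).trans (add_zero 0)
      zero_mem' := rfl
      smul_mem' := fun c A h => by
        change c.1 (A.1 u) = 0
        rw [show A.1 u = 0 from h, map_zero] }
  obtain ⟨t, ht⟩ := IsNoetherian.noetherian J
  have htu : ∀ g ∈ t, g.1 u = 0 := fun g hg => by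
    have : g ∈ J := ht ▸ Submodule.subset_span hg
    exact this
  have hw : ∃ w : ℕ, ∀ g ∈ t, ∀ k : ℤ, ((w : ℤ) ≤ k → shiftOp k * g.1 ∈ upperRing S) ∧
      (k ≤ -(w : ℤ) → shiftOp k * g.1 ∈ lowerRing S) := by
    choose w hw hw' using fun g : bandRing S => bandRing_band g.2
    refine ⟨t.sup w, fun g hg k => ?_⟩
    have h := Finset.le_sup (f := w) hg
    refine ⟨fun hk => ⟨mul_mem (shiftOp_mem_bandRing k) g.2, fun m hm l hl => ?_⟩,
      fun hk => ⟨mul_mem (shiftOp_mem_bandRing k) g.2, fun m hm l hl => ?_⟩⟩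
    · exact hw g 0 m hm _ (by omega)
    · exact hw' g 0 m hm _ (by omega)
  obtain ⟨w, hw⟩ := hw
  obtain ⟨q, hq, hq0⟩ := exists_desc (2 * w)
  refine ⟨((t ×ˢ Finset.Ioo (-(w : ℤ)) w) ×ˢ Finset.range q.natDegree).image fun x =>
    polOp (Polynomial.X ^ x.2) * (shiftOp x.1.2 * x.1.1.1), fun A hA hAu => ?_⟩
  set E := ((t ×ˢ Finset.Ioo (-(w : ℤ)) w) ×ˢ Finset.range q.natDegree).image fun x =>
    polOp (Polynomial.X ^ x.2) * (shiftOp x.1.2 * x.1.1.1) with hE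
  set Q := (upperModule S ⊓ annModule S u) ⊔ (lowerModule S ⊓ annModule S u) ⊔
        Submodule.span S (E : Set (AddMonoid.End (ℤ → M))) with hQ
  have hup : ∀ B ∈ upperRing S, B u = 0 → B ∈ Q := fun B h1 h2 =>
    Submodule.mem_sup_left (Submodule.mem_sup_left ⟨h1, h2⟩)
  have hlo : ∀ B ∈ lowerRing S, B u = 0 → B ∈ Q := fun B h1 h2 =>
    Submodule.mem_sup_left (Submodule.mem_sup_right ⟨h1, h2⟩)
  have hzero : ∀ (B : AddMonoid.End (ℤ → M)), ∀ g ∈ t, (B * g.1) u = 0 := fun B g hg => by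
    change B (g.1 u) = 0
    rw [htu g hg, map_zero]
  have hpol : ∀ g ∈ t, ∀ (p : Polynomial ℤ) (k : ℤ), polOp p * (shiftOp k * g.1) ∈ Q := by
    intro g hg p k
    have hz : ∀ p : Polynomial ℤ, (polOp p * (shiftOp k * g.1) : AddMonoid.End (ℤ → M)) u = 0 := fun p => by
      rw [← mul_assoc]; exact hzero _ g hg
    by_cases h1 : (w : ℤ) ≤ k
    · exact hup _ (mul_mem (polOp_mem_upperRing p) ((hw g hg k).1 h1)) (hz p)
    by_cases h2 : k ≤ -(w : ℤ)
    · exact hlo _ (mul_mem (polOp_mem_lowerRing p) ((hw g hg k).2 h2)) (hz p)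
    rw [← Polynomial.modByMonic_add_div p q, map_add, add_mul]
    refine add_mem (Submodule.mem_sup_right ?_) (hup _ ?_ (hz _))
    · have hsum := Polynomial.as_sum_range' (p %ₘ q) q.natDegree
      by_cases hd : q.natDegree = 0
      · have : q = 1 := hq.natDegree_eq_zero.1 hd
        rw [this, Polynomial.modByMonic_one, map_zero, zero_mul]; exact zero_mem _
      rw [hsum (Polynomial.natDegree_modByMonic_lt p hq fun h => hd (by rw [h]; simp)), map_sum,
        Finset.sum_mul]
      refine sum_mem fun l hl => ?_
      rw [← Polynomial.C_mul_X_pow_eq_monomial]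
      have e : polOp (Polynomial.C ((p %ₘ q).coeff l) * Polynomial.X ^ l) * (shiftOp k * g.1) =
          ((p %ₘ q).coeff l : S) • (polOp (Polynomial.X ^ l) * (shiftOp k * g.1)) := by
        rw [map_mul, mul_assoc, diag_smul_eq]
        congr 1
        simp
      rw [e]
      refine Submodule.smul_mem _ _ (Submodule.subset_span ?_)
      rw [hE, Finset.coe_image]
      exact ⟨((g, k), l), by simp [hg, Finset.mem_range.1 hl]; omega, rfl⟩
    · rw [mul_comm q, map_mul]
      have e : polOp (p /ₘ q) * polOp q * (shiftOp k * g.1) =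
          polOp (p /ₘ q) * ((polOp q * shiftOp (k - w)) * (shiftOp w * g.1)) := by
        have : (shiftOp k : AddMonoid.End (ℤ → M)) = shiftOp (k - w) * shiftOp w := by
          rw [shiftOp_mul]; congr 1; ring
        rw [this]; simp only [mul_assoc]
      rw [e]
      refine mul_mem (polOp_mem_upperRing _) (mul_mem (polOp_mul_shiftOp_mem_upperRing ?_)
        ((hw g hg w).1 le_rfl))
      intro l hl hl'
      exact hq0 l hl (by push_cast; omega)
  have hall : ∀ g ∈ t, ∀ B ∈ bandRing S, B * g.1 ∈ Q := by
    intro g hg B hB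
    have hB' := mem_closure_monomials hB
    clear hB
    induction hB' using AddSubgroup.closure_induction with
    | mem x h =>
      obtain ⟨s, hs, p, k, rfl⟩ := h
      rw [mul_assoc, mul_assoc]
      exact Q.smul_mem (⟨s, hs⟩ : S) (hpol g hg p k)
    | zero => rw [zero_mul]; exact zero_mem _
    | add x y _ _ hx hy => rw [add_mul]; exact add_mem hx hy
    | neg x _ hx => exact neg_mem hx
  have hAJ : (⟨A, hA⟩ : bandRing S) ∈ Submodule.span (bandRing S) (t : Set (bandRing S)) :=
    ht ▸ hAu
  have hgen : ∀ x ∈ Submodule.span (bandRing S) (t : Set (bandRing S)), x.1 ∈ Q := by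
    intro x hx
    induction hx using Submodule.span_induction with
    | mem x h => simpa using hall x h 1 (one_mem _)
    | zero => exact zero_mem _
    | add x y _ _ hx hy => exact add_mem hx hy
    | smul c x hx h =>
      clear hAJ h
      induction hx using Submodule.span_induction generalizing c with
      | mem x h => exact hall x h c.1 c.2
      | zero => rw [smul_zero]; exact zero_mem _
      | add x y _ _ hx hy => rw [smul_add]; exact add_mem (hx c) (hy c)
      | smul d x _ hx => rw [← mul_smul]; exact hx _
  exact hgen _ hAJ

/-- The key finiteness statement: a sequence which lies both in the upper and in the lower module
generated by `u` has its entry at `0` generated by a bounded number of entries of `u`. -/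
theorem exists_bound [IsNoetherianRing S] (u : ℤ → M) :
    ∃ K : ℕ, ∀ A ∈ upperRing S, ∀ A' ∈ lowerRing S, A u = A' u →
      A u 0 ∈ Submodule.span S (u '' Set.Icc 0 (K : ℤ)) := by
  obtain ⟨E, hE⟩ := exists_finset_ann_le (S := S) u
  set G := Submodule.span S (E : Set (AddMonoid.End (ℤ → M))) with hG
  have hGn : IsNoetherian S G := isNoetherian_span_of_finite S E.finite_toSet
  obtain ⟨t, ht⟩ := isNoetherian_submodule.1 hGn (G ⊓ (upperModule S ⊔ lowerModule S)) inf_le_left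
  have hK : ∃ K : ℕ, G ⊓ (upperModule S ⊔ lowerModule S) ≤ boundedModule S u K ⊔ lowerModule S := by
    have h1 : ∀ g : AddMonoid.End (ℤ → M), ∃ K : ℕ, g ∈ t → g ∈ boundedModule S u K ⊔ lowerModule S := by
      intro g
      by_cases hg : g ∈ t
      · have h2 : g ∈ G ⊓ (upperModule S ⊔ lowerModule S) := ht ▸ Submodule.subset_span hg
        obtain ⟨a, ha, b, hb, rfl⟩ := Submodule.mem_sup.1 h2.2
        obtain ⟨K, hK⟩ := exists_upperRing_apply_mem_span (S := S) (A := a) ha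
        exact ⟨K, fun _ => add_mem (Submodule.mem_sup_left ⟨ha, hK u⟩) (Submodule.mem_sup_right hb)⟩
      · exact ⟨0, fun h => absurd h hg⟩
    choose K hK using h1
    refine ⟨t.sup K, ?_⟩
    rw [← ht, Submodule.span_le]
    intro g hg
    exact sup_le_sup_right (boundedModule_mono u (Finset.le_sup (f := K) hg)) _ (hK g hg)
  obtain ⟨K, hK⟩ := hK
  refine ⟨K, fun A hA A' hA' h => ?_⟩
  obtain ⟨x, hx, w, hw, hxw⟩ := Submodule.mem_sup.1
    (hE (A - A') (sub_mem hA.1 hA'.1) (by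
      change A u - A' u = 0
      rw [h, sub_self]))
  obtain ⟨j0, hj0, j1, hj1, rfl⟩ := Submodule.mem_sup.1 hx
  have hw2 : w = (A - j0) + -(A' + j1) := by
    have : w = A - A' - (j0 + j1) := by rw [← hxw]; abel
    rw [this]; abel
  obtain ⟨a, ha, b, hb, hab⟩ := Submodule.mem_sup.1 (hK ⟨hw, hw2 ▸ Submodule.add_mem_sup
    (show A - j0 ∈ upperRing S from sub_mem hA hj0.1)
    (show -(A' + j1) ∈ lowerRing S from neg_mem (add_mem hA' hj1.1))⟩)
  have hB1 : A - j0 - a ∈ upperRing S := sub_mem (sub_mem hA hj0.1) ha.1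
  have hB2 : A - j0 - a ∈ lowerRing S := by
    have : A - j0 - a = A' + j1 + b := by
      have e : a + b = (A - j0) + -(A' + j1) := hab.trans hw2
      have e2 : A - j0 = a + b + (A' + j1) := by rw [e]; abel
      rw [e2]; abel
    rw [this]
    exact add_mem (add_mem hA' hj1.1) hb
  obtain ⟨s, hs, hsu⟩ := upperRing_lowerRing_apply hB1 hB2 u
  have e : A u 0 = (A - j0 - a) u 0 + a u 0 := by
    change A u 0 = (A u 0 - j0 u 0 - a u 0) + a u 0
    rw [show j0 u = 0 from hj0.2, Pi.zero_apply, sub_zero, sub_add_cancel]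
  rw [e, hsu]
  exact add_mem (Submodule.smul_mem _ (⟨s, hs⟩ : S) (Submodule.subset_span ⟨0, by simp, rfl⟩)) ha.2

theorem exists_bandRing_conj (τ : M ≃+ M)
    (hτ : ∀ s ∈ S, ∃ s' ∈ S, ∀ m, s (τ m) = τ (s' m)) {A : AddMonoid.End (ℤ → M)}
    (hA : A ∈ bandRing S) :
    ∃ A' ∈ bandRing S, ∀ m : ℤ → M, A (fun k => τ (m k)) = fun k => τ (A' m k) := by
  refine bandRing_induction (S := S) (P := fun A => ∃ A' ∈ bandRing S, ∀ m : ℤ → M,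
    A (fun k => τ (m k)) = fun k => τ (A' m k)) ?_ ?_ ?_ ?_ ?_ ?_ hA
  · intro s hs
    obtain ⟨s', hs', h⟩ := hτ s hs
    exact ⟨diag s', diag_mem_bandRing hs', fun m => funext fun k => h _⟩
  · exact fun k => ⟨shiftOp k, shiftOp_mem_bandRing k, fun m => rfl⟩
  · exact fun p => ⟨polOp p, polOp_mem_bandRing p, fun m => funext fun k => by simp⟩
  · rintro a b ⟨a', ha', ha⟩ ⟨b', hb', hb⟩
    refine ⟨a' + b', add_mem ha' hb', fun m => ?_⟩
    change a _ + b _ = fun k => τ (a' m k + b' m k)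
    rw [ha, hb]
    ext k
    simp
  · rintro a ⟨a', ha', ha⟩
    refine ⟨-a', neg_mem ha', fun m => ?_⟩
    change -(a _) = fun k => τ (-(a' m k))
    rw [ha]
    ext k
    simp
  · rintro a _ b _ ⟨a', ha', ha⟩ ⟨b', hb', hb⟩
    refine ⟨a' * b', mul_mem ha' hb', fun m => ?_⟩
    change a (b _) = fun k => τ (a' (b' m) k)
    rw [hb, ha]

theorem exists_upperRing_conj (τ : M ≃+ M)
    (hτ : ∀ s ∈ S, ∃ s' ∈ S, ∀ m, s (τ m) = τ (s' m)) {A : AddMonoid.End (ℤ → M)}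
    (hA : A ∈ upperRing S) :
    ∃ A' ∈ upperRing S, ∀ m : ℤ → M, A (fun k => τ (m k)) = fun k => τ (A' m k) := by
  obtain ⟨A', hA', h⟩ := exists_bandRing_conj τ hτ hA.1
  refine ⟨A', ⟨hA', fun m hm k hk => τ.injective ?_⟩, h⟩
  rw [map_zero, ← congrFun (h m) k]
  exact hA.2 _ (fun k hk => by simp [hm k hk]) k hk

theorem exists_lowerRing_conj (τ : M ≃+ M)
    (hτ : ∀ s ∈ S, ∃ s' ∈ S, ∀ m, s (τ m) = τ (s' m)) {A : AddMonoid.End (ℤ → M)}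
    (hA : A ∈ lowerRing S) :
    ∃ A' ∈ lowerRing S, ∀ m : ℤ → M, A (fun k => τ (m k)) = fun k => τ (A' m k) := by
  obtain ⟨A', hA', h⟩ := exists_bandRing_conj τ hτ hA.1
  refine ⟨A', ⟨hA', fun m hm k hk => τ.injective ?_⟩, h⟩
  rw [map_zero, ← congrFun (h m) k]
  exact hA.2 _ (fun k hk => by simp [hm k hk]) k hk

/-- The gluing lemma in abstract form. -/
theorem exists_prod_apply_eq [IsNoetherianRing S] (τ : M ≃+ M)
    (hτ : ∀ s ∈ S, ∃ s' ∈ S, ∀ m, s (τ m) = τ (s' m))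
    (hτ' : ∀ s ∈ S, ∃ s' ∈ S, ∀ m, τ (s m) = s' (τ m))
    (u : ℤ → M) (B P : ℕ → AddMonoid.End M)
    (hBτ : ∀ i m, B (i + 1) (τ m) = τ (B i m)) (hBc : ∀ s ∈ S, ∀ m, B 0 (s m) = s (B 0 m))
    (hP0 : P 0 = 1) (hP : ∀ i m, P (i + 1) m = B i (P i m))
    {A₀ A₁ : AddMonoid.End (ℤ → M)} (hA₀ : A₀ ∈ upperRing S) (hA₁ : A₁ ∈ lowerRing S)
    (h₀ : ∀ k, B 0 (u k) = τ (A₀ u k)) (h₁ : ∀ k, B 0 (u k) = τ (A₁ u k))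
    (hclear : ∀ k : ℕ, ∃ L, ∀ L' ≥ L, ∃ s ∈ S, τ^[L'] (u k) = s (u 0)) :
    ∃ N, ∃ s ∈ S, P N (u 0) = τ (s (u 0)) := by
  have hconj0 := fun A hA => exists_upperRing_conj (S := S) (A := A) τ hτ hA
  have hconj1 := fun A hA => exists_lowerRing_conj (S := S) (A := A) τ hτ hA
  have hBA : ∀ A ∈ bandRing S, ∀ m : ℤ → M, (fun k => B 0 (A m k)) = A fun k => B 0 (m k) := by
    intro A hA
    refine bandRing_induction (S := S) (P := fun A => ∀ m : ℤ → M,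
      (fun k => B 0 (A m k)) = A fun k => B 0 (m k)) ?_ ?_ ?_ ?_ ?_ ?_ hA
    · exact fun s hs m => funext fun k => hBc s hs _
    · exact fun k m => rfl
    · exact fun p m => funext fun k => by simp
    · intro a b ha hb m
      change (fun k => B 0 (a m k + b m k)) = (a fun k => B 0 (m k)) + b fun k => B 0 (m k)
      rw [← ha, ← hb]
      ext k
      simp
    · intro a ha m
      change (fun k => B 0 (-(a m k))) = -(a fun k => B 0 (m k))
      rw [← ha]
      ext k
      simp
    · intro a _ b _ ha hb m
      change (fun k => B 0 (a (b m) k)) = a (b fun k => B 0 (m k))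
      rw [← hb, ← ha]
  have hBiter : ∀ N m, B N (τ^[N] m) = τ^[N] (B 0 m) := by
    intro N
    induction N with
    | zero => exact fun m => rfl
    | succ N ih => intro m; rw [Function.iterate_succ_apply', hBτ, ih, Function.iterate_succ_apply']
  have key : ∀ N, ∃ A ∈ upperRing S, ∃ A' ∈ lowerRing S, A u = A' u ∧
      ∀ k, P N (u k) = τ^[N] (A u k) := by
    intro N
    induction N with
    | zero => exact ⟨1, one_mem _, 1, one_mem _, rfl, fun k => by rw [hP0]; rfl⟩
    | succ N ih =>
      obtain ⟨A, hA, A', hA', hAA', h⟩ := ih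
      obtain ⟨A2, hA2, h2⟩ := hconj0 A hA
      obtain ⟨A2', hA2', h2'⟩ := hconj1 A' hA'
      have e0 : (fun k => B 0 (A u k)) = fun k => τ (A2 (A₀ u) k) := by
        rw [hBA A hA.1, ← h2]
        congr 1
        exact funext h₀
      have e1 : (fun k => B 0 (A u k)) = fun k => τ (A2' (A₁ u) k) := by
        rw [hAA', hBA A' hA'.1, ← h2']
        congr 1
        exact funext h₁
      refine ⟨A2 * A₀, mul_mem hA2 hA₀, A2' * A₁, mul_mem hA2' hA₁, ?_, fun k => ?_⟩
      · ext k
        exact τ.injective (congrFun (e0.symm.trans e1) k)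
      · rw [hP, h, hBiter, Function.iterate_succ_apply]
        exact congrArg _ (congrFun e0 k)
  obtain ⟨K, hK⟩ := exists_bound (S := S) u
  have hτN : ∀ N : ℕ, ∀ s ∈ S, ∃ s' ∈ S, ∀ m, τ^[N] (s m) = s' (τ^[N] m) := by
    intro N
    induction N with
    | zero => exact fun s hs => ⟨s, hs, fun m => rfl⟩
    | succ N ih =>
      intro s hs
      obtain ⟨s1, hs1, h1⟩ := ih s hs
      obtain ⟨s2, hs2, h2⟩ := hτ' s1 hs1
      exact ⟨s2, hs2, fun m => by
        rw [Function.iterate_succ_apply', h1, h2, Function.iterate_succ_apply']⟩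
  choose L hL using hclear
  set N := (Finset.range (K + 1)).sup L with hN
  obtain ⟨A, hA, A', hA', hAA', h⟩ := key (N + 1)
  have hspan : ∀ x ∈ Submodule.span S (u '' Set.Icc 0 (K : ℤ)), ∃ s ∈ S, τ^[N] x = s (u 0) := by
    intro x hx
    have hadd : ∀ x y, τ^[N] (x + y) = τ^[N] x + τ^[N] y := by
      intro x y
      exact Function.Semiconj₂.iterate (f := τ) (op := (· + ·)) (fun x y => map_add τ x y) N x y
    induction hx using Submodule.span_induction with
    | mem x hx =>
      obtain ⟨k, ⟨hk0, hk1⟩, rfl⟩ := hx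
      lift k to ℕ using hk0
      exact hL k N (Finset.le_sup (f := L) (by simp; omega))
    | zero =>
      refine ⟨0, zero_mem _, ?_⟩
      have := hadd 0 0
      rw [add_zero, left_eq_add] at this
      exact this
    | add x y _ _ hx hy =>
      obtain ⟨s, hs, h⟩ := hx
      obtain ⟨s', hs', h'⟩ := hy
      exact ⟨s + s', add_mem hs hs', by rw [hadd, h, h']; rfl⟩
    | smul c x _ hx =>
      obtain ⟨s, hs, h⟩ := hx
      obtain ⟨s', hs', h'⟩ := hτN N c.1 c.2
      exact ⟨s' * s, mul_mem hs' hs, (h' x).trans (congrArg s' h)⟩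
  obtain ⟨s, hs, hsx⟩ := hspan _ (hK A hA A' hA' hAA')
  exact ⟨N + 1, s, hs, by rw [h 0, Function.iterate_succ_apply', hsx]⟩

end Bounded

section Generic
variable {A : Type*} [CommRing A] [Algebra ℂ A] {I : Type*}

/-- `Gen D f t m₀ Λ m` says that `m / f ^ Λ` belongs to the module generated from `m₀` by
multiplications and by the twisted derivations `D i + t i / f`. -/
inductive Gen (D : I → Derivation ℂ A A) (f : A) (t : I → A) (m₀ : A) : ℕ → A → Prop
  | base : Gen D f t m₀ 0 m₀
  | smul {Λ : ℕ} {m : A} (c : A) : Gen D f t m₀ Λ m → Gen D f t m₀ Λ (c * m)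
  | add {Λ : ℕ} {m m' : A} : Gen D f t m₀ Λ m → Gen D f t m₀ Λ m' → Gen D f t m₀ Λ (m + m')
  | clear {Λ : ℕ} {m : A} : Gen D f t m₀ Λ m → Gen D f t m₀ (Λ + 1) (f * m)
  | nabla {Λ : ℕ} {m : A} (i : I) : Gen D f t m₀ Λ m →
      Gen D f t m₀ (Λ + 1) (f * D i m - Λ * D i f * m + m * t i)

namespace Gen
variable {D : I → Derivation ℂ A A} {f : A} {t : I → A} {m₀ : A} {Λ : ℕ}

theorem pow_mul {m : A} (h : Gen D f t m₀ Λ m) (k : ℕ) : Gen D f t m₀ (Λ + k) (f ^ k * m) := by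
  induction k with
  | zero => simpa using h
  | succ k ih => rw [pow_succ', mul_assoc]; exact ih.clear

theorem multiple (c : A) : Gen D f t m₀ Λ (f ^ Λ * (c * m₀)) := by
  simpa using (Gen.base.smul c : Gen D f t m₀ 0 (c * m₀)).pow_mul Λ

theorem zero : Gen D f t m₀ Λ 0 := by simpa using multiple (D := D) (f := f) (t := t) (m₀ := m₀) (Λ := Λ) 0

theorem sum {J : Type*} (s : Finset J) (g : J → A) (h : ∀ j ∈ s, Gen D f t m₀ Λ (g j)) :
    Gen D f t m₀ Λ (∑ j ∈ s, g j) := by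
  classical
  induction s using Finset.induction_on with
  | empty => exact zero
  | insert j s hj ih =>
    rw [Finset.sum_insert hj]
    exact (h j (by simp)).add (ih fun k hk => h k (by simp [hk]))

theorem sub {m m' : A} (h : Gen D f t m₀ Λ m) (h' : Gen D f t m₀ Λ m') : Gen D f t m₀ Λ (m - m') := by
  simpa [sub_eq_add_neg] using h.add (h'.smul (-1))

/-- The elements at a given level form an ideal. -/
def ideal (D : I → Derivation ℂ A A) (f : A) (t : I → A) (m₀ : A) (Λ : ℕ) : Ideal A where
  carrier := {m | Gen D f t m₀ Λ m}
  add_mem' := Gen.add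
  zero_mem' := zero
  smul_mem' c _ h := h.smul c

/-- Restriction to a locus on which one of the exponents vanishes. -/
theorem restrict {A' : Type*} [CommRing A'] [Algebra ℂ A'] {D' : I → Derivation ℂ A' A'} {f' : A'}
    {t' : I → A'} {m₀' : A'} (ε : A' →+* A) (h : A)
    (hD : ∀ i m, ε (D' i m) = D i (ε m)) (hf : ε f' = f * h) (ht : ∀ i, ε (t' i) = h * t i)
    (hm : Gen D f t m₀ 0 (ε m₀')) {m : A'} (hg : Gen D' f' t' m₀' Λ m) :
    ∃ m', Gen D f t m₀ Λ m' ∧ ε m = h ^ Λ * m' := by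
  induction hg with
  | base => exact ⟨_, hm, by simp⟩
  | smul c _ ih =>
    obtain ⟨m', h1, h2⟩ := ih
    exact ⟨ε c * m', h1.smul _, by rw [map_mul, h2]; ring⟩
  | add _ _ ih ih' =>
    obtain ⟨m', h1, h2⟩ := ih
    obtain ⟨m'', h1', h2'⟩ := ih'
    exact ⟨m' + m'', h1.add h1', by rw [map_add, h2, h2']; ring⟩
  | clear _ ih =>
    obtain ⟨m', h1, h2⟩ := ih
    exact ⟨f * m', h1.clear, by rw [map_mul, h2, hf]; ring⟩
  | @nabla Λ m i _ ih =>
    obtain ⟨m', h1, h2⟩ := ih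
    refine ⟨_, h1.nabla i, ?_⟩
    simp only [map_add, map_sub, map_mul, map_natCast, hD, hf, ht, h2, Derivation.leibniz,
      Derivation.leibniz_pow, smul_eq_mul, nsmul_eq_mul]
    rcases Λ with _ | Λ
    · simp; ring
    · simp only [Nat.add_sub_cancel]; push_cast; ring

/-- Direct images. -/
theorem push {A' : Type*} [CommRing A'] [Algebra ℂ A'] {I' : Type*} [Fintype I]
    {D' : I' → Derivation ℂ A' A'} {f' : A'}
    {t' : I' → A'} {m₀' : A'} (φ : A →+* A') (pr : A' →+ A) (u : I' → I → A')
    (hpr : ∀ r m, pr (φ r * m) = r * pr m)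
    (hD : ∀ j m, pr (D' j m) = ∑ k, D k (pr (u j k * m)))
    (hf : f' = φ f) (hDf : ∀ j, D' j (φ f) = ∑ k, u j k * φ (D k f))
    (ht : ∀ j, t' j = ∑ k, u j k * φ (t k))
    {ω : A'} (hm : m₀' = φ m₀ * ω) {m : A'} (hg : Gen D' f' t' m₀' Λ m) (h : A') :
    Gen D f t m₀ Λ (pr (h * m)) := by
  induction hg generalizing h with
  | base =>
    have : pr (h * m₀') = pr (h * ω) * m₀ := by
      rw [hm, mul_left_comm, hpr, mul_comm]
    rw [this]
    exact Gen.base.smul _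
  | smul c _ ih => rw [← mul_assoc]; exact ih _
  | add _ _ ih ih' => rw [mul_add, map_add]; exact (ih h).add (ih' h)
  | clear _ ih => rw [hf, mul_left_comm, hpr]; exact (ih h).clear
  | @nabla Λ m j _ ih =>
    have e : h * (f' * D' j m - Λ * D' j f' * m + m * t' j) =
        φ f * D' j (h * m) - φ f * (D' j h * m) -
          ∑ k, φ (Λ * D k f) * (u j k * (h * m)) + ∑ k, φ (t k) * (u j k * (h * m)) := by
      rw [hf, hDf, ht, Derivation.leibniz, smul_eq_mul, smul_eq_mul]
      have e1 : ∑ k, φ (Λ * D k f) * (u j k * (h * m)) = Λ * (∑ k, u j k * φ (D k f)) * (h * m) := by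
        rw [Finset.mul_sum, Finset.sum_mul]
        exact Finset.sum_congr rfl fun k _ => by rw [map_mul, map_natCast]; ring
      have e2 : ∑ k, φ (t k) * (u j k * (h * m)) = (∑ k, u j k * φ (t k)) * (h * m) := by
        rw [Finset.sum_mul]
        exact Finset.sum_congr rfl fun k _ => by ring
      rw [e1, e2]
      ring
    have e' : pr (h * (f' * D' j m - Λ * D' j f' * m + m * t' j)) =
        ∑ k, (f * D k (pr (u j k * h * m)) - Λ * D k f * pr (u j k * h * m) +
          pr (u j k * h * m) * t k) - f * pr (D' j h * m) := by
      rw [e, map_add, map_sub, map_sub, hpr, hpr, hD, map_sum, map_sum]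
      simp only [hpr, mul_assoc, Finset.sum_add_distrib, Finset.sum_sub_distrib, Finset.mul_sum]
      have : ∀ k, t k * pr (u j k * (h * m)) = pr (u j k * (h * m)) * t k := fun k => mul_comm _ _
      simp only [this]
      ring
    rw [e']
    exact (Gen.sum _ _ fun k _ => (ih _).nabla k).sub (ih _).clear

theorem base_change {A' : Type*} [CommRing A'] [Algebra ℂ A'] {D' : I → Derivation ℂ A' A'}
    (θ : A →+* A') (hD : ∀ i m, D' i (θ m) = θ (D i m)) {m : A'}
    (hg : Gen D' (θ f) (fun i => θ (t i)) (θ m₀) Λ m) :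
    m ∈ Ideal.span (θ '' {m | Gen D f t m₀ Λ m}) := by
  induction hg with
  | base => exact Ideal.subset_span ⟨_, .base, rfl⟩
  | smul c _ ih => exact Ideal.mul_mem_left _ _ ih
  | add _ _ ih ih' => exact add_mem ih ih'
  | @clear Λ m _ ih =>
    clear * - ih
    induction ih using Submodule.span_induction with
    | mem x h =>
      obtain ⟨y, hy, rfl⟩ := h
      exact Ideal.subset_span ⟨f * y, hy.clear, map_mul _ _ _⟩
    | zero => simp
    | add x y _ _ hx hy => rw [mul_add]; exact add_mem hx hy
    | smul c x _ hx => rw [smul_eq_mul, mul_left_comm]; exact Ideal.mul_mem_left _ _ hx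
  | @nabla Λ m i _ ih =>
    clear * - ih hD
    induction ih using Submodule.span_induction with
    | mem x h =>
      obtain ⟨y, hy, rfl⟩ := h
      exact Ideal.subset_span ⟨_, hy.nabla i, by simp [hD]⟩
    | zero => simp
    | add x y _ _ hx hy =>
      convert add_mem hx hy using 1
      simp only [map_add]; ring
    | smul c x hx' hx =>
      have hx2 : θ f * x ∈ Ideal.span (θ '' {m | Gen D f t m₀ (Λ + 1) m}) := by
        clear hx
        induction hx' using Submodule.span_induction with
        | mem x h =>
          obtain ⟨y, hy, rfl⟩ := h
          exact Ideal.subset_span ⟨f * y, hy.clear, map_mul _ _ _⟩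
        | zero => simp
        | add x y _ _ hx hy => rw [mul_add]; exact add_mem hx hy
        | smul c x _ hx => rw [smul_eq_mul, mul_left_comm]; exact Ideal.mul_mem_left _ _ hx
      convert add_mem (Ideal.mul_mem_left _ c hx) (Ideal.mul_mem_left _ (D' i c) hx2) using 1
      simp only [smul_eq_mul, Derivation.leibniz]; ring

end Gen
end Generic

section Coefficientwise
variable {ι κ : Type*} {B B' : Type*} [CommRing B] [CommRing B']

/-- Coefficientwise application of an additive map. -/
def coeffMap (g : B' →+ B) : MvPolynomial ι B' →+ MvPolynomial ι B where
  toFun p := ∑ e ∈ p.support, monomial e (g (coeff e p))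
  map_zero' := by simp
  map_add' p q := by
    classical
    have key : ∀ (p : MvPolynomial ι B') (e : ι →₀ ℕ),
        coeff e (∑ e ∈ p.support, monomial e (g (coeff e p))) = g (coeff e p) := by
      intro p e
      simp only [coeff_sum, coeff_monomial, Finset.sum_ite_eq', mem_support_iff]
      split_ifs with h
      · rfl
      · rw [not_not.1 h, map_zero]
    ext e
    rw [coeff_add, key, key, key, coeff_add, map_add]

@[simp] theorem coeff_coeffMap (g : B' →+ B) (p : MvPolynomial ι B') (e : ι →₀ ℕ) :
    coeff e (coeffMap g p) = g (coeff e p) := by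
  classical
  change coeff e (∑ e ∈ p.support, monomial e (g (coeff e p))) = g (coeff e p)
  simp only [coeff_sum, coeff_monomial, Finset.sum_ite_eq', mem_support_iff]
  split_ifs with h
  · rfl
  · rw [not_not.1 h, map_zero]

@[simp] theorem coeffMap_C (g : B' →+ B) (b : B') : coeffMap g (C b : MvPolynomial ι B') = C (g b) := by
  classical
  ext e
  rw [coeff_coeffMap, coeff_C, coeff_C]
  split_ifs <;> simp

theorem coeffMap_map_mul (φ : B →+* B') (pr : B' →+ B) (h : ∀ r m, pr (φ r * m) = r * pr m)
    (r : MvPolynomial ι B) (m : MvPolynomial ι B') :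
    coeffMap pr (map φ r * m) = r * coeffMap pr m := by
  classical
  ext e
  rw [coeff_coeffMap, coeff_mul, coeff_mul, map_sum]
  refine Finset.sum_congr rfl fun x _ => ?_
  rw [coeff_map, h, coeff_coeffMap]

theorem coeffMap_mul_map (pr : B' →+ B) (φ : B →+* B') (h : ∀ r m, pr (φ r * m) = r * pr m)
    (m : B') (r : MvPolynomial ι B) : coeffMap pr (C m * map φ r) = C (pr m) * r := by
  rw [mul_comm, coeffMap_map_mul φ pr h, coeffMap_C, mul_comm]

variable [Algebra ℂ B] [Algebra ℂ B']

/-- Coefficientwise extension of a derivation to a polynomial ring. -/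
def coeffDer (D : Derivation ℂ B B) : Derivation ℂ (MvPolynomial ι B) (MvPolynomial ι B) :=
  Derivation.mk'
    { toFun := coeffMap (D : B →ₗ[ℂ] B).toAddMonoidHom
      map_add' := map_add _
      map_smul' := fun c p => by ext e; simp }
    fun p q => by
      classical
      ext e
      rw [coeff_add, smul_eq_mul, smul_eq_mul, mul_comm q]
      change coeff e (coeffMap _ _) = coeff e (p * coeffMap _ _) + coeff e (coeffMap _ _ * q)
      rw [coeff_coeffMap, coeff_mul, coeff_mul, coeff_mul, map_sum, ← Finset.sum_add_distrib]
      refine Finset.sum_congr rfl fun x _ => ?_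
      rw [coeff_coeffMap, coeff_coeffMap]
      change D _ = _ * D _ + D _ * _
      rw [Derivation.leibniz, smul_eq_mul, smul_eq_mul, mul_comm (coeff x.2 q)]

@[simp] theorem coeff_coeffDer (D : Derivation ℂ B B) (p : MvPolynomial ι B) (e : ι →₀ ℕ) :
    coeff e (coeffDer D p) = D (coeff e p) := coeff_coeffMap _ p e

@[simp] theorem coeffDer_C (D : Derivation ℂ B B) (b : B) :
    coeffDer D (C b : MvPolynomial ι B) = C (D b) := coeffMap_C _ b

@[simp] theorem coeffDer_map (D : Derivation ℂ B B) (b : MvPolynomial ι ℂ) :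
    coeffDer D (map (algebraMap ℂ B) b) = 0 := by
  ext e
  rw [coeff_coeffDer, coeff_map, Derivation.map_algebraMap, coeff_zero]

@[simp] theorem coeffDer_X (D : Derivation ℂ B B) (i : ι) : coeffDer D (X i : MvPolynomial ι B) = 0 := by
  simpa using coeffDer_map D (X i : MvPolynomial ι ℂ)

theorem coeffDer_hom (D : Derivation ℂ B B) (D' : Derivation ℂ B' B')
    (ε : MvPolynomial κ B' →+* MvPolynomial ι B) (θ : B' →+* B)
    (hC : ∀ b, ε (C b) = C (θ b)) (hX : ∀ k, coeffDer D (ε (X k)) = 0)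
    (hθ : ∀ b, D (θ b) = θ (D' b)) (m : MvPolynomial κ B') :
    coeffDer D (ε m) = ε (coeffDer D' m) := by
  induction m using MvPolynomial.induction_on with
  | C b => rw [hC, coeffDer_C, coeffDer_C, hC, hθ]
  | add p q hp hq => simp [hp, hq]
  | mul_X p i hp => simp [hp, hX]

end Coefficientwise

section Good
variable {ι : Type*} [Fintype ι] [DecidableEq ι] {B B' : Type*} [CommRing B] [CommRing B']
  [Algebra ℂ B] [Algebra ℂ B'] {I : Type*}

/-- The numerator of the logarithmic twist. -/
def tw (D : I → Derivation ℂ B B) (F : ι → B) (i : I) : MvPolynomial ι B :=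
  ∑ j, X j * C (D i (F j) * ∏ k ∈ Finset.univ.erase j, F k)

/-- Membership in the module generated by `F ^ (s + a) * J`, after clearing denominators. -/
abbrev GenP (D : I → Derivation ℂ B B) (F : ι → B) (a : ι → ℕ) (J : B) :
    ℕ → MvPolynomial ι B → Prop :=
  Gen (fun i => coeffDer (D i)) (C (∏ j, F j)) (tw D F) (C ((∏ j, F j ^ a j) * J))

/-- Products of nonzero constants and of linear forms with natural coefficients and positive
constant term. -/
def linForms (ι : Type*) [Fintype ι] : Submonoid (MvPolynomial ι ℂ) :=
  Submonoid.closure ({b | ∃ c : ℂ, c ≠ 0 ∧ b = C c} ∪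
    {b | ∃ (l : ι → ℕ) (c : ℕ), 0 < c ∧ b = ∑ j, C (l j : ℂ) * X j + C (c : ℂ)})

omit [DecidableEq ι] in
theorem linForm_mem (l : ι → ℕ) {c : ℕ} (hc : 0 < c) :
    (∑ j, C (l j : ℂ) * X j + C (c : ℂ) : MvPolynomial ι ℂ) ∈ linForms ι :=
  Submonoid.subset_closure (Or.inr ⟨l, c, hc, rfl⟩)

/-- Existence of a Bernstein polynomial which is a product of linear forms. -/
def Good (D : I → Derivation ℂ B B) (F : ι → B) (a : ι → ℕ) (J : B) : Prop :=
  ∃ b ∈ linForms ι, ∃ Λ, GenP D F a J Λ (C ((∏ j, F j) ^ Λ * J) * map (algebraMap ℂ B) b)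

omit [DecidableEq ι] in
theorem linForms_restrict {b : MvPolynomial (Option ι) ℂ} (hb : b ∈ linForms (Option ι)) :
    (aeval (fun o : Option ι => o.elim (0 : MvPolynomial ι ℂ) X) b : MvPolynomial ι ℂ) ∈
      linForms ι := by
  induction hb using Submonoid.closure_induction with
  | mem x h =>
    rcases h with ⟨c, hc, rfl⟩ | ⟨l, c, hc, rfl⟩
    · exact Submonoid.subset_closure (Or.inl ⟨c, hc, by simp [algebraMap_eq]⟩)
    · refine Submonoid.subset_closure (Or.inr ⟨fun j => l (some j), c, hc, ?_⟩)
      simp [Fintype.sum_option]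
  | one => simp
  | mul x y _ _ hx hy => rw [map_mul]; exact mul_mem hx hy

theorem tw_option (D : I → Derivation ℂ B B) (F : ι → B) (h : B) (i : I) :
    aeval (fun o : Option ι => o.elim (0 : MvPolynomial ι B) X) (tw D (fun o : Option ι => o.elim h F) i) =
      C h * tw D F i := by
  simp only [tw, Fintype.sum_option, map_add, map_mul, map_sum, aeval_X, aeval_C, algebraMap_eq,
    Option.elim, zero_mul, zero_add, Finset.mul_sum]
  refine Finset.sum_congr rfl fun j _ => ?_
  have : ∏ k ∈ Finset.univ.erase (some j), (Option.elim k h F) =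
      h * ∏ k ∈ Finset.univ.erase j, F k := by
    have e : (Finset.univ.erase (some j)) = Finset.insertNone (Finset.univ.erase j) := by
      ext o; cases o <;> simp
    rw [e, Finset.prod_insertNone]
    rfl
  rw [← map_mul C, ← map_mul C]
  change X j * C (D i (F j) * ∏ k ∈ Finset.univ.erase (some j), (Option.elim k h F)) = _
  rw [this]
  simp only [map_mul]
  ring

theorem Good.of_enlarge [IsDomain B] {D : I → Derivation ℂ B B} {F : ι → B} {a : ι → ℕ} {J : B}
    {h : B} (h0 : h ≠ 0) {a₀ : ℕ}
    (H : Good D (fun o : Option ι => o.elim h F) (fun o => o.elim a₀ a) J) : Good D F a J := by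
  obtain ⟨b, hb, Λ, H⟩ := H
  refine ⟨_, linForms_restrict hb, Λ, ?_⟩
  obtain ⟨m', h1, h2⟩ := Gen.restrict (D := fun i => coeffDer (D i)) (f := C (∏ j, F j)) (t := tw D F)
    (m₀ := C ((∏ j, F j ^ a j) * J))
    (aeval (fun o : Option ι => o.elim (0 : MvPolynomial ι B) X)).toRingHom (C h)
    (fun i m => (coeffDer_hom (D i) (D i) _ (RingHom.id B) (fun b => by simp [algebraMap_eq])
      (fun k => by cases k <;> simp) (fun b => rfl) m).symm)
    (by simp [algebraMap_eq, Fintype.prod_option, mul_comm]) (fun i => tw_option D F h i)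
    (by
      have : (aeval (fun o : Option ι => o.elim (0 : MvPolynomial ι B) X)).toRingHom
          (C ((∏ j : Option ι, (j.elim h F) ^ (j.elim a₀ a)) * J)) =
          C (h ^ a₀) * C ((∏ j, F j ^ a j) * J) := by
        simp [algebraMap_eq, Fintype.prod_option, mul_assoc]
      rw [this]
      exact Gen.base.smul _) H
  have e : (aeval (fun o : Option ι => o.elim (0 : MvPolynomial ι B) X)).toRingHom
      (C ((∏ j : Option ι, j.elim h F) ^ Λ * J) * map (algebraMap ℂ B) b) =
      C h ^ Λ * (C ((∏ j, F j) ^ Λ * J) *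
        map (algebraMap ℂ B) (aeval (fun o : Option ι => o.elim (0 : MvPolynomial ι ℂ) X) b)) := by
    have e1 : aeval (fun o : Option ι => o.elim (0 : MvPolynomial ι B) X) (map (algebraMap ℂ B) b) =
        map (algebraMap ℂ B) (aeval (fun o : Option ι => o.elim (0 : MvPolynomial ι ℂ) X) b) := by
      rw [aeval_map_algebraMap, map_aeval]
      simp only [aeval_def, eval₂_eq]
      refine congrArg₂ (fun f g => eval₂ f g b) ?_ ?_
      · ext; simp
      · ext o : 1
        cases o <;> simp
    rw [AlgHom.toRingHom_eq_coe, RingHom.coe_coe, map_mul, e1, aeval_C, algebraMap_eq,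
      Fintype.prod_option, ← mul_assoc]
    congr 1
    simp only [Option.elim, map_mul, map_pow, mul_pow]
    ring
  rw [e] at h2
  rwa [mul_left_cancel₀ (pow_ne_zero _ (by simpa using h0)) h2]

theorem tw_map [Fintype I] {I' : Type*} {D : I → Derivation ℂ B B} {D' : I' → Derivation ℂ B' B'}
    (φ : B →+* B') (u : I' → I → B') (hDφ : ∀ j b, D' j (φ b) = ∑ k, u j k * φ (D k b))
    (F : ι → B) (j : I') :
    tw D' (fun l => φ (F l)) j = ∑ k, C (u j k) * map φ (tw D F k) := by
  simp only [tw, hDφ, map_sum, map_mul, map_X, map_C, Finset.mul_sum, Finset.sum_mul, map_prod]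
  rw [Finset.sum_comm]
  exact Finset.sum_congr rfl fun k _ => Finset.sum_congr rfl fun l _ => by ring

theorem Good.push [Fintype I] {I' : Type*} {D : I → Derivation ℂ B B} {D' : I' → Derivation ℂ B' B'}
    {F : ι → B} {a : ι → ℕ} {J : B} (φ : B →ₐ[ℂ] B') (pr : B' →+ B) (u : I' → I → B')
    (hpr : ∀ r m, pr (φ r * m) = r * pr m)
    (hDφ : ∀ j b, D' j (φ b) = ∑ k, u j k * φ (D k b))
    (hD : ∀ j m, pr (D' j m) = ∑ k, D k (pr (u j k * m)))
    {ω : B'} (hω : pr ω = 1)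
    (H : Good D' (fun l => φ (F l)) a (φ J * ω)) : Good D F a J := by
  obtain ⟨b, hb, Λ, H⟩ := H
  refine ⟨b, hb, Λ, ?_⟩
  have := Gen.push (D := fun i => coeffDer (D i)) (f := C (∏ j, F j)) (t := tw D F)
    (m₀ := C ((∏ j, F j ^ a j) * J)) (map φ.toRingHom) (coeffMap pr) (fun j k => C (u j k))
    (coeffMap_map_mul _ _ hpr) (fun j m => by
      ext e
      simp [hD, coeff_sum]) (by simp) (fun j => by
      rw [map_C, coeffDer_C]
      change C (D' j (φ _)) = _
      rw [hDφ, map_sum]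
      refine Finset.sum_congr rfl fun k _ => ?_
      rw [coeffDer_C, map_C, map_mul]
      rfl) (tw_map φ.toRingHom u hDφ F)
    (ω := C ω) (by simp; ring) H 1
  have e : coeffMap pr (1 * (C ((∏ j, φ (F j)) ^ Λ * (φ J * ω)) * map (algebraMap ℂ B') b)) =
      C ((∏ j, F j) ^ Λ * J) * map (algebraMap ℂ B) b := by
    have e1 : map (algebraMap ℂ B') b = map φ.toRingHom (map (algebraMap ℂ B) b) := by
      rw [map_map]; congr 2; ext x; simp
    have e2 : (∏ j, φ (F j)) ^ Λ * (φ J * ω) = φ ((∏ j, F j) ^ Λ * J) * ω := by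
      simp only [map_mul, map_pow, map_prod]; ring
    rw [one_mul, e1, e2, coeffMap_mul_map _ φ.toRingHom hpr, hpr, hω, mul_one]
  rwa [e] at this

end Good

section Leaf
variable {B : Type*} [CommRing B] [Algebra ℂ B]

/-- The logarithmic derivative of `g` along `y * D` is a natural number modulo `y`. -/
def LogDer (D : Derivation ℂ B B) (y g : B) : Prop := ∃ (m : ℕ) (c : B), y * D g = g * (m + y * c)

namespace LogDer
variable {D : Derivation ℂ B B} {y : B}

theorem one : LogDer D y 1 := ⟨0, 0, by simp⟩

theorem mul {g h : B} (hg : LogDer D y g) (hh : LogDer D y h) : LogDer D y (g * h) := by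
  obtain ⟨m, c, hg⟩ := hg
  obtain ⟨m', c', hh⟩ := hh
  refine ⟨m + m', c + c', ?_⟩
  rw [Derivation.leibniz, smul_eq_mul, smul_eq_mul]
  push_cast
  linear_combination h * hg + g * hh

theorem list_prod (l : List B) (hg : ∀ g ∈ l, LogDer D y g) : LogDer D y l.prod := by
  induction l with
  | nil => simpa using one
  | cons g l ih =>
    rw [List.prod_cons]
    exact (hg g (by simp)).mul (ih fun g' h => hg g' (by simp [h]))

theorem of_isUnit {u : B} (hu : IsUnit u) : LogDer D y u := by
  obtain ⟨u, rfl⟩ := hu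
  refine ⟨0, ↑u⁻¹ * D u, ?_⟩
  have : (u : B) * ↑u⁻¹ = 1 := Units.mul_inv u
  linear_combination (-y * D u) * this

end LogDer

variable {ι : Type*} [Fintype ι] [DecidableEq ι] {I : Type*} [DecidableEq I]

omit [DecidableEq I] in
theorem GenP.lower {D : I → Derivation ℂ B B} {F : ι → B} {a : ι → ℕ} {J w y : B} (i : I)
    (hy : D i y = 1) (hF : ∀ j, LogDer (D i) y (F j)) (hw : LogDer (D i) y w)
    {Λ : ℕ} {b : MvPolynomial ι ℂ}
    (h : GenP D F a J Λ (C ((∏ j, F j) ^ Λ * (y * w)) * map (algebraMap ℂ B) b)) :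
    ∃ b' ∈ linForms ι, GenP D F a J (Λ + 1)
      (C ((∏ j, F j) ^ (Λ + 1) * w) * map (algebraMap ℂ B) (b * b')) := by
  choose m c hmc using hF
  obtain ⟨m₀, c₀, hw⟩ := hw
  refine ⟨_, linForm_mem m (Nat.succ_pos m₀), ?_⟩
  convert (h.nabla i).sub (h.clear.smul (C c₀ + ∑ j, X j * C (c j))) using 1
  set f := ∏ j, F j with hf
  have e1 : f * D i (f ^ Λ) = Λ * f ^ Λ * D i f := by
    rcases Λ with _ | Λ
    · simp
    · simp only [Derivation.leibniz_pow, Nat.add_sub_cancel, smul_eq_mul, nsmul_eq_mul]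
      ring
  have e2 : (C y : MvPolynomial ι B) * tw D F i = C f * (∑ j, X j * C ((m j : B) + y * c j)) := by
    rw [tw, Finset.mul_sum, Finset.mul_sum]
    refine Finset.sum_congr rfl fun j _ => ?_
    have : y * (D i (F j) * ∏ k ∈ Finset.univ.erase j, F k) = f * (m j + y * c j) := by
      rw [← mul_assoc, hmc, hf, ← Finset.mul_prod_erase _ _ (Finset.mem_univ j)]
      ring
    rw [mul_left_comm, ← map_mul, this, map_mul]
    ring
  have e3 : coeffDer (D i) (C (f ^ Λ * (y * w)) * map (algebraMap ℂ B) b) =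
      (C (D i (f ^ Λ)) * C (y * w) + C (f ^ Λ) * (C w * (1 + (m₀ : MvPolynomial ι B) + C (y * c₀)))) *
        map (algebraMap ℂ B) b := by
    rw [Derivation.leibniz, coeffDer_map, coeffDer_C, Derivation.leibniz, Derivation.leibniz, hy]
    simp only [smul_eq_mul, mul_zero, zero_add]
    rw [hw]
    simp only [map_add, map_mul, map_one, map_natCast]
    ring
  have e1' := congrArg (C (σ := ι)) e1
  simp only [map_mul, map_natCast] at e1'
  rw [e3, coeffDer_C]
  have e4 : ∑ j, X j * C ((m j : B) + y * c j) =
      ∑ j, X j * C (m j : B) + C y * ∑ j, X j * C (c j) := by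
    rw [Finset.mul_sum, ← Finset.sum_add_distrib]
    refine Finset.sum_congr rfl fun j _ => ?_
    rw [map_add, map_mul]; ring
  have e5 : map (algebraMap ℂ B) (∑ j, C (m j : ℂ) * X j + C (((m₀ + 1 : ℕ)) : ℂ)) =
      ∑ j, X j * C (m j : B) + m₀ + 1 := by
    simp [mul_comm, add_assoc]
  rw [e4] at e2
  rw [Nat.succ_eq_add_one, map_mul (map (algebraMap ℂ B)), e5]
  simp only [map_mul, map_pow] at e1' ⊢
  generalize (∑ j, X j * C (c j) : MvPolynomial ι B) = s1 at *
  generalize (∑ j, X j * C (m j : B) : MvPolynomial ι B) = s2 at *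
  generalize (map (algebraMap ℂ B) b) = bb at *
  linear_combination (-(C y * C w * bb)) * e1' - (C f ^ Λ * C w * bb) * e2

omit [DecidableEq I] in
/-- The normal crossing case. -/
theorem Good.of_logDer {D : I → Derivation ℂ B B} {F : ι → B} {a : ι → ℕ} {J : B} (y : I → B)
    (hy : ∀ i, D i (y i) = 1) (hy' : ∀ i k, LogDer (D i) (y i) (y k))
    (hF : ∀ i j, LogDer (D i) (y i) (F j)) (hJ : ∀ i, LogDer (D i) (y i) J) (l : List I)
    (hl : (∏ j, F j ^ a j) ∣ (l.map y).prod) : Good D F a J := by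
  suffices H : ∀ l : List I, ∀ b ∈ linForms ι, ∀ Λ,
      GenP D F a J Λ (C ((∏ j, F j) ^ Λ * ((l.map y).prod * J)) * map (algebraMap ℂ B) b) →
      Good D F a J by
    obtain ⟨q, hq⟩ := hl
    refine H l 1 (one_mem _) 0 ?_
    have : C ((∏ j, F j) ^ 0 * ((l.map y).prod * J)) * map (algebraMap ℂ B) (1 : MvPolynomial ι ℂ) =
        C q * C ((∏ j, F j ^ a j) * J) := by
      rw [hq, ← map_mul]
      simp only [map_one, mul_one, pow_zero, one_mul]
      congr 1; ring
    rw [this]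
    exact Gen.base.smul _
  intro l
  induction l with
  | nil => intro b hb Λ h; exact ⟨b, hb, Λ, by simpa using h⟩
  | cons i l ih =>
    intro b hb Λ h
    rw [List.map_cons, List.prod_cons, mul_assoc] at h
    obtain ⟨b', hb', h'⟩ := h.lower i (hy i) (hF i)
      ((LogDer.list_prod _ (by simpa using fun k _ => hy' i k)).mul (hJ i))
    exact ih _ (mul_mem hb hb') _ h'

end Leaf

section Descent
variable {B R : Type*} [CommRing B] [CommRing R]

theorem exists_smul_sub_mem [IsNoetherianRing B] (θ : B →+* R) (𝔟 κ : Ideal B) (𝔫 : Ideal R)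
    (hA : ∀ (c : ℕ) (w : B), θ w ∈ 𝔫 ^ c → w ∈ 𝔟 ^ c ⊔ κ)
    (hB : ∀ (c : ℕ) (r : R), ∃ p, r - θ p ∈ 𝔫 ^ c) {T : Type*} [Finite T] (v : T → B)
    (E : Submodule B (T → B))
    (hv : (fun t => θ (v t)) ∈ Submodule.span R ((fun (e : T → B) t => θ (e t)) '' E)) :
    ∃ φ, φ - 1 ∈ 𝔟 ∧ ∃ e ∈ E, ∀ t, φ * v t - e t ∈ κ := by
  classical
  have := Fintype.ofFinite T
  have happ : ∀ (c : ℕ), ∀ x ∈ Submodule.span R ((fun (e : T → B) t => θ (e t)) '' E),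
      ∃ e ∈ E, ∀ t, x t - θ (e t) ∈ 𝔫 ^ c := by
    intro c x hx
    induction hx using Submodule.span_induction with
    | mem x h => obtain ⟨e, he, rfl⟩ := h; exact ⟨e, he, by simp⟩
    | zero => exact ⟨0, zero_mem _, by simp⟩
    | add x y _ _ hx hy =>
      obtain ⟨e, he, h1⟩ := hx
      obtain ⟨e', he', h2⟩ := hy
      refine ⟨e + e', add_mem he he', fun t => ?_⟩
      convert add_mem (h1 t) (h2 t) using 1
      simp only [Pi.add_apply, map_add]; ring
    | smul r x _ hx =>
      obtain ⟨e, he, h1⟩ := hx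
      obtain ⟨p, hp⟩ := hB c r
      refine ⟨p • e, E.smul_mem p he, fun t => ?_⟩
      convert add_mem (Ideal.mul_mem_right (x t) _ hp) (Ideal.mul_mem_left _ (θ p) (h1 t)) using 1
      simp only [Pi.smul_apply, smul_eq_mul, map_mul]; ring
  let K : Submodule B (T → B) := Submodule.pi Set.univ fun _ => κ
  have hmem : (E ⊔ K).mkQ v ∈ (⨅ c : ℕ, 𝔟 ^ c • ⊤ : Submodule B ((T → B) ⧸ (E ⊔ K))) := by
    rw [Submodule.mem_iInf]
    intro c
    obtain ⟨e, he, h⟩ := happ c _ hv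
    have h' : ∀ t, ∃ w ∈ 𝔟 ^ c, ∃ k ∈ κ, w + k = v t - e t := fun t =>
      Submodule.mem_sup.1 (hA c (v t - e t) (by rw [map_sub]; exact h t))
    choose w hw k hk hwk using h'
    have e1 : (E ⊔ K).mkQ v = (E ⊔ K).mkQ w := by
      rw [← sub_eq_zero, ← map_sub, Submodule.mkQ_apply, Submodule.Quotient.mk_eq_zero]
      have : v - w = e + k := by
        ext t
        have := hwk t
        simp only [Pi.sub_apply, Pi.add_apply]
        linear_combination -this
      rw [this]
      exact add_mem (Submodule.mem_sup_left he) (Submodule.mem_sup_right fun t _ => hk t)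
    have e2 : w = ∑ t, w t • (Pi.single t 1 : T → B) := by
      ext t
      simp [Finset.sum_apply, Pi.single_apply]
    rw [e1, e2, map_sum]
    refine sum_mem fun t _ => ?_
    rw [map_smul]
    exact Submodule.smul_mem_smul (hw t) trivial
  obtain ⟨r, hr⟩ := (Ideal.mem_iInf_smul_pow_eq_bot_iff 𝔟 _).1 hmem
  rw [← map_smul, ← sub_eq_zero, ← map_sub, Submodule.mkQ_apply, Submodule.Quotient.mk_eq_zero] at hr
  obtain ⟨e, he, k, hk, hek⟩ := Submodule.mem_sup.1 hr
  refine ⟨1 - r, by simp, -e, neg_mem he, fun t => ?_⟩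
  have := congrFun hek t
  simp only [Pi.add_apply, Pi.sub_apply, Pi.smul_apply, smul_eq_mul] at this
  have e3 : (1 - (r : B)) * v t - (-e) t = -k t := by
    simp only [Pi.neg_apply]; linear_combination this
  rw [e3]
  exact neg_mem (hk t trivial)

variable {ι : Type*}

theorem mem_span_map_of_mem_ideal_span (θ : B →+* R) (N : Ideal (MvPolynomial ι B))
    {x : MvPolynomial ι R} (hx : x ∈ Ideal.span (map θ '' (N : Set (MvPolynomial ι B)))) :
    x ∈ Submodule.span R (map θ '' (N : Set (MvPolynomial ι B))) := by
  induction hx using Submodule.span_induction with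
  | mem x h => exact Submodule.subset_span h
  | zero => exact zero_mem _
  | add x y _ _ hx hy => exact add_mem hx hy
  | smul c x _ hx =>
    rw [smul_eq_mul]
    induction c using MvPolynomial.induction_on with
    | C a => rw [← smul_eq_C_mul]; exact Submodule.smul_mem _ _ hx
    | add p q hp hq => rw [add_mul]; exact add_mem hp hq
    | mul_X p i hp =>
      rw [mul_right_comm, mul_comm _ (X i)]
      clear hx
      generalize p * x = z at hp
      induction hp using Submodule.span_induction with
      | mem x h =>
        obtain ⟨y, hy, rfl⟩ := h
        exact Submodule.subset_span ⟨X i * y, N.mul_mem_left _ hy, by simp⟩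
      | zero => simp
      | add x y _ _ hx hy => rw [mul_add]; exact add_mem hx hy
      | smul c x _ hx => rw [mul_smul_comm]; exact Submodule.smul_mem _ _ hx

theorem exists_C_mul_sub_mem [IsNoetherianRing B] (θ : B →+* R) (𝔟 κ : Ideal B) (𝔫 : Ideal R)
    (hA : ∀ (c : ℕ) (w : B), θ w ∈ 𝔫 ^ c → w ∈ 𝔟 ^ c ⊔ κ)
    (hB : ∀ (c : ℕ) (r : R), ∃ p, r - θ p ∈ 𝔫 ^ c) (N : Ideal (MvPolynomial ι B))
    (v : MvPolynomial ι B)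
    (hv : map θ v ∈ Ideal.span (map θ '' (N : Set (MvPolynomial ι B)))) :
    ∃ φ, φ - 1 ∈ 𝔟 ∧ ∃ e ∈ N, ∀ t, coeff t (C φ * v - e) ∈ κ := by
  classical
  let E (T : Finset (ι →₀ ℕ)) : Submodule B (T → B) :=
    { carrier := {e | ∃ p ∈ N, p.support ⊆ T ∧ ∀ t : T, e t = coeff t.1 p}
      add_mem' := by
        rintro _ _ ⟨p, hp, hpT, h⟩ ⟨q, hq, hqT, h'⟩
        exact ⟨p + q, add_mem hp hq, support_add.trans (Finset.union_subset hpT hqT),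
          fun t => by simp [h, h']⟩
      zero_mem' := ⟨0, zero_mem _, by simp, by simp⟩
      smul_mem' := by
        rintro c _ ⟨p, hp, hpT, h⟩
        refine ⟨C c * p, N.mul_mem_left _ hp, ?_, fun t => by simp [h, coeff_C_mul]⟩
        rw [← smul_eq_C_mul]
        exact (support_smul).trans hpT }
  have key : ∀ x ∈ Submodule.span R (map θ '' (N : Set (MvPolynomial ι B))), ∃ T₀ : Finset (ι →₀ ℕ),
      ∀ T : Finset (ι →₀ ℕ), T₀ ⊆ T → (fun t : T => coeff t.1 x) ∈
        Submodule.span R ((fun (e : T → B) t => θ (e t)) '' E T) := by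
    intro x hx
    induction hx using Submodule.span_induction with
    | mem x h =>
      obtain ⟨e, he, rfl⟩ := h
      refine ⟨e.support, fun T hT => Submodule.subset_span ⟨fun t => coeff t.1 e,
        ⟨e, he, hT, fun _ => rfl⟩, ?_⟩⟩
      ext t; simp [coeff_map]
    | zero => exact ⟨∅, fun T _ => by
      have : (fun t : T => coeff t.1 (0 : MvPolynomial ι R)) = 0 := by ext t; simp
      rw [this]; exact zero_mem _⟩
    | add x y _ _ hx hy =>
      obtain ⟨T₁, h1⟩ := hx
      obtain ⟨T₂, h2⟩ := hy
      refine ⟨T₁ ∪ T₂, fun T hT => ?_⟩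
      convert add_mem (h1 T (Finset.union_subset_left hT)) (h2 T (Finset.union_subset_right hT)) using 1
      ext t; simp
    | smul c x _ hx =>
      obtain ⟨T₁, h1⟩ := hx
      refine ⟨T₁, fun T hT => ?_⟩
      convert Submodule.smul_mem _ c (h1 T hT) using 1
      ext t; simp
  obtain ⟨T₀, hT₀⟩ := key _ (mem_span_map_of_mem_ideal_span θ N hv)
  have hT := hT₀ (T₀ ∪ v.support) Finset.subset_union_left
  simp only [coeff_map] at hT
  obtain ⟨φ, hφ, e, ⟨p, hp, hpT, hpe⟩, h⟩ :=
    exists_smul_sub_mem θ 𝔟 κ 𝔫 hA hB (fun t : ↥(T₀ ∪ v.support) => coeff t.1 v) (E _) hT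
  refine ⟨φ, hφ, p, hp, fun t => ?_⟩
  rw [coeff_sub, coeff_C_mul]
  by_cases ht : t ∈ T₀ ∪ v.support
  · simpa [hpe] using h ⟨t, ht⟩
  · have h1 : coeff t v = 0 := notMem_support_iff.1 fun h => ht (Finset.mem_union_right _ h)
    have h2 : coeff t p = 0 := notMem_support_iff.1 fun h => ht (hpT h)
    simp [h1, h2]

end Descent

section GoodDescent
variable {ι : Type*} [Fintype ι] [DecidableEq ι] {B R : Type*} [CommRing B] [CommRing R]
  [Algebra ℂ B] [Algebra ℂ R] {I : Type*}

theorem tw_hom {E : I → Derivation ℂ B B} {D : I → Derivation ℂ R R} (θ : B →+* R)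
    (hD : ∀ i b, D i (θ b) = θ (E i b)) (F : ι → B) (i : I) :
    tw D (fun j => θ (F j)) i = map θ (tw E F i) := by
  simp only [tw, hD, map_sum, map_mul, map_X, map_C, map_prod]

theorem Good.descend [IsNoetherianRing B] {E : I → Derivation ℂ B B} {D : I → Derivation ℂ R R}
    (θ : B →ₐ[ℂ] R) (hD : ∀ i b, D i (θ b) = θ (E i b)) (𝔟 κ : Ideal B) (𝔫 : Ideal R)
    (hA : ∀ (c : ℕ) (w : B), θ w ∈ 𝔫 ^ c → w ∈ 𝔟 ^ c ⊔ κ)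
    (hB : ∀ (c : ℕ) (r : R), ∃ p, r - θ p ∈ 𝔫 ^ c) {F : ι → B} {a : ι → ℕ} {J : B}
    (H : Good D (fun j => θ (F j)) a (θ J)) :
    ∃ b ∈ linForms ι, ∃ Λ, ∃ φ, φ - 1 ∈ 𝔟 ∧ ∃ e, GenP E F a J Λ e ∧
      ∀ t, coeff t (C (φ * ((∏ j, F j) ^ Λ * J)) * map (algebraMap ℂ B) b - e) ∈ κ := by
  obtain ⟨b, hb, Λ, H⟩ := H
  refine ⟨b, hb, Λ, ?_⟩
  have h := Gen.base_change (D := fun i => coeffDer (E i)) (D' := fun i => coeffDer (D i))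
    (f := C (∏ j, F j)) (t := tw E F) (m₀ := C ((∏ j, F j ^ a j) * J)) (Λ := Λ) (map θ.toRingHom)
    (fun i m => by
      refine coeffDer_hom (D i) (E i) (map θ.toRingHom) θ.toRingHom (fun b => map_C _ _) ?_ (hD i) m
      intro k; simp) (m := C ((∏ j, θ (F j)) ^ Λ * θ J) * map (algebraMap ℂ R) b) (by
      convert H using 1
      · simp
      · funext i; exact (tw_hom θ.toRingHom hD F i).symm
      · simp)
  have e : C ((∏ j, θ (F j)) ^ Λ * θ J) * map (algebraMap ℂ R) b =
      map θ.toRingHom (C ((∏ j, F j) ^ Λ * J) * map (algebraMap ℂ B) b) := by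
    rw [map_mul (map θ.toRingHom), map_map, map_C]
    congr 2
    · simp
    · congr 1; ext x; simp
  rw [e] at h
  obtain ⟨φ, hφ, e, he, h'⟩ := exists_C_mul_sub_mem θ.toRingHom 𝔟 κ 𝔫 hA hB
    (Gen.ideal (fun i => coeffDer (E i)) (C (∏ j, F j)) (tw E F) (C ((∏ j, F j ^ a j) * J)) Λ) _ h
  refine ⟨φ, hφ, e, he, fun t => ?_⟩
  rw [map_mul C φ, mul_assoc (C φ)]
  exact h' t

end GoodDescent

section FractionDerivation
variable {R : Type*} [CommRing R] [IsDomain R] [Algebra ℂ R]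
  {K : Type*} [Field K] [Algebra R K] [IsFractionRing R K]

omit [IsDomain R] [IsFractionRing R K] in
theorem quotient_rule_congr [FaithfulSMul R K] (D : Derivation ℂ R R) {p q p' q' : R} (hq : algebraMap R K q ≠ 0)
    (hq' : algebraMap R K q' ≠ 0)
    (h : algebraMap R K p / algebraMap R K q = algebraMap R K p' / algebraMap R K q') :
    (algebraMap R K (D p) * algebraMap R K q - algebraMap R K p * algebraMap R K (D q)) /
        algebraMap R K q ^ 2 =
      (algebraMap R K (D p') * algebraMap R K q' - algebraMap R K p' * algebraMap R K (D q')) /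
        algebraMap R K q' ^ 2 := by
  rw [div_eq_div_iff hq hq', ← map_mul, ← map_mul] at h
  have h1 : p * q' = p' * q := FaithfulSMul.algebraMap_injective R K h
  have h2 := congrArg D h1
  simp only [Derivation.leibniz, smul_eq_mul] at h2
  rw [div_eq_div_iff (pow_ne_zero _ hq) (pow_ne_zero _ hq')]
  simp only [← map_mul, ← map_sub, ← map_pow]
  congr 1
  linear_combination (q * q') * h2 - (q * D q' + q' * D q) * h1

variable [Algebra ℂ K] [IsScalarTower ℂ R K]

theorem exists_fraction_derivation (D : Derivation ℂ R R) :
    ∃ δ : Derivation ℂ K K, ∀ r, δ (algebraMap R K r) = algebraMap R K (D r) := by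
  have hs := fun z : K => IsFractionRing.div_surjective R z
  choose p q hq hz using hs
  have hq' : ∀ z, algebraMap R K (q z) ≠ 0 := fun z =>
    IsFractionRing.to_map_ne_zero_of_mem_nonZeroDivisors (hq z)
  let d : K → K := fun z => (algebraMap R K (D (p z)) * algebraMap R K (q z) -
    algebraMap R K (p z) * algebraMap R K (D (q z))) / algebraMap R K (q z) ^ 2
  have hd : ∀ p₁ q₁ z, algebraMap R K q₁ ≠ 0 → algebraMap R K p₁ / algebraMap R K q₁ = z →
      d z = (algebraMap R K (D p₁) * algebraMap R K q₁ - algebraMap R K p₁ * algebraMap R K (D q₁)) /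
        algebraMap R K q₁ ^ 2 := fun p₁ q₁ z h h' =>
    quotient_rule_congr D (hq' z) h ((hz z).trans h'.symm)
  have h1 : ∀ r, d (algebraMap R K r) = algebraMap R K (D r) := fun r => by
    rw [hd r 1 _ (by simp) (by simp)]; simp
  refine ⟨Derivation.mk' { toFun := d, map_add' := ?_, map_smul' := ?_ } ?_, h1⟩
  · intro x y
    have hx := hq' x
    have hy := hq' y
    rw [hd (p x * q y + p y * q x) (q x * q y) (x + y) (by simp [hx, hy]) (by
      refine Eq.trans ?_ (congrArg₂ (· + ·) (hz x) (hz y))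
      simp only [map_add, map_mul]
      field_simp)]
    simp only [d]
    simp only [Derivation.leibniz, map_add, map_mul, smul_eq_mul]
    field_simp
    ring
  · intro c x
    have hx := hq' x
    rw [hd (algebraMap ℂ R c * p x) (q x) (c • x) hx (by
      rw [Algebra.smul_def, IsScalarTower.algebraMap_apply ℂ R K, map_mul, mul_div_assoc, hz])]
    simp only [d, Derivation.leibniz, Derivation.map_algebraMap, map_add, map_mul, smul_eq_mul,
      RingHom.id_apply, Algebra.smul_def, IsScalarTower.algebraMap_apply ℂ R K, map_zero]
    field_simp
    ring
  · intro x y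
    have hx := hq' x
    have hy := hq' y
    change d (x * y) = x * d y + y * d x
    rw [hd (p x * p y) (q x * q y) (x * y) (by simp [hx, hy]) (by
      rw [map_mul, map_mul, mul_div_mul_comm, hz, hz])]
    refine Eq.trans ?_ (congrArg₂ (fun u v => u * d y + v * d x) (hz x) (hz y))
    simp only [d, Derivation.leibniz, map_add, map_mul, smul_eq_mul]
    field_simp
    ring

end FractionDerivation

/-- The substitution `X j ↦ X j + c j`. -/
def translate {A ι : Type*} [CommRing A] (c : ι → A) : MvPolynomial ι A →ₐ[A] MvPolynomial ι A :=
  aeval fun j => X j + C (c j)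

theorem translate_translate {A ι : Type*} [CommRing A] (c : ι → A) (x : MvPolynomial ι A) :
    translate (-c) (translate c x) = x := by
  have : (translate (-c)).comp (translate c) = AlgHom.id A _ := by
    ext j : 1
    simp [translate, algebraMap_eq]
  exact DFunLike.congr_fun this x

theorem map_translate {A A' ι : Type*} [CommRing A] [CommRing A'] (ψ : A →+* A') (c : ι → A)
    (x : MvPolynomial ι A) :
    map ψ (translate c x) = translate (fun j => ψ (c j)) (map ψ x) := by
  induction x using MvPolynomial.induction_on with
  | C b => simp [translate, algebraMap_eq]
  | add p q hp hq => simp [hp, hq]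
  | mul_X p i hp => rw [map_mul, map_mul, hp, map_mul, map_mul]; simp [translate]

theorem linForms_translate {ι : Type*} [Fintype ι] (a : ι → ℕ) {b : MvPolynomial ι ℂ}
    (hb : b ∈ linForms ι) : translate (fun j => (a j : ℂ)) b ∈ linForms ι := by
  induction hb using Submonoid.closure_induction with
  | mem x h =>
    rcases h with ⟨c, hc, rfl⟩ | ⟨l, c, hc, rfl⟩
    · exact Submonoid.subset_closure (Or.inl ⟨c, hc, by simp [translate, algebraMap_eq]⟩)
    · have : translate (fun j => (a j : ℂ)) (∑ j, C (l j : ℂ) * X j + C (c : ℂ)) =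
          ∑ j, C (l j : ℂ) * X j + C ((∑ j, l j * a j + c : ℕ) : ℂ) := by
        simp [translate, mul_add, Finset.sum_add_distrib, add_assoc]
      rw [this]
      exact linForm_mem l (by omega)
  | one => rw [map_one]; exact one_mem _
  | mul x y _ _ hx hy => rw [map_mul]; exact mul_mem hx hy

section Operators
variable {K : Type*} [Field K] [Algebra ℂ K] {ι : Type*} [Fintype ι]

/-- The logarithmic twist. -/
def twK (δ : Derivation ℂ K K) (F : ι → K) : MvPolynomial ι K := ∑ j, X j * C (δ (F j) / F j)

/-- The twisted derivation. -/
def nab (δ : Derivation ℂ K K) (F : ι → K) : AddMonoid.End (MvPolynomial ι K) where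
  toFun x := coeffDer δ x + x * twK δ F
  map_zero' := by simp
  map_add' x y := by rw [map_add]; ring

theorem nab_apply (δ : Derivation ℂ K K) (F : ι → K) (x : MvPolynomial ι K) :
    nab δ F x = coeffDer δ x + x * twK δ F := rfl

theorem nab_mul (δ : Derivation ℂ K K) (F : ι → K) (p x : MvPolynomial ι K) :
    nab δ F (p * x) = coeffDer δ p * x + p * nab δ F x := by
  rw [nab_apply, nab_apply, Derivation.leibniz, smul_eq_mul, smul_eq_mul]; ring

theorem nab_add (δ δ' : Derivation ℂ K K) (F : ι → K) (x : MvPolynomial ι K) :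
    nab (δ + δ') F x = nab δ F x + nab δ' F x := by
  have h1 : coeffDer (δ + δ') x = coeffDer δ x + coeffDer δ' x := by ext e; simp
  have h2 : twK (δ + δ') F = twK δ F + twK δ' F := by
    simp only [twK, ← Finset.sum_add_distrib]
    refine Finset.sum_congr rfl fun j _ => ?_
    rw [Derivation.add_apply, add_div, map_add, mul_add]
  rw [nab_apply, nab_apply, nab_apply, h1, h2]; ring

theorem nab_smul (g : K) (δ : Derivation ℂ K K) (F : ι → K) (x : MvPolynomial ι K) :
    nab (g • δ) F x = C g * nab δ F x := by
  have h1 : coeffDer (g • δ) x = C g * coeffDer δ x := by ext e; simp [coeff_C_mul]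
  have h2 : twK (g • δ) F = C g * twK δ F := by
    simp only [twK, Finset.mul_sum]
    refine Finset.sum_congr rfl fun j _ => ?_
    rw [Derivation.smul_apply, smul_eq_mul, mul_div_assoc, map_mul]; ring
  rw [nab_apply, nab_apply, h1, h2]; ring

theorem nab_comm {δ δ' : Derivation ℂ K K} (h : ∀ x, δ (δ' x) = δ' (δ x)) {F : ι → K}
    (hF : ∀ j, F j ≠ 0) (x : MvPolynomial ι K) : nab δ F (nab δ' F x) = nab δ' F (nab δ F x) := by
  have h1 : coeffDer δ (coeffDer δ' x) = coeffDer δ' (coeffDer δ x) := by ext e; simp [h]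
  have h2 : coeffDer δ (twK δ' F) = coeffDer δ' (twK δ F) := by
    simp only [twK, map_sum]
    refine Finset.sum_congr rfl fun j _ => ?_
    simp only [Derivation.leibniz, coeffDer_X, coeffDer_C, smul_eq_mul]
    have key : ∀ δ δ' : Derivation ℂ K K, δ (δ' (F j) / F j) =
        (δ (δ' (F j)) * F j - δ' (F j) * δ (F j)) / F j ^ 2 := by
      intro δ δ'
      rw [eq_div_iff (pow_ne_zero 2 (hF j))]
      have e : δ (δ' (F j)) = δ (δ' (F j) / F j * F j) := by rw [div_mul_cancel₀ _ (hF j)]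
      rw [e, Derivation.leibniz, smul_eq_mul, smul_eq_mul]
      field_simp [hF j]
      ring
    rw [key, key, h]
    rw [mul_comm (δ' (F j)) (δ (F j)), mul_zero, mul_zero]
  simp only [nab_apply, map_add, Derivation.leibniz, smul_eq_mul, h1, h2]
  ring

/-- Multiplication by `F ^ a` composed with the translation `s ↦ s + a`. -/
def tauEquiv (F : ι → K) (hF : ∀ j, F j ≠ 0) (a : ι → ℕ) : MvPolynomial ι K ≃+ MvPolynomial ι K where
  toFun x := C (∏ j, F j ^ a j) * translate (fun j => (a j : K)) x
  invFun x := C (∏ j, F j ^ a j)⁻¹ * translate (-fun j => (a j : K)) x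
  left_inv x := by
    have h0 : (∏ j, F j ^ a j) ≠ 0 := Finset.prod_ne_zero_iff.2 fun j _ => pow_ne_zero _ (hF j)
    have e : ∀ c : K, translate (-fun j => (a j : K)) (C c) = C c := fun c => by
      simp [translate, algebraMap_eq]
    beta_reduce
    rw [map_mul, translate_translate, e, ← mul_assoc, ← map_mul, inv_mul_cancel₀ h0, map_one, one_mul]
  right_inv x := by
    have h0 : (∏ j, F j ^ a j) ≠ 0 := Finset.prod_ne_zero_iff.2 fun j _ => pow_ne_zero _ (hF j)
    have e : ∀ c : K, translate (fun j => (a j : K)) (C c) = C c := fun c => by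
      simp [translate, algebraMap_eq]
    have := translate_translate (-fun j => (a j : K)) x
    rw [neg_neg] at this
    beta_reduce
    rw [map_mul, this, e, ← mul_assoc, ← map_mul, mul_inv_cancel₀ h0, map_one, one_mul]
  map_add' x y := by rw [map_add, mul_add]

variable {F : ι → K} {hF : ∀ j, F j ≠ 0} {a : ι → ℕ}

omit [Algebra ℂ K] in
theorem tau_apply (x : MvPolynomial ι K) :
    tauEquiv F hF a x = C (∏ j, F j ^ a j) * translate (fun j => (a j : K)) x := rfl

omit [Algebra ℂ K] in
theorem tau_mul (p x : MvPolynomial ι K) :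
    tauEquiv F hF a (p * x) = translate (fun j => (a j : K)) p * tauEquiv F hF a x := by
  rw [tau_apply, tau_apply, map_mul]; ring

omit [Algebra ℂ K] in
theorem tau_C_mul (c : K) (x : MvPolynomial ι K) :
    tauEquiv F hF a (C c * x) = C c * tauEquiv F hF a x := by
  rw [tau_mul]; congr 1; simp [translate, algebraMap_eq]

omit [Algebra ℂ K] in
theorem tau_C (c : K) : tauEquiv F hF a (C c) = C ((∏ j, F j ^ a j) * c) := by
  rw [tau_apply, map_mul]; congr 1; simp [translate, algebraMap_eq]

theorem logDeriv_prod_pow (δ : Derivation ℂ K K) (hF : ∀ j, F j ≠ 0) :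
    δ (∏ j, F j ^ a j) = (∏ j, F j ^ a j) * ∑ j, (a j : K) * (δ (F j) / F j) := by
  classical
  have : ∀ s : Finset ι, δ (∏ j ∈ s, F j ^ a j) =
      (∏ j ∈ s, F j ^ a j) * ∑ j ∈ s, (a j : K) * (δ (F j) / F j) := by
    intro s
    induction s using Finset.induction_on with
    | empty => simp
    | insert j s hj ih =>
      rw [Finset.prod_insert hj, Finset.sum_insert hj, Derivation.leibniz, ih, Derivation.leibniz_pow,
        smul_eq_mul, smul_eq_mul, nsmul_eq_mul, smul_eq_mul]
      have h0 := hF j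
      rcases a j with _ | m
      · simp
      · rw [Nat.add_sub_cancel, pow_succ]; field_simp; ring
  exact this _

theorem nab_tau (δ : Derivation ℂ K K) (x : MvPolynomial ι K) :
    nab δ F (tauEquiv F hF a x) = tauEquiv F hF a (nab δ F x) := by
  have h1 : coeffDer δ (translate (fun j => (a j : K)) x) =
      translate (fun j => (a j : K)) (coeffDer δ x) := by
    refine coeffDer_hom δ δ (translate (fun j => (a j : K))).toRingHom (RingHom.id K)
      (fun b => ?_) (fun k => ?_) (fun b => rfl) x
    · simp [translate, algebraMap_eq]
    · simp [translate]
  have h2 : translate (fun j => (a j : K)) (twK δ F) =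
      twK δ F + C (∑ j, (a j : K) * (δ (F j) / F j)) := by
    simp only [twK, map_sum, ← Finset.sum_add_distrib]
    refine Finset.sum_congr rfl fun j _ => ?_
    simp [translate, algebraMap_eq, add_mul]
  rw [tau_apply, tau_apply, nab_apply, nab_apply, map_add (translate _), map_mul (translate _), h2, Derivation.leibniz, h1,
    coeffDer_C, logDeriv_prod_pow δ hF]
  simp only [smul_eq_mul, map_mul]
  ring

end Operators

section OperatorRing
variable {R K : Type*} [CommRing R] [Algebra ℂ R] [Field K] [Algebra ℂ K]
  {ι I : Type*} [Fintype ι]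

/-- Multiplication by polynomials over `R`, as operators. -/
def mulOp (ψ : R →ₐ[ℂ] K) : MvPolynomial ι R →+* AddMonoid.End (MvPolynomial ι K) :=
  (Module.toAddMonoidEnd (MvPolynomial ι K) (MvPolynomial ι K)).comp (map ψ.toRingHom)

omit [Fintype ι] in
@[simp] theorem mulOp_apply (ψ : R →ₐ[ℂ] K) (p : MvPolynomial ι R) (x : MvPolynomial ι K) :
    mulOp ψ p x = map ψ.toRingHom p * x := rfl

/-- The ring generated by multiplications and twisted derivations. -/
def opRing (ψ : R →ₐ[ℂ] K) (δ : I → Derivation ℂ K K) (F : ι → R) :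
    Subring (AddMonoid.End (MvPolynomial ι K)) :=
  Subring.closure (Set.range (fun i => nab (δ i) fun j => ψ (F j)) ∪ Set.range (mulOp ψ))

variable {ψ : R →ₐ[ℂ] K} {δ : I → Derivation ℂ K K} {D : I → Derivation ℂ R R} {F : ι → R}

theorem nab_mem_opRing (i : I) : (nab (δ i) fun j => ψ (F j)) ∈ opRing ψ δ F :=
  Subring.subset_closure (Or.inl ⟨i, rfl⟩)

theorem mulOp_mem_opRing (p : MvPolynomial ι R) : mulOp ψ p ∈ opRing ψ δ F :=
  Subring.subset_closure (Or.inr ⟨p, rfl⟩)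

theorem nab_mul_mulOp {d : Derivation ℂ K K} {E : Derivation ℂ R R} (h : ∀ r, d (ψ r) = ψ (E r))
    (p : MvPolynomial ι R) : (nab d fun j => ψ (F j)) * mulOp ψ p =
      mulOp ψ (coeffDer E p) + mulOp ψ p * (nab d fun j => ψ (F j)) := by
  refine AddMonoidHom.ext fun x => ?_
  have h1 : coeffDer d (map ψ.toRingHom p) = map ψ.toRingHom (coeffDer E p) :=
    coeffDer_hom d E (map ψ.toRingHom) ψ.toRingHom (fun b => map_C _ _)
      (fun k => by simp) h p
  refine (nab_mul d (fun j => ψ (F j)) (map ψ.toRingHom p) x).trans ?_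
  rw [h1]
  rfl

theorem nab_mul_comm {δ δ' : Derivation ℂ K K} (h : ∀ x, δ (δ' x) = δ' (δ x)) {F : ι → K}
    (hF : ∀ j, F j ≠ 0) : nab δ F * nab δ' F = nab δ' F * nab δ F :=
  AddMonoidHom.ext fun x => nab_comm h hF x

theorem isNoetherianRing_opRing [Finite I] [IsNoetherianRing R] (hF : ∀ j, ψ (F j) ≠ 0)
    (hδ : ∀ i r, δ i (ψ r) = ψ (D i r)) (hc : ∀ i k x, δ i (δ k x) = δ k (δ i x)) :
    IsNoetherianRing (opRing ψ δ F) := by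
  classical
  have key : ∀ T : Finset I, IsNoetherianRing (Subring.closure
      (((T.image fun i => nab (δ i) fun j => ψ (F j)) : Set (AddMonoid.End (MvPolynomial ι K))) ∪
        Set.range (mulOp ψ))) := by
    intro T
    induction T using Finset.induction_on with
    | empty =>
      have : Subring.closure ((((∅ : Finset I).image fun i => nab (δ i) fun j => ψ (F j)) :
          Set (AddMonoid.End (MvPolynomial ι K))) ∪ Set.range (mulOp ψ)) = (mulOp ψ).range := by
        simp only [Finset.image_empty, Finset.coe_empty, Set.empty_union]
        rw [← RingHom.coe_range, Subring.closure_eq]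
      rw [this]
      exact isNoetherianRing_of_surjective _ _ (mulOp ψ).rangeRestrict
        (mulOp ψ).rangeRestrict_surjective
    | insert i T _ ih =>
      rw [Finset.image_insert, Finset.coe_insert, Set.insert_union]
      refine isNoetherianRing_closure_insert ?_ ih
      rintro g (hg | ⟨p, rfl⟩)
      · obtain ⟨k, _, rfl⟩ := Finset.mem_image.1 hg
        rw [nab_mul_comm (hc i k) hF, sub_self]
        exact zero_mem _
      · rw [sub_eq_of_eq_add (nab_mul_mulOp (hδ i) p)]
        exact Subring.subset_closure (Or.inr ⟨_, rfl⟩)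
  cases nonempty_fintype I
  have := key Finset.univ
  rwa [Finset.coe_image, Finset.coe_univ, Set.image_univ] at this

theorem opRing_tau (hF : ∀ j, ψ (F j) ≠ 0) (a : ι → ℕ) :
    (∀ s ∈ opRing ψ δ F, ∃ s' ∈ opRing ψ δ F,
      ∀ m, s (tauEquiv _ hF a m) = tauEquiv _ hF a (s' m)) ∧
    (∀ s ∈ opRing ψ δ F, ∃ s' ∈ opRing ψ δ F,
      ∀ m, tauEquiv _ hF a (s m) = s' (tauEquiv _ hF a m)) := by
  have e : ∀ (c : ι → ℕ) (p : MvPolynomial ι R), map ψ.toRingHom (translate (fun j => (c j : R)) p) =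
      translate (fun j => (c j : K)) (map ψ.toRingHom p) := fun c p => by
    rw [map_translate]; simp
  have e' : ∀ (c : ι → ℕ) (p : MvPolynomial ι R), map ψ.toRingHom (translate (-fun j => (c j : R)) p) =
      translate (-fun j => (c j : K)) (map ψ.toRingHom p) := fun c p => by
    rw [map_translate]; congr 1; simp [Pi.neg_def]
  constructor
  · intro s hs
    induction hs using Subring.closure_induction with
    | mem x h =>
      rcases h with ⟨i, rfl⟩ | ⟨p, rfl⟩
      · exact ⟨_, nab_mem_opRing i, fun m => nab_tau _ _⟩
      · refine ⟨_, mulOp_mem_opRing (translate (-fun j => (a j : R)) p), fun m => ?_⟩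
        have := translate_translate (-fun j => (a j : K)) (map ψ.toRingHom p)
        rw [neg_neg] at this
        rw [mulOp_apply, mulOp_apply, tau_mul, e', this]
    | zero => exact ⟨0, zero_mem _, fun m => by simp⟩
    | one => exact ⟨1, one_mem _, fun m => rfl⟩
    | add x y _ _ hx hy =>
      obtain ⟨x', hx', h⟩ := hx
      obtain ⟨y', hy', h'⟩ := hy
      exact ⟨x' + y', add_mem hx' hy', fun m => (congrArg₂ (· + ·) (h m) (h' m)).trans (map_add _ _ _).symm⟩
    | neg x _ hx =>
      obtain ⟨x', hx', h⟩ := hx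
      exact ⟨-x', neg_mem hx', fun m => (congrArg Neg.neg (h m)).trans (map_neg _ _).symm⟩
    | mul x y _ _ hx hy =>
      obtain ⟨x', hx', h⟩ := hx
      obtain ⟨y', hy', h'⟩ := hy
      exact ⟨x' * y', mul_mem hx' hy', fun m => by simp [h, h']⟩
  · intro s hs
    induction hs using Subring.closure_induction with
    | mem x h =>
      rcases h with ⟨i, rfl⟩ | ⟨p, rfl⟩
      · exact ⟨_, nab_mem_opRing i, fun m => (nab_tau _ _).symm⟩
      · exact ⟨_, mulOp_mem_opRing (translate (fun j => (a j : R)) p), fun m => by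
          rw [mulOp_apply, mulOp_apply, tau_mul, e]⟩
    | zero => exact ⟨0, zero_mem _, fun m => by simp⟩
    | one => exact ⟨1, one_mem _, fun m => rfl⟩
    | add x y _ _ hx hy =>
      obtain ⟨x', hx', h⟩ := hx
      obtain ⟨y', hy', h'⟩ := hy
      exact ⟨x' + y', add_mem hx' hy', fun m => (map_add _ _ _).trans (congrArg₂ (· + ·) (h m) (h' m))⟩
    | neg x _ hx =>
      obtain ⟨x', hx', h⟩ := hx
      exact ⟨-x', neg_mem hx', fun m => (map_neg _ _).trans (congrArg Neg.neg (h m))⟩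
    | mul x y _ _ hx hy =>
      obtain ⟨x', hx', h⟩ := hx
      obtain ⟨y', hy', h'⟩ := hy
      exact ⟨x' * y', mul_mem hx' hy', fun m => by simp [h, h']⟩

variable [DecidableEq ι]

theorem twK_mul_prod (hF : ∀ j, ψ (F j) ≠ 0) {B : Type*} [CommRing B] [Algebra ℂ B] (η : B →ₐ[ℂ] K)
    (G : ι → B) (hG : ∀ j, η (G j) = ψ (F j)) (E : I → Derivation ℂ B B) (d : I → Derivation ℂ K K)
    (hd : ∀ i b, d i (η b) = η (E i b)) (i : I) :
    twK (d i) (fun j => ψ (F j)) * C (η (∏ j, G j)) = map η.toRingHom (tw E G i) := by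
  simp only [twK, tw, map_sum, Finset.sum_mul]
  refine Finset.sum_congr rfl fun j _ => ?_
  rw [map_mul, map_X, map_C, mul_assoc, ← map_mul C]
  congr 2
  change _ = η _
  rw [map_mul, ← hd, hG, ← Finset.mul_prod_erase Finset.univ G (Finset.mem_univ j), map_mul, hG]
  field_simp [hF j]

/-- Membership in the module generated over `R`, tested in the fraction field. -/
theorem exists_genP_of_opRing (hF : ∀ j, ψ (F j) ≠ 0)
    (hδ : ∀ i r, δ i (ψ r) = ψ (D i r)) (a : ι → ℕ) (J : R) {s : AddMonoid.End (MvPolynomial ι K)}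
    (hs : s ∈ opRing ψ δ F) :
    ∃ Λ m, GenP D F a J Λ m ∧
      C (ψ (∏ j, F j) ^ Λ) * s (C (ψ ((∏ j, F j ^ a j) * J))) = map ψ.toRingHom m := by
  suffices H : ∀ x : MvPolynomial ι K, (∃ Λ m, GenP D F a J Λ m ∧
      C (ψ (∏ j, F j) ^ Λ) * x = map ψ.toRingHom m) → (∃ Λ m, GenP D F a J Λ m ∧
      C (ψ (∏ j, F j) ^ Λ) * s x = map ψ.toRingHom m) from
    H _ ⟨0, _, Gen.base, by simp⟩
  have hadd : ∀ x y : MvPolynomial ι K, (∃ Λ m, GenP D F a J Λ m ∧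
      C (ψ (∏ j, F j) ^ Λ) * x = map ψ.toRingHom m) → (∃ Λ m, GenP D F a J Λ m ∧
      C (ψ (∏ j, F j) ^ Λ) * y = map ψ.toRingHom m) → (∃ Λ m, GenP D F a J Λ m ∧
      C (ψ (∏ j, F j) ^ Λ) * (x + y) = map ψ.toRingHom m) := by
    rintro x y ⟨Λ, m, h, e⟩ ⟨Λ', m', h', e'⟩
    refine ⟨Λ + Λ', _, (h.pow_mul Λ').add (by rw [add_comm]; exact h'.pow_mul Λ), ?_⟩
    rw [map_add, map_mul, map_mul, ← e, ← e']
    simp only [map_pow, map_C]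
    change _ = C (ψ _) ^ _ * _ + C (ψ _) ^ _ * _
    ring
  have hmul : ∀ (c : MvPolynomial ι R) (x : MvPolynomial ι K), (∃ Λ m, GenP D F a J Λ m ∧
      C (ψ (∏ j, F j) ^ Λ) * x = map ψ.toRingHom m) → (∃ Λ m, GenP D F a J Λ m ∧
      C (ψ (∏ j, F j) ^ Λ) * (map ψ.toRingHom c * x) = map ψ.toRingHom m) := by
    rintro c x ⟨Λ, m, h, e⟩
    exact ⟨Λ, _, h.smul c, by rw [map_mul, ← e]; ring⟩
  induction hs using Subring.closure_induction with
  | mem s h =>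
    rcases h with ⟨i, rfl⟩ | ⟨p, rfl⟩
    · rintro x ⟨Λ, m, h, e⟩
      refine ⟨Λ + 1, _, h.nabla i, ?_⟩
      have h1 : coeffDer (δ i) (map ψ.toRingHom m) = map ψ.toRingHom (coeffDer (D i) m) := by
        refine coeffDer_hom (δ i) (D i) (map ψ.toRingHom) ψ.toRingHom (fun b => map_C _ _) ?_
          (hδ i) m
        intro k; simp
      have h2 := twK_mul_prod hF ψ F (fun _ => rfl) D δ hδ i
      rw [nab_apply, map_add, map_sub, map_mul, map_mul, map_mul, map_mul, ← h1, ← e, ← h2,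
        Derivation.leibniz, map_C, coeffDer_C, coeffDer_C, map_C]
      change _ = C (ψ _) * _ - _ * C (ψ _) * _ + _
      rw [← hδ, Derivation.leibniz_pow]
      simp only [smul_eq_mul, nsmul_eq_mul, map_mul, map_pow, map_natCast]
      rcases Λ with _ | Λ
      · simp; ring
      · rw [Nat.add_sub_cancel]; push_cast; ring
    · exact fun x hx => hmul p x hx
  | zero => exact fun x _ => ⟨0, 0, Gen.zero, by simp⟩
  | one => exact fun x hx => hx
  | add s t _ _ hs ht => exact fun x hx => hadd _ _ (hs x hx) (ht x hx)
  | neg s _ hs =>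
    intro x hx
    have := hmul (-1) _ (hs x hx)
    rwa [map_neg, map_one, neg_one_mul] at this
  | mul s t _ _ hs ht => exact fun x hx => hs _ (ht x hx)

end OperatorRing

section Chart
variable {R K : Type*} [CommRing R] [Algebra ℂ R] [Field K] [Algebra ℂ K]
  {ι I : Type*} [Fintype ι] {ψ : R →ₐ[ℂ] K} {F : ι → R}

/-- The sequence of multiples of `x` by the powers of `g`. -/
def ell (g : K) (x : MvPolynomial ι K) : ℤ → MvPolynomial ι K := fun k => C (g ^ k) * x

omit [Algebra ℂ K] [Fintype ι] in
theorem ell_add (g : K) (x y : MvPolynomial ι K) : ell g (x + y) = ell g x + ell g y :=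
  funext fun _ => mul_add _ _ _

/-- The sequences in the image of `τ` composed with an operator ring. -/
def inImage (U : Subring (AddMonoid.End (ℤ → MvPolynomial ι K))) (hF : ∀ j, ψ (F j) ≠ 0) (a : ι → ℕ)
    (u v : ℤ → MvPolynomial ι K) : Prop :=
  ∃ A ∈ U, v = fun k => tauEquiv _ hF a (A u k)

variable {U : Subring (AddMonoid.End (ℤ → MvPolynomial ι K))} {hF : ∀ j, ψ (F j) ≠ 0} {a : ι → ℕ}
  {u v w : ℤ → MvPolynomial ι K}

theorem inImage.add (hv : inImage U hF a u v) (hw : inImage U hF a u w) :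
    inImage U hF a u (v + w) := by
  obtain ⟨A, hA, rfl⟩ := hv
  obtain ⟨A', hA', rfl⟩ := hw
  exact ⟨A + A', add_mem hA hA', funext fun k => (map_add (tauEquiv _ hF a) _ _).symm⟩

theorem inImage.apply (hU : ∀ X ∈ U, ∃ X' ∈ U, ∀ m : ℤ → MvPolynomial ι K,
      X (fun k => tauEquiv _ hF a (m k)) = fun k => tauEquiv _ hF a (X' m k))
    (hv : inImage U hF a u v) {X : AddMonoid.End (ℤ → MvPolynomial ι K)} (hX : X ∈ U) :
    inImage U hF a u (X v) := by
  obtain ⟨A, hA, rfl⟩ := hv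
  obtain ⟨X', hX', h⟩ := hU X hX
  exact ⟨X' * A, mul_mem hX' hA, h _⟩

theorem ell_tau (hF : ∀ j, ψ (F j) ≠ 0) (a : ι → ℕ) (g c : K) :
    ell g (C ((∏ j, ψ (F j) ^ a j) * c)) = fun k => tauEquiv _ hF a (ell g (C c) k) := by
  funext k
  rw [ell, ell, tau_C_mul, tau_C]

variable [DecidableEq ι] {B : Type*} [CommRing B] [Algebra ℂ B]

theorem nab_chart (η : B →ₐ[ℂ] K) {G : ι → B} (hG : ∀ j, η (G j) = ψ (F j))
    {E : I → Derivation ℂ B B} {d : I → Derivation ℂ K K} (hd : ∀ i b, d i (η b) = η (E i b)) {ω : B}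
    (hω : η ω ≠ 0) (hF : ∀ j, ψ (F j) ≠ 0) (i : I) (m : MvPolynomial ι B) (Λ : ℕ) :
    C (η ω)⁻¹ * nab (d i) (fun j => ψ (F j)) (C (η ω) * (C (η (∏ j, G j) ^ Λ * η ω)⁻¹ *
      map η.toRingHom m)) = C (η (∏ j, G j) ^ (Λ + 1) * η ω)⁻¹ * map η.toRingHom
        (C (∏ j, G j) * coeffDer (E i) m - (Λ : MvPolynomial ι B) * coeffDer (E i) (C (∏ j, G j)) * m + m * tw E G i) := by
  have hG0 : η (∏ j, G j) ≠ 0 := by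
    rw [map_prod]; exact Finset.prod_ne_zero_iff.2 fun j _ => by rw [hG]; exact hF j
  have h1 : coeffDer (d i) (map η.toRingHom m) = map η.toRingHom (coeffDer (E i) m) :=
    coeffDer_hom (d i) (E i) (map η.toRingHom) η.toRingHom (fun b => map_C _ _)
      (fun k => by simp) (hd i) m
  have h2 := twK_mul_prod hF η G hG E d hd i
  have h3 := hd i (∏ j, G j)
  have hC : ∀ b : B, map η.toRingHom (C b : MvPolynomial ι B) = C (η b) := fun b => map_C _ _
  simp only [map_add, map_sub, map_mul, coeffDer_C, hC, map_natCast, ← h1, ← h2, ← h3]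
  generalize η (∏ j, G j) = f at *
  generalize η ω = w at *
  generalize map η.toRingHom m = x
  rw [nab_apply, Derivation.leibniz, Derivation.leibniz]
  simp only [coeffDer_C, smul_eq_mul]
  have e2 : d i (f ^ Λ * w)⁻¹ = - (Λ * d i f * (f ^ (Λ + 1) * w)⁻¹) - d i w * (f ^ Λ * w ^ 2)⁻¹ := by
    rw [Derivation.leibniz_inv, Derivation.leibniz, Derivation.leibniz_pow]
    simp only [smul_eq_mul, nsmul_eq_mul]
    rcases Λ with _ | Λ
    · simp [mul_comm]
    · rw [Nat.add_sub_cancel]; field_simp; ring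
  rw [e2]
  simp only [map_sub, map_neg, map_mul, map_natCast, mul_inv, pow_succ, pow_zero, one_mul]
  have e5 : (C f⁻¹ * C f : MvPolynomial ι K) = 1 := by
    rw [← map_mul, inv_mul_cancel₀ hG0, map_one]
  have e6 : (C w⁻¹ * C w : MvPolynomial ι K) = 1 := by
    rw [← map_mul, inv_mul_cancel₀ hω, map_one]
  generalize (C (f ^ Λ)⁻¹ : MvPolynomial ι K) = fl at *
  generalize (C (f⁻¹) : MvPolynomial ι K) = fi at *
  generalize (C (w⁻¹) : MvPolynomial ι K) = wi at *
  generalize (C w : MvPolynomial ι K) = w' at *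
  generalize (C f : MvPolynomial ι K) = f' at *
  generalize coeffDer (d i) x = dx
  generalize twK (d i) (fun j => ψ (F j)) = t
  generalize (C (d i f) : MvPolynomial ι K) = df
  generalize (C (d i w) : MvPolynomial ι K) = dw
  generalize (Λ : MvPolynomial ι K) = L
  linear_combination (fl * wi * (dx + x * t) - fl * fi * wi * L * df * x - x * dw * fl * wi * wi) * e6
    - fl * wi * (dx + x * t) * e5

theorem inImage_of_genP {g : K} (hU : ∀ X ∈ U, ∃ X' ∈ U, ∀ m : ℤ → MvPolynomial ι K,
      X (fun k => tauEquiv _ hF a (m k)) = fun k => tauEquiv _ hF a (X' m k))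
    (η : B →ₐ[ℂ] K) {G : ι → B} (hG : ∀ j, η (G j) = ψ (F j)) {E : I → Derivation ℂ B B}
    {d : I → Derivation ℂ K K} (hd : ∀ i b, d i (η b) = η (E i b)) {ω J' : B} (hω : η ω ≠ 0) {J : R}
    (hJ : η J' = ψ J)
    (hmul : ∀ c : MvPolynomial ι B, ∃ X ∈ U, ∀ x, X (ell g x) = ell g (map η.toRingHom c * x))
    (hnab : ∀ i, ∃ X ∈ U, ∀ x, X (ell g x) =
      ell g (C (η ω)⁻¹ * nab (d i) (fun j => ψ (F j)) (C (η ω) * x)))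
    {Λ : ℕ} {m : MvPolynomial ι B} (h : GenP E G a (J' * ω) Λ m) :
    inImage U hF a (ell g (C (ψ J))) (ell g (C (η (∏ j, G j) ^ Λ * η ω)⁻¹ * map η.toRingHom m)) := by
  have hG0 : η (∏ j, G j) ≠ 0 := by
    rw [map_prod]; exact Finset.prod_ne_zero_iff.2 fun j _ => by rw [hG]; exact hF j
  induction h with
  | base =>
    refine ⟨1, one_mem _, (congrArg (ell g) ?_).trans (ell_tau hF a g (ψ J))⟩
    rw [map_C, ← map_mul]
    refine congrArg C (?_ : _ * η _ = _)
    simp only [map_mul, map_prod, map_pow, hG, hJ]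
    field_simp
  | smul c _ ih =>
    obtain ⟨X, hX, h⟩ := hmul c
    have := ih.apply hU hX
    rw [h] at this
    convert this using 2
    rw [map_mul]; ring
  | add _ _ ih ih' =>
    have := ih.add ih'
    rw [← ell_add] at this
    convert this using 2
    rw [map_add, mul_add]
  | @clear Λ m _ ih =>
    convert ih using 2
    rw [map_mul, map_C, ← mul_assoc, ← map_mul]
    refine congrArg (C · * _) (?_ : _ * η _ = _)
    field_simp
    ring
  | @nabla Λ m i _ ih =>
    obtain ⟨X, hX, h⟩ := hnab i
    have := ih.apply hU hX
    rw [h] at this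
    rwa [nab_chart η hG hd hω hF i m Λ] at this

theorem inImage_of_chart {g : K} (hU : ∀ X ∈ U, ∃ X' ∈ U, ∀ m : ℤ → MvPolynomial ι K,
      X (fun k => tauEquiv _ hF a (m k)) = fun k => tauEquiv _ hF a (X' m k))
    (η : B →ₐ[ℂ] K) {G : ι → B} (hG : ∀ j, η (G j) = ψ (F j)) {E : I → Derivation ℂ B B}
    {d : I → Derivation ℂ K K} (hd : ∀ i b, d i (η b) = η (E i b)) {ω J' : B} (hω : η ω ≠ 0) {J : R}
    (hJ : η J' = ψ J)
    (hmul : ∀ c : MvPolynomial ι B, ∃ X ∈ U, ∀ x, X (ell g x) = ell g (map η.toRingHom c * x))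
    (hnab : ∀ i, ∃ X ∈ U, ∀ x, X (ell g x) =
      ell g (C (η ω)⁻¹ * nab (d i) (fun j => ψ (F j)) (C (η ω) * x)))
    {b : MvPolynomial ι ℂ} {Λ : ℕ} {φ : B} {e : MvPolynomial ι B} (h : GenP E G a (J' * ω) Λ e)
    {κ : Ideal B} (hκ : ∀ x ∈ κ, η x = 0)
    (hb : ∀ t, coeff t (C (φ * ((∏ j, G j) ^ Λ * (J' * ω))) * map (algebraMap ℂ B) b - e) ∈ κ) :
    inImage U hF a (ell g (C (ψ J)))
      (ell g (C (η φ) * C (ψ J) * map (algebraMap ℂ K) b)) := by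
  have hG0 : η (∏ j, G j) ≠ 0 := by
    rw [map_prod]; exact Finset.prod_ne_zero_iff.2 fun j _ => by rw [hG]; exact hF j
  have := inImage_of_genP hU η hG hd hω hJ hmul hnab h
  have e1 : map η.toRingHom e = map η.toRingHom
      (C (φ * ((∏ j, G j) ^ Λ * (J' * ω))) * map (algebraMap ℂ B) b) := by
    rw [eq_comm, ← sub_eq_zero, ← map_sub]
    ext t
    rw [coeff_map, coeff_zero]
    exact hκ _ (hb t)
  rw [e1] at this
  convert this using 2
  rw [map_mul (map η.toRingHom), map_map, map_C, ← mul_assoc]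
  congr 1
  · rw [← map_mul, ← map_mul]
    congr 1
    change _ = _ * η _
    simp only [map_mul, map_pow, hJ]
    field_simp
  · exact congrArg (map · b) (RingHom.ext fun x => (η.commutes x).symm)

end Chart

section PolyDer
variable {R K : Type*} [CommRing R] [Algebra ℂ R] [Field K] [Algebra ℂ K] {I : Type*} [DecidableEq I]

/-- The coefficientwise derivation on polynomials. -/
def polyDer (D : Derivation ℂ R R) : Derivation ℂ (Polynomial R) (Polynomial R) :=
  PolynomialModule.equivPolynomialSelf.compDer D.mapCoeffs

@[simp] theorem coeff_polyDer (D : Derivation ℂ R R) (p : Polynomial R) (k : ℕ) :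
    (polyDer D p).coeff k = D (p.coeff k) := rfl

@[simp] theorem polyDer_C (D : Derivation ℂ R R) (r : R) :
    polyDer D (Polynomial.C r) = Polynomial.C (D r) := by
  ext k; rw [coeff_polyDer, Polynomial.coeff_C, Polynomial.coeff_C]; split_ifs <;> simp

@[simp] theorem polyDer_X (D : Derivation ℂ R R) : polyDer D Polynomial.X = 0 := by
  ext k; rw [coeff_polyDer, Polynomial.coeff_X]; split_ifs <;> simp

/-- The derivations along the coordinates of the chart `y_j = y_i X` of the blow-up. -/
def chartDer (D : I → Derivation ℂ R R) (y : I → R) (i j k : I) :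
    Derivation ℂ (Polynomial R) (Polynomial R) :=
  if k = i then polyDer (D i) + (Polynomial.X : Polynomial R) • polyDer (D j)
  else if k = j then Polynomial.C (y i) • polyDer (D j) + Polynomial.derivative'.restrictScalars ℂ
  else polyDer (D k)

theorem derivation_hom_eq {K : Type*} [CommRing K] [Algebra ℂ K] (η : Polynomial R →ₐ[ℂ] K)
    (d : Derivation ℂ K K) (E : Derivation ℂ (Polynomial R) (Polynomial R))
    (hC : ∀ r, d (η (Polynomial.C r)) = η (E (Polynomial.C r)))
    (hX : d (η Polynomial.X) = η (E Polynomial.X)) (b : Polynomial R) : d (η b) = η (E b) := by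
  induction b using Polynomial.induction_on with
  | C a => exact hC a
  | add p q hp hq => simp only [map_add, hp, hq]
  | monomial n a h =>
    rw [pow_succ, ← mul_assoc, map_mul η, Derivation.leibniz, Derivation.leibniz, h, hX]
    simp only [smul_eq_mul, map_add, map_mul]

/-- The vector fields on the target corresponding to the chart coordinates. -/
def chartVec (δ : I → Derivation ℂ K K) (v γ : K) (i j k : I) : Derivation ℂ K K :=
  if k = i then δ i + γ • δ j else if k = j then v • δ j else δ k

variable {ψ : R →ₐ[ℂ] K} {δ : I → Derivation ℂ K K} {D : I → Derivation ℂ R R} {y : I → R} {i j : I}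

theorem chartVec_ratio (hδ : ∀ i r, δ i (ψ r) = ψ (D i r))
    (hy : ∀ k l, D k (y l) = if k = l then 1 else 0) (hv : ψ (y i) ≠ 0)
    {γ : K} (hγ : γ * ψ (y i) = ψ (y j)) (k : I) :
    δ k γ = ((if k = j then 1 else 0) - if k = i then γ else 0) / ψ (y i) := by
  have : γ = ψ (y j) * (ψ (y i))⁻¹ := by field_simp; exact hγ
  rw [eq_div_iff hv]
  have h := congrArg (δ k) hγ
  rw [Derivation.leibniz, hδ, hδ, hy, hy, smul_eq_mul, smul_eq_mul] at h
  split_ifs at h ⊢ <;> simp only [map_one, map_zero, mul_one, mul_zero, zero_add] at h <;>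
    linear_combination h

theorem chartVec_hom (hδ : ∀ i r, δ i (ψ r) = ψ (D i r))
    (hy : ∀ k l, D k (y l) = if k = l then 1 else 0) (hij : i ≠ j) (hv : ψ (y i) ≠ 0)
    {γ : K} (hγ : γ * ψ (y i) = ψ (y j)) (η : Polynomial R →ₐ[ℂ] K)
    (hC : ∀ r, η (Polynomial.C r) = ψ r) (hX : η Polynomial.X = γ) (k : I) (b : Polynomial R) :
    chartVec δ (ψ (y i)) γ i j k (η b) = η (chartDer D y i j k b) := by
  have hr := chartVec_ratio hδ hy hv hγ
  refine derivation_hom_eq η _ _ (fun r => ?_) ?_ b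
  · unfold chartVec chartDer
    split_ifs
    · simp [hC, hX, hδ]; ring
    · simp [hC, hδ]
    · simp [hC, hδ]
  · unfold chartVec chartDer
    split_ifs with h1 h2
    · simp [hX, hr, hij, hij.symm]; ring
    · simp [hX, hr, hij.symm, hv]
    · simp [hX, hr, h1, h2]

variable {ι : Type*} [Fintype ι] {F : ι → R} {U : Subring (AddMonoid.End (ℤ → MvPolynomial ι K))}
  {g γ : K} {e : ℤ}

omit [DecidableEq I] in
theorem exists_mul_ell (hU : ∀ s ∈ opRing ψ δ F, diag s ∈ U) (hUs : shiftOp e ∈ U) (hg : g ≠ 0)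
    (hγ : γ = g ^ e) (η : Polynomial R →ₐ[ℂ] K) (hC : ∀ r, η (Polynomial.C r) = ψ r)
    (hX : η Polynomial.X = γ) (c : MvPolynomial ι (Polynomial R)) :
    ∃ X ∈ U, ∀ x, X (ell g x) = ell g (map η.toRingHom c * x) := by
  have hmul : ∀ c c' : MvPolynomial ι (Polynomial R),
      (∃ X ∈ U, ∀ x, X (ell g x) = ell g (map η.toRingHom c * x)) →
      (∃ X ∈ U, ∀ x, X (ell g x) = ell g (map η.toRingHom c' * x)) →
      ∃ X ∈ U, ∀ x, X (ell g x) = ell g (map η.toRingHom (c * c') * x) := by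
    rintro c c' ⟨A, hA, h⟩ ⟨A', hA', h'⟩
    refine ⟨A * A', mul_mem hA hA', fun x => ?_⟩
    rw [map_mul, mul_assoc, ← h, ← h']
    rfl
  have hadd : ∀ c c' : MvPolynomial ι (Polynomial R),
      (∃ X ∈ U, ∀ x, X (ell g x) = ell g (map η.toRingHom c * x)) →
      (∃ X ∈ U, ∀ x, X (ell g x) = ell g (map η.toRingHom c' * x)) →
      ∃ X ∈ U, ∀ x, X (ell g x) = ell g (map η.toRingHom (c + c') * x) := by
    rintro c c' ⟨A, hA, h⟩ ⟨A', hA', h'⟩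
    refine ⟨A + A', add_mem hA hA', fun x => ?_⟩
    rw [map_add, add_mul, ell_add, ← h, ← h']
    rfl
  have hop : ∀ (p : MvPolynomial ι R) (c : MvPolynomial ι (Polynomial R)),
      map ψ.toRingHom p = map η.toRingHom c →
      ∃ X ∈ U, ∀ x, X (ell g x) = ell g (map η.toRingHom c * x) := by
    intro p c h
    refine ⟨diag (mulOp ψ p), hU _ (mulOp_mem_opRing p), fun x => funext fun k => ?_⟩
    rw [diag_apply, mulOp_apply, h, ell, ell]
    ring
  have hXX : ∃ X ∈ U, ∀ x, X (ell g x) =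
      ell g (map η.toRingHom (C Polynomial.X : MvPolynomial ι (Polynomial R)) * x) := by
    refine ⟨shiftOp e, hUs, fun x => funext fun k => ?_⟩
    have : map η.toRingHom (C Polynomial.X : MvPolynomial ι (Polynomial R)) = C γ := by
      rw [map_C]; exact congrArg C hX
    rw [shiftOp_apply, this, hγ, ell, ell, zpow_add₀ hg, map_mul, mul_assoc]
  have hCC : ∀ r : R, ∃ X ∈ U, ∀ x, X (ell g x) =
      ell g (map η.toRingHom (C (Polynomial.C r) : MvPolynomial ι (Polynomial R)) * x) := by
    refine fun r => hop (C r) _ ?_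
    rw [map_C, map_C]
    exact congrArg C (hC r).symm
  induction c using MvPolynomial.induction_on with
  | C q =>
    induction q using Polynomial.induction_on with
    | C r => exact hCC r
    | add p q hp hq => rw [map_add]; exact hadd _ _ hp hq
    | monomial n r h =>
      rw [pow_succ, ← mul_assoc, map_mul]
      exact hmul _ _ h hXX
  | add p q hp hq => exact hadd _ _ hp hq
  | mul_X p l h => exact hmul _ _ h (hop (X l) _ (by rw [map_X, map_X]))

theorem nab_pow_mul (d : Derivation ℂ K K) (F : ι → K) (n : ℤ) (x : MvPolynomial ι K) :
    nab d F (C (γ ^ n) * x) = C (γ ^ n) * nab d F x + C (n * (γ ^ (n - 1) * d γ)) * x := by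
  rw [nab_mul, coeffDer_C, Derivation.leibniz_zpow, zsmul_eq_mul, smul_eq_mul, add_comm]

theorem exists_nab_ell (hδ : ∀ i r, δ i (ψ r) = ψ (D i r))
    (hy : ∀ k l, D k (y l) = if k = l then 1 else 0) (hij : i ≠ j) (hv : ψ (y i) ≠ 0)
    (hγv : γ * ψ (y i) = ψ (y j)) (hγ0 : γ ≠ 0)
    (hU : ∀ s ∈ opRing ψ δ F, diag s ∈ U) (hUs : shiftOp e ∈ U)
    (hUp : polOp (Polynomial.C e * Polynomial.X) * shiftOp (-e) ∈ U) (he : e * e = 1)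
    (hg : ∀ k : ℤ, g ^ k = γ ^ (e * k)) (k : I) :
    ∃ X ∈ U, ∀ x, X (ell g x) = ell g (C (ψ (y i))⁻¹ *
      nab (chartVec δ (ψ (y i)) γ i j k) (fun l => ψ (F l)) (C (ψ (y i)) * x)) := by
  have hr := chartVec_ratio hδ hy hv hγv
  have hvd : ∀ k, δ k (ψ (y i)) = if k = i then 1 else 0 := fun k => by
    rw [hδ, hy]; split_ifs <;> simp
  have e6 : (C (ψ (y i))⁻¹ * C (ψ (y i)) : MvPolynomial ι K) = 1 := by
    rw [← map_mul, inv_mul_cancel₀ hv, map_one]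
  have e7 : ∀ n : ℤ, γ ^ (n - 1) * γ = γ ^ n := fun n => by
    rw [zpow_sub₀ hγ0, zpow_one]; field_simp
  unfold chartVec
  split_ifs with h1 h2
  · subst h1
    refine ⟨diag (nab (δ k) fun j => ψ (F j)) + diag (nab (δ j) fun j => ψ (F j)) * shiftOp e,
      add_mem (hU _ (nab_mem_opRing k)) (mul_mem (hU _ (nab_mem_opRing j)) hUs), fun x => funext fun n => ?_⟩
    have step : ell g (C (ψ (y k))⁻¹ *
        nab (δ k + γ • δ j) (fun l => ψ (F l)) (C (ψ (y k)) * x)) n =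
        nab (δ k) (fun j => ψ (F j)) (C (γ ^ (e * n)) * x) +
        nab (δ j) (fun j => ψ (F j)) (C (γ ^ (e * n + 1)) * x) := by
      rw [nab_add, nab_smul, nab_mul, nab_mul, coeffDer_C, coeffDer_C, hvd, hvd, nab_pow_mul,
        nab_pow_mul, hr, hr, ell, hg, if_pos rfl, if_pos rfl, if_neg hij,
        if_neg hij.symm, if_pos rfl, if_neg hij.symm]
      have : (C (((e * n : ℤ) : K) * (γ ^ (e * n - 1) * ((0 - γ) / ψ (y k)))) +
          C (((e * n + 1 : ℤ) : K) * (γ ^ (e * n + 1 - 1) * ((1 - 0) / ψ (y k)))) :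
          MvPolynomial ι K) = C (γ ^ (e * n)) * C (ψ (y k))⁻¹ := by
        rw [← map_add, ← map_mul]
        congr 1
        rw [add_sub_cancel_right, ← e7 (e * n)]
        push_cast
        ring
      have h8 : (C (γ ^ (e * n + 1)) : MvPolynomial ι K) = C (γ ^ (e * n)) * C γ := by
        rw [← map_mul, zpow_add_one₀ hγ0]
      rw [h8, map_one, map_zero]
      linear_combination -this * x + (C (γ ^ (e * n))) * (nab (δ k) (fun l => ψ (F l)) x +
        C γ * nab (δ j) (fun l => ψ (F l)) x) * e6
    rw [step, ← he, ← mul_add, ← hg, ← hg]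
    rfl
  · subst h2
    refine ⟨diag ((nab (δ k) fun j => ψ (F j)) * mulOp ψ (C (y i))) -
      polOp (Polynomial.C e * Polynomial.X) * shiftOp (-e),
      sub_mem (hU _ (mul_mem (nab_mem_opRing k) (mulOp_mem_opRing _))) hUp, fun x => funext fun n => ?_⟩
    have hA : (Polynomial.C e * Polynomial.X).eval n • ell g x (n + -e) =
        C (((e * n : ℤ) : K) * γ ^ (e * n - 1)) * x := by
      rw [ell, hg, mul_add, mul_neg, he, ← sub_eq_add_neg, zsmul_eq_mul]
      simp [mul_assoc]
    have hB : map ψ.toRingHom (C (y i) : MvPolynomial ι R) * ell g x n =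
        C (ψ (y i)) * (C (γ ^ (e * n)) * x) := by rw [map_C, ell, hg]; rfl
    refine (congrArg₂ (fun p q => nab (δ k) (fun j => ψ (F j)) p - q) hB hA).trans ?_
    rw [nab_smul, nab_mul, nab_mul _ _ (C (ψ (y i))) x, coeffDer_C, hvd, nab_pow_mul, hr, ell, hg,
      if_pos rfl, if_neg h1, if_neg h1]
    have : (C (((e * n : ℤ) : K) * (γ ^ (e * n - 1) * ((1 - 0) / ψ (y i)))) * C (ψ (y i)): MvPolynomial ι K) = C (((e * n : ℤ) : K) * γ ^ (e * n - 1)) := by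
      rw [← map_mul]
      congr 1
      field_simp
      ring
    rw [map_zero]
    linear_combination x * this - C (γ ^ (e * n)) * C (ψ (y i)) * nab (δ k) (fun l => ψ (F l)) x * e6
  · refine ⟨diag (nab (δ k) fun j => ψ (F j)), hU _ (nab_mem_opRing k), fun x => funext fun n => ?_⟩
    rw [diag_apply, ell, ell, hg, nab_pow_mul, nab_mul, coeffDer_C, hvd, hr, if_neg h1, if_neg h2,
      if_neg h1]
    simp only [sub_zero, zero_div, mul_zero, map_zero, zero_mul, add_zero, zero_add]
    linear_combination -(C (γ ^ (e * n)) * nab (δ k) (fun l => ψ (F l)) x) * e6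

end PolyDer

section Charts
variable {R : Type*} [CommRing R] [Algebra ℂ R]

theorem isUnit_coeff_zero {ρ : R →ₐ[ℂ] ℂ} (hρ : ∀ r, ρ r ≠ 0 → IsUnit r) {φ : Polynomial R}
    (h : φ.eval₂ (ρ : R →+* ℂ) 0 = 1) : IsUnit (φ.coeff 0) := by
  refine hρ _ fun h0 => ?_
  rw [Polynomial.eval₂_at_zero] at h
  exact one_ne_zero (h.symm.trans h0)

/-- An ideal of `R[X]`, with `R` local, which avoids every closed point of the affine line over the
residue field and contains a polynomial with invertible leading coefficient is trivial. -/
theorem eq_top_of_charts {ρ : R →ₐ[ℂ] ℂ} (hρ : ∀ r, ρ r ≠ 0 → IsUnit r) {I : Ideal (Polynomial R)}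
    {Ψ : Polynomial R} (hΨ : Ψ ∈ I) {N : ℕ} (hN : Ψ.natDegree ≤ N) (hu : IsUnit (Ψ.coeff N))
    (h : ∀ ξ : ℂ, ∃ φ ∈ I, φ.eval₂ (ρ : R →+* ℂ) ξ = 1) : I = ⊤ := by
  by_contra hI
  obtain ⟨P, hP, hIP⟩ := Ideal.exists_le_maximal I hI
  let L := Polynomial R ⧸ P
  let _ : Field L := Ideal.Quotient.field P
  let π : Polynomial R →ₐ[ℂ] L := Ideal.Quotient.mkₐ ℂ P
  let f : R →+* L := (π : Polynomial R →+* L).comp Polynomial.C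
  obtain ⟨u, hu⟩ := hu
  set p : Polynomial R := Polynomial.C (↑u⁻¹ : R) * Ψ with hp
  have hpm : p.Monic := by
    refine Polynomial.monic_of_natDegree_le_of_coeff_eq_one N ?_ ?_
    · exact (Polynomial.natDegree_C_mul_le _ _).trans hN
    · rw [hp, Polynomial.coeff_C_mul, ← hu, Units.inv_mul]
  have hev : ∀ q : Polynomial R, q.eval₂ f (π Polynomial.X) = π q := fun q =>
    (Polynomial.hom_eval₂ q Polynomial.C (π : Polynomial R →+* L) Polynomial.X).symm.trans
      (by rw [Polynomial.eval₂_C_X]; rfl)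
  have hp0 : π p = 0 := Ideal.Quotient.eq_zero_iff_mem.2 (hIP (I.mul_mem_left _ hΨ))
  have hint : f.IsIntegral := by
    intro x
    obtain ⟨q, rfl⟩ := Ideal.Quotient.mk_surjective x
    have hX : f.IsIntegralElem (π Polynomial.X) := ⟨p, hpm, (hev p).trans hp0⟩
    induction q using Polynomial.induction_on with
    | C r => exact f.isIntegralElem_map
    | add p q hp hq => rw [map_add]; exact hp.add f hq
    | monomial n a h => rw [pow_succ, ← mul_assoc, map_mul]; exact h.mul f hX
  have hmax : ((⊥ : Ideal L).comap f).IsMaximal :=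
    haveI := Ideal.bot_isMaximal (K := L)
    Ideal.isMaximal_comap_of_isIntegral_of_isMaximal' f hint ⊥
  have hker : (⊥ : Ideal L).comap f = RingHom.ker ρ := by
    refine hmax.eq_of_le (RingHom.ker_ne_top _) fun r hr => ?_
    by_contra h0
    exact hmax.ne_top (Ideal.eq_top_of_isUnit_mem _ hr (hρ r h0))
  have hf : ∀ r, f r = algebraMap ℂ L (ρ r) := by
    intro r
    have h1 : r - algebraMap ℂ R (ρ r) ∈ RingHom.ker ρ := by
      rw [RingHom.mem_ker, map_sub, AlgHom.commutes]; exact sub_self _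
    rw [← hker, Ideal.mem_comap, Ideal.mem_bot, map_sub, sub_eq_zero] at h1
    rw [h1]
    exact π.commutes _
  have hf' : f = (algebraMap ℂ L).comp (ρ : R →+* ℂ) := RingHom.ext hf
  have hXint : IsIntegral ℂ (π Polynomial.X) := by
    refine ⟨p.map (ρ : R →+* ℂ), hpm.map _, ?_⟩
    rw [Polynomial.eval₂_map, ← hf', hev, hp0]
  obtain ⟨ξ, hξ⟩ := minpoly.mem_range_of_degree_eq_one ℂ _
    (IsAlgClosed.degree_eq_one_of_irreducible ℂ (minpoly.irreducible hXint))
  obtain ⟨φ, hφ, h1⟩ := h ξ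
  have h2 := hev φ
  rw [hf', ← hξ, ← Polynomial.hom_eval₂ φ (ρ : R →+* ℂ) (algebraMap ℂ L), h1, map_one] at h2
  exact one_ne_zero (h2.trans (Ideal.Quotient.eq_zero_iff_mem.2 (hIP hφ)))

omit [Algebra ℂ R] in
theorem one_mem_of_coeff_zero {I : Ideal (Polynomial R)} {φ : Polynomial R} (hφ : φ ∈ I)
    (hu : IsUnit (φ.coeff 0)) {N : ℕ} (hX : Polynomial.X ^ N ∈ I) : (1 : Polynomial R) ∈ I := by
  obtain ⟨u, hu⟩ := hu
  have h1 : IsCoprime φ Polynomial.X := by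
    refine ⟨Polynomial.C (↑u⁻¹ : R), - Polynomial.C (↑u⁻¹ : R) * φ.divX, ?_⟩
    have h1 := Polynomial.divX_mul_X_add φ
    have h2 : Polynomial.C (↑u⁻¹ : R) * Polynomial.C (φ.coeff 0) = 1 := by
      rw [← map_mul, ← hu, Units.inv_mul, map_one]
    linear_combination -Polynomial.C (↑u⁻¹ : R) * h1 + h2
  obtain ⟨x, y, h⟩ := h1.pow_right (n := N)
  rw [← h]
  exact add_mem (I.mul_mem_left _ hφ) (I.mul_mem_left _ hX)

end Charts

section Loc
variable {R K : Type*} [CommRing R] [Algebra ℂ R] [Field K] [Algebra ℂ K]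
  {ι I : Type*} [Fintype ι] {ψ : R →ₐ[ℂ] K} {F : ι → R}
  {U : Subring (AddMonoid.End (ℤ → MvPolynomial ι K))} {g : K}

/-- The functions `φ` on a chart for which `φ b F^s` belongs to the module for some product of
linear forms `b`. -/
def locIdeal {hF : ∀ j, ψ (F j) ≠ 0} {a : ι → ℕ} (J : R)
    (hU : ∀ X ∈ U, ∃ X' ∈ U, ∀ m : ℤ → MvPolynomial ι K,
      X (fun k => tauEquiv _ hF a (m k)) = fun k => tauEquiv _ hF a (X' m k))
    (η : Polynomial R →ₐ[ℂ] K)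
    (hmul : ∀ c : MvPolynomial ι (Polynomial R), ∃ X ∈ U, ∀ x, X (ell g x) = ell g (map η.toRingHom c * x)) :
    Ideal (Polynomial R) where
  carrier := {φ | ∃ b ∈ linForms ι, inImage U hF a (ell g (C (ψ J)))
    (ell g (C (η φ) * C (ψ J) * map (algebraMap ℂ K) b))}
  zero_mem' := ⟨1, one_mem _, 0, zero_mem _, funext fun k => by simp [ell]⟩
  add_mem' := by
    rintro φ φ' ⟨b, hb, h⟩ ⟨b', hb', h'⟩
    refine ⟨b * b', mul_mem hb hb', ?_⟩
    obtain ⟨X, hX, e⟩ := hmul (map (algebraMap ℂ (Polynomial R)) b')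
    obtain ⟨X', hX', e'⟩ := hmul (map (algebraMap ℂ (Polynomial R)) b)
    have hmap : ∀ p : MvPolynomial ι ℂ, map η.toRingHom (map (algebraMap ℂ (Polynomial R)) p) =
        map (algebraMap ℂ K) p := fun p => by
      rw [map_map]; exact congrArg (map · p) (RingHom.ext fun x => η.commutes x)
    have := (h.apply hU hX).add (h'.apply hU hX')
    rw [e, e', hmap, hmap, ← ell_add] at this
    convert this using 2
    rw [map_add, map_add, map_mul]; ring
  smul_mem' := by
    rintro r φ ⟨b, hb, h⟩
    refine ⟨b, hb, ?_⟩
    obtain ⟨X, hX, e⟩ := hmul (C r)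
    have := h.apply hU hX
    rw [e] at this
    convert this using 2
    rw [map_C, smul_eq_mul, map_mul, map_mul]
    simp only [mul_assoc]
    rfl

omit [Algebra ℂ K] [Fintype ι] in
theorem shiftOp_ell (hg : g ≠ 0) (k : ℤ) (x : MvPolynomial ι K) :
    shiftOp k (ell g x) = ell g (C (g ^ k) * x) := funext fun l => by
  rw [shiftOp_apply, ell, ell, zpow_add₀ hg, map_mul, mul_assoc]

theorem inImage_lower_of_upper {S : Subring (AddMonoid.End (MvPolynomial ι K))}
    {hF : ∀ j, ψ (F j) ≠ 0} {a : ι → ℕ} (hg : g ≠ 0) {u : ℤ → MvPolynomial ι K} {x : MvPolynomial ι K}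
    (h : inImage (upperRing S) hF a u (ell g x)) :
    ∃ w : ℕ, ∀ N ≥ w, inImage (lowerRing S) hF a u (ell g (C (g ^ (-(N : ℤ))) * x)) := by
  obtain ⟨A, hA, e⟩ := h
  obtain ⟨w, -, hw⟩ := bandRing_band hA.1
  refine ⟨w, fun N hN => ⟨shiftOp (-(N : ℤ)) * A, ⟨mul_mem (shiftOp_mem_bandRing _) hA.1, fun m hm k hk =>
    hw 0 m hm _ (by omega)⟩, ?_⟩⟩
  rw [← shiftOp_ell hg, e]
  rfl

theorem inImage_upper_of_lower {S : Subring (AddMonoid.End (MvPolynomial ι K))}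
    {hF : ∀ j, ψ (F j) ≠ 0} {a : ι → ℕ} (hg : g ≠ 0) {u : ℤ → MvPolynomial ι K} {x : MvPolynomial ι K}
    (h : inImage (lowerRing S) hF a u (ell g x)) :
    ∃ w : ℕ, ∀ N ≥ w, inImage (upperRing S) hF a u (ell g (C (g ^ (N : ℤ)) * x)) := by
  obtain ⟨A, hA, e⟩ := h
  obtain ⟨w, hw, -⟩ := bandRing_band hA.1
  refine ⟨w, fun N hN => ⟨shiftOp (N : ℤ) * A, ⟨mul_mem (shiftOp_mem_bandRing _) hA.1, fun m hm k hk =>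
    hw 0 m hm _ (by omega)⟩, ?_⟩⟩
  rw [← shiftOp_ell hg, e]
  rfl

end Loc

section Blowup
variable {R : Type*} [CommRing R] [Algebra ℂ R] {ι I : Type*} [Fintype ι] [DecidableEq ι] [DecidableEq I]

/-- The Bernstein–Sato property on the chart `y_j = y_i X` of the blow-up, near the point `X = ξ`. -/
def ChartGood (D : I → Derivation ℂ R R) (y : I → R) (i j : I) (F : ι → R) (a : ι → ℕ) (J : R)
    (ρ : R →ₐ[ℂ] ℂ) (ξ : ℂ) : Prop :=
  ∃ b ∈ linForms ι, ∃ Λ, ∃ φ : Polynomial R, φ.eval₂ (ρ : R →+* ℂ) ξ = 1 ∧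
    ∃ e, GenP (chartDer D y i j) (fun l => Polynomial.C (F l)) a
      (Polynomial.C J * Polynomial.C (y i)) Λ e ∧
    ∀ t, coeff t (C (φ * ((∏ l, Polynomial.C (F l)) ^ Λ * (Polynomial.C J * Polynomial.C (y i)))) *
      map (algebraMap ℂ (Polynomial R)) b - e) ∈
        Ideal.span {Polynomial.C (y i) * Polynomial.X - Polynomial.C (y j)}

theorem ChartGood.exists_mem {D : I → Derivation ℂ R R} {y : I → R} {i j : I} {F : ι → R} {a : ι → ℕ}
    {J : R} {ρ : R →ₐ[ℂ] ℂ} {ξ : ℂ} (h : ChartGood D y i j F a J ρ ξ)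
    {K : Type*} [Field K] [Algebra ℂ K] {ψ : R →ₐ[ℂ] K} {hF : ∀ j, ψ (F j) ≠ 0}
    {δ : I → Derivation ℂ K K} {g γ : K} {e : ℤ} (hδ : ∀ i r, δ i (ψ r) = ψ (D i r))
    (hy : ∀ k l, D k (y l) = if k = l then 1 else 0) (hij : i ≠ j) (hv : ψ (y i) ≠ 0)
    (hγv : γ * ψ (y i) = ψ (y j)) (hγ0 : γ ≠ 0) {U : Subring (AddMonoid.End (ℤ → MvPolynomial ι K))}
    (hU : ∀ s ∈ opRing ψ δ F, diag s ∈ U) (hUs : shiftOp e ∈ U)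
    (hUp : polOp (Polynomial.C e * Polynomial.X) * shiftOp (-e) ∈ U) (he : e * e = 1)
    (hg : ∀ k : ℤ, g ^ k = γ ^ (e * k)) (η : Polynomial R →ₐ[ℂ] K)
    (hC : ∀ r, η (Polynomial.C r) = ψ r) (hX : η Polynomial.X = γ)
    (hUc : ∀ X ∈ U, ∃ X' ∈ U, ∀ m : ℤ → MvPolynomial ι K,
      X (fun k => tauEquiv _ hF a (m k)) = fun k => tauEquiv _ hF a (X' m k))
    (hmul : ∀ c : MvPolynomial ι (Polynomial R), ∃ X ∈ U, ∀ x, X (ell g x) = ell g (map η.toRingHom c * x)) :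
    ∃ φ ∈ locIdeal J hUc η hmul, φ.eval₂ (ρ : R →+* ℂ) ξ = 1 := by
  obtain ⟨b, hb, Λ, φ, hφ, p, hp, hκ⟩ := h
  refine ⟨φ, ⟨b, hb, ?_⟩, hφ⟩
  refine inImage_of_chart hUc η (G := fun l => Polynomial.C (F l)) (fun l => hC _)
    (chartVec_hom hδ hy hij hv hγv η hC hX) (ω := Polynomial.C (y i)) (by rwa [hC]) (hC J) hmul
    (fun k => ?_) hp (κ := Ideal.span {Polynomial.C (y i) * Polynomial.X - Polynomial.C (y j)})
    (fun x hx => ?_) hκ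
  · rw [hC]
    exact exists_nab_ell hδ hy hij hv hγv hγ0 hU hUs hUp he hg k
  · obtain ⟨q, rfl⟩ := Ideal.mem_span_singleton.1 hx
    rw [map_mul, map_sub, map_mul, hC, hC, hX, mul_comm, ← hγv]
    ring

omit [DecidableEq I] in
theorem fraction_derivation_comm [IsDomain R] {K : Type*} [Field K] [Algebra ℂ K] [Algebra R K] [IsScalarTower ℂ R K]
    [IsFractionRing R K] {D : I → Derivation ℂ R R} {δ : I → Derivation ℂ K K}
    (hδ : ∀ i r, δ i (algebraMap R K r) = algebraMap R K (D i r))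
    (hc : ∀ i k r, D i (D k r) = D k (D i r)) (i k : I) (x : K) : δ i (δ k x) = δ k (δ i x) := by
  obtain ⟨p, q, hq, rfl⟩ := IsFractionRing.div_surjective (A := R) x
  have hq0 : algebraMap R K q ≠ 0 := IsLocalization.to_map_ne_zero_of_mem_nonZeroDivisors _ le_rfl hq
  have h : ∀ r, ⁅δ i, δ k⁆ (algebraMap R K r) = 0 := fun r => by
    rw [Derivation.commutator_apply, hδ, hδ, hδ, hδ, hc, sub_self]
  rw [← sub_eq_zero, ← Derivation.commutator_apply, Derivation.leibniz_div, h, h]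
  simp

omit [DecidableEq ι] [DecidableEq I] in
theorem opRing_mul_map {K : Type*} [Field K] [Algebra ℂ K] {ψ : R →ₐ[ℂ] K} {δ : I → Derivation ℂ K K}
    {F : ι → R} {s : AddMonoid.End (MvPolynomial ι K)} (hs : s ∈ opRing ψ δ F) (b : MvPolynomial ι ℂ)
    (m : MvPolynomial ι K) : s (map (algebraMap ℂ K) b * m) = map (algebraMap ℂ K) b * s m := by
  induction hs using Subring.closure_induction generalizing m with
  | mem s hs =>
    obtain ⟨i, rfl⟩ | ⟨p, rfl⟩ := hs
    · rw [nab_mul, coeffDer_map, zero_mul, zero_add]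
    · exact mul_left_comm _ _ _
  | zero => exact (mul_zero _).symm
  | one => rfl
  | add s t _ _ hs ht => exact (congrArg₂ (· + ·) (hs m) (ht m)).trans (mul_add _ _ _).symm
  | neg s _ hs => exact (congrArg (- ·) (hs m)).trans (mul_neg _ _).symm
  | mul s t _ _ hs ht => exact (congrArg s (ht m)).trans (hs _)

omit [DecidableEq ι] in
theorem tau_iterate_C {K : Type*} [Field K] {F : ι → K} {hF : ∀ j, F j ≠ 0} {a : ι → ℕ} (L : ℕ) (c : K) :
    (tauEquiv F hF a)^[L] (C c) = C ((∏ j, F j ^ a j) ^ L * c) := by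
  induction L with
  | zero => rw [pow_zero, one_mul]; rfl
  | succ L ih => rw [Function.iterate_succ_apply', ih, tau_C, pow_succ', mul_assoc]

omit [DecidableEq I] in
theorem Good.of_inImage [IsNoetherianRing R] [Finite I] {D : I → Derivation ℂ R R}
    {y : I → R} {i j : I} {F : ι → R} {a : ι → ℕ} {J : R} {K : Type*} [Field K] [Algebra ℂ K]
    {ψ : R →ₐ[ℂ] K} (hψ : Function.Injective ψ) {δ : I → Derivation ℂ K K}
    (hδ : ∀ k r, δ k (ψ r) = ψ (D k r)) (hcδ : ∀ i k x, δ i (δ k x) = δ k (δ i x))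
    (hψF : ∀ l, ψ (F l) ≠ 0) {b : MvPolynomial ι ℂ} (hb : b ∈ linForms ι)
    {g : K} (hgv : g * ψ (y i) = ψ (y j)) {p : ℕ} (hp : y i ∣ (∏ l, F l ^ a l) ^ p)
    (key₀ : inImage (upperRing (opRing ψ δ F)) hψF a (ell g (C (ψ J)))
      (ell g (map (algebraMap ℂ K) b * C (ψ J))))
    (key₁ : inImage (lowerRing (opRing ψ δ F)) hψF a (ell g (C (ψ J)))
      (ell g (map (algebraMap ℂ K) b * C (ψ J)))) : Good D F a J := by
  let S := opRing ψ δ F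
  have : IsNoetherianRing S := isNoetherianRing_opRing hψF hδ hcδ
  obtain ⟨hτ, hτ'⟩ := opRing_tau (δ := δ) hψF a
  obtain ⟨A₀, hA₀, e₀⟩ := key₀
  obtain ⟨A₁, hA₁, e₁⟩ := key₁
  obtain ⟨bs, hbs0, hbs'⟩ : ∃ bs : ℕ → MvPolynomial ι ℂ, bs 0 = b ∧
      ∀ k, bs (k + 1) = translate (fun j => (a j : ℂ)) (bs k) :=
    ⟨fun k => (translate fun j => (a j : ℂ))^[k] b, rfl, fun k => Function.iterate_succ_apply' _ _ _⟩
  have hbs : ∀ k, bs k ∈ linForms ι := fun k => by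
    induction k with
    | zero => rwa [hbs0]
    | succ k ih => rw [hbs']; exact linForms_translate a ih
  obtain ⟨B, hBa⟩ : ∃ B : ℕ → AddMonoid.End (MvPolynomial ι K),
      ∀ k m, B k m = map (algebraMap ℂ K) (bs k) * m :=
    ⟨fun k => AddMonoidHom.mulLeft (map (algebraMap ℂ K) (bs k)), fun _ _ => rfl⟩
  obtain ⟨P, hP0, hPa⟩ : ∃ P : ℕ → AddMonoid.End (MvPolynomial ι K), P 0 = 1 ∧
      ∀ k m, P k m = map (algebraMap ℂ K) (∏ l ∈ Finset.range k, bs l) * m :=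
    ⟨fun k => Module.toAddMonoidEnd _ _ (map (algebraMap ℂ K) (∏ l ∈ Finset.range k, bs l)),
      by beta_reduce; rw [Finset.range_zero, Finset.prod_empty, map_one, map_one], fun _ _ => rfl⟩
  have hu : ∀ k, ell g (C (ψ J) : MvPolynomial ι K) k = C (g ^ k) * C (ψ J) := fun k => rfl
  have hB0 : ∀ k, B 0 (ell g (C (ψ J)) k) = ell g (map (algebraMap ℂ K) b * C (ψ J)) k :=
    fun k => by
    rw [hBa, hbs0]; exact mul_left_comm _ _ _
  have hcl : ∀ k : ℕ, ∃ L, ∀ L' ≥ L, ∃ s ∈ S, (tauEquiv _ hψF a)^[L'] (ell g (C (ψ J)) k) =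
      s (ell g (C (ψ J)) 0) := fun k => by
    obtain ⟨L, hL⟩ : ∃ L, y i ^ k ∣ (∏ l, F l ^ a l) ^ L :=
      ⟨p * k, by rw [pow_mul]; exact pow_dvd_pow_of_dvd hp k⟩
    refine ⟨L, fun L' hL' => ?_⟩
    obtain ⟨c, hc⟩ := hL.trans (pow_dvd_pow _ hL')
    refine ⟨mulOp ψ (C (y j ^ k * c)), mulOp_mem_opRing _, ?_⟩
    rw [mulOp_apply, hu, hu, zpow_zero, C_1, one_mul, ← C_mul, tau_iterate_C, map_C, ← C_mul]
    congr 1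
    have h : (∏ l, ψ (F l) ^ a l) ^ L' = ψ (y i) ^ k * ψ c := by
      rw [← map_pow, ← map_mul, ← hc]; simp
    have h2 : ψ.toRingHom (y j ^ k * c) = g ^ k * ψ (y i) ^ k * ψ c := by
      rw [← mul_pow, hgv]; simp
    rw [h, h2, zpow_natCast]
    ring
  obtain ⟨N, s, hs, e⟩ := exists_prod_apply_eq (S := S) (tauEquiv _ hψF a) hτ hτ' (ell g (C (ψ J))) B P
    (fun k m => by
      rw [hBa, hBa, tau_mul, hbs', map_translate]
      simp)
    (fun s hs m => by rw [hBa, hBa, opRing_mul_map hs])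
    hP0
    (fun k m => by rw [hPa, hPa, hBa, ← mul_assoc, ← map_mul, Finset.prod_range_succ_comm])
    hA₀ hA₁ (fun k => (hB0 k).trans (congrFun e₀ k)) (fun k => (hB0 k).trans (congrFun e₁ k)) hcl
  obtain ⟨s', hs', e'⟩ := hτ' s hs
  rw [e', hu, zpow_zero, C_1, one_mul, tau_C] at e
  have h3 : (∏ l, ψ (F l) ^ a l) * ψ J = ψ ((∏ l, F l ^ a l) * J) := by simp
  rw [h3] at e
  obtain ⟨Λ, m, hm, hm'⟩ := exists_genP_of_opRing hψF hδ a J hs'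
  refine ⟨_, prod_mem fun k (_ : k ∈ Finset.range N) => hbs k, Λ, ?_⟩
  convert hm
  apply map_injective ψ.toRingHom hψ
  rw [← hm', ← e, map_mul, map_C, map_map]
  have h4 : ψ.toRingHom.comp (algebraMap ℂ R) = algebraMap ℂ K := RingHom.ext ψ.commutes
  rw [h4]
  have h5 : ∀ r, ψ.toRingHom r = ψ r := fun r => rfl
  rw [h5, map_mul, map_pow, C_mul, C_pow, hPa]
  ring

/-- Descent of the Bernstein–Sato property along a blow-up of codimension two. -/
theorem Good.of_blowup [IsDomain R] [IsNoetherianRing R] [Finite I] {D : I → Derivation ℂ R R}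
    {y : I → R} {i j : I} {F : ι → R} {a : ι → ℕ} {J : R} {ρ : R →ₐ[ℂ] ℂ}
    (hρ : ∀ r, ρ r ≠ 0 → IsUnit r) (hc : ∀ i k r, D i (D k r) = D k (D i r))
    (hy : ∀ k l, D k (y l) = if k = l then 1 else 0) (hij : i ≠ j) (hF : ∀ l, F l ≠ 0)
    {p : ℕ} (hp : y i ∣ (∏ l, F l ^ a l) ^ p) (h₀ : ∀ ξ, ChartGood D y i j F a J ρ ξ)
    (h₁ : ChartGood D y j i F a J ρ 0) : Good D F a J := by
  let K := FractionRing R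
  let ψ : R →ₐ[ℂ] K := IsScalarTower.toAlgHom ℂ R K
  have hψ : Function.Injective ψ := IsFractionRing.injective R K
  have hψF : ∀ l, ψ (F l) ≠ 0 := fun l => (map_ne_zero_iff ψ hψ).2 (hF l)
  have hyne : ∀ k, ψ (y k) ≠ 0 := fun k => (map_ne_zero_iff ψ hψ).2 fun h => by
    have := hy k k; rw [h, map_zero, if_pos rfl] at this; exact zero_ne_one this
  choose δ hδ using fun k => exists_fraction_derivation (K := K) (D k)
  replace hδ : ∀ k r, δ k (ψ r) = ψ (D k r) := hδ
  have hcδ : ∀ i k x, δ i (δ k x) = δ k (δ i x) := fraction_derivation_comm hδ hc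
  let S := opRing ψ δ F
  have : IsNoetherianRing S := isNoetherianRing_opRing hψF hδ hcδ
  obtain ⟨hτ, hτ'⟩ := opRing_tau (δ := δ) hψF a
  set g : K := ψ (y j) / ψ (y i) with hg
  have hg0 : g ≠ 0 := div_ne_zero (hyne j) (hyne i)
  have hgv : g * ψ (y i) = ψ (y j) := div_mul_cancel₀ _ (hyne i)
  have hgv' : g⁻¹ * ψ (y j) = ψ (y i) := by rw [← hgv, inv_mul_cancel_left₀ hg0]
  let η : K → (Polynomial R →ₐ[ℂ] K) := fun γ => Polynomial.eval₂AlgHom ψ γ fun _ => Commute.all _ _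
  have hC : ∀ γ r, η γ (Polynomial.C r) = ψ r := fun γ r => Polynomial.eval₂_C _ _
  have hX : ∀ γ, η γ Polynomial.X = γ := fun γ => Polynomial.eval₂_X _ _
  have hU₀ := fun X hX => exists_upperRing_conj (S := S) (A := X) _ hτ hX
  have hU₁ := fun X hX => exists_lowerRing_conj (S := S) (A := X) _ hτ hX
  have hmul₀ : ∀ c : MvPolynomial ι (Polynomial R), ∃ X ∈ upperRing S, ∀ x, X (ell g x) =
      ell g (map (η g).toRingHom c * x) := exists_mul_ell (e := 1) (fun s hs => diag_mem_upperRing hs)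
    (shiftOp_mem_upperRing zero_le_one) hg0 (zpow_one g).symm (η g) (hC g) (hX g)
  have hmul₁ : ∀ c : MvPolynomial ι (Polynomial R), ∃ X ∈ lowerRing S, ∀ x, X (ell g x) =
      ell g (map (η g⁻¹).toRingHom c * x) := exists_mul_ell (e := -1) (fun s hs => diag_mem_lowerRing hs)
    (shiftOp_mem_lowerRing (by norm_num)) hg0 (zpow_neg_one g).symm (η g⁻¹) (hC _) (hX _)
  let I₀ := locIdeal J hU₀ (η g) hmul₀
  let I₁ := locIdeal J hU₁ (η g⁻¹) hmul₁
  have H₀ : ∀ ξ : ℂ, ∃ φ ∈ I₀, φ.eval₂ (ρ : R →+* ℂ) ξ = 1 := fun ξ =>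
    (h₀ ξ).exists_mem (e := 1) hδ hy hij (hyne i) hgv hg0 (fun s hs => diag_mem_upperRing hs)
      (shiftOp_mem_upperRing zero_le_one)
      (polOp_mul_shiftOp_mem_upperRing fun l hl hl' => by
        have : l = 0 := by omega
        simp [this]) rfl (fun k => by rw [one_mul]) (η g) (hC g) (hX g) hU₀ hmul₀
  obtain ⟨φ, hφ, hφ0⟩ : ∃ φ ∈ I₁, φ.eval₂ (ρ : R →+* ℂ) 0 = 1 :=
    h₁.exists_mem (e := -1) hδ hy hij.symm (hyne j) hgv' (inv_ne_zero hg0)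
      (fun s hs => diag_mem_lowerRing hs) (shiftOp_mem_lowerRing (by norm_num))
      (polOp_mul_shiftOp_mem_lowerRing fun l hl hl' => by
        have : l = 0 := by omega
        simp [this]) rfl (fun k => by rw [neg_one_mul, inv_zpow', neg_neg]) (η g⁻¹) (hC _) (hX _) hU₁ hmul₁
  have hu := isUnit_coeff_zero hρ hφ0
  have htop : I₀ = ⊤ := by
    obtain ⟨b, hb, h⟩ := id hφ
    obtain ⟨w, hw⟩ := inImage_upper_of_lower hg0 h
    set N := max w φ.natDegree
    have hN : φ.natDegree ≤ N := le_max_right _ _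
    have e : η g (φ.reflect N) = g ^ (N : ℤ) * η g⁻¹ φ := by
      let _ := invertibleOfNonzero (inv_ne_zero hg0)
      have h : Polynomial.eval₂ (ψ : R →+* K) (⅟(g⁻¹)) (φ.reflect N) * g⁻¹ ^ N =
        Polynomial.eval₂ (ψ : R →+* K) g⁻¹ φ := Polynomial.eval₂_reflect_mul_pow _ g⁻¹ N φ hN
      rw [invOf_eq_inv, inv_inv] at h
      change Polynomial.eval₂ (ψ : R →+* K) g (φ.reflect N) = _ * Polynomial.eval₂ (ψ : R →+* K) g⁻¹ φ
      rw [← h, zpow_natCast, mul_left_comm, ← mul_pow, mul_inv_cancel₀ hg0, one_pow, mul_one]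
    refine eq_top_of_charts hρ (Ψ := φ.reflect N) ⟨b, hb, ?_⟩ (N := N) ?_ ?_ H₀
    · rw [e, map_mul]
      convert hw N (le_max_left _ _) using 2
      ring
    · refine Polynomial.natDegree_le_iff_coeff_eq_zero.2 fun k hk => ?_
      rw [Polynomial.coeff_reflect, Polynomial.revAt_eq_self_of_lt hk]
      exact Polynomial.coeff_eq_zero_of_natDegree_lt (hN.trans_lt hk)
    · rwa [Polynomial.coeff_reflect, Polynomial.revAt_le le_rfl, Nat.sub_self]
  obtain ⟨b₀, hb₀, hi₀⟩ : (1 : Polynomial R) ∈ I₀ := htop ▸ Submodule.mem_top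
  obtain ⟨b₁, hb₁, hi₁⟩ : (1 : Polynomial R) ∈ I₁ := by
    obtain ⟨w, hw⟩ := inImage_lower_of_upper hg0 hi₀
    refine one_mem_of_coeff_zero hφ hu (N := w) ⟨b₀, hb₀, ?_⟩
    convert hw w le_rfl using 2
    rw [map_pow, hX, map_one, map_one, inv_pow, zpow_neg, zpow_natCast]
    ring
  have hη : ∀ (γ : K) (b : MvPolynomial ι ℂ), map (η γ).toRingHom (map (algebraMap ℂ (Polynomial R)) b) =
      map (algebraMap ℂ K) b := fun γ b => by
    rw [map_map]; exact congrArg (map · b) (RingHom.ext fun x => (η γ).commutes x)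
  have key₀ : inImage (upperRing S) hψF a (ell g (C (ψ J))) (ell g (map (algebraMap ℂ K) (b₀ * b₁) * C (ψ J))) := by
    obtain ⟨X, hX, e⟩ := hmul₀ (map (algebraMap ℂ (Polynomial R)) b₁)
    have := hi₀.apply hU₀ hX
    rw [e, hη, map_one, map_one] at this
    convert this using 2
    rw [map_mul]; ring
  have key₁ : inImage (lowerRing S) hψF a (ell g (C (ψ J))) (ell g (map (algebraMap ℂ K) (b₀ * b₁) * C (ψ J))) := by
    obtain ⟨X, hX, e⟩ := hmul₁ (map (algebraMap ℂ (Polynomial R)) b₀)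
    have := hi₁.apply hU₁ hX
    rw [e, hη, map_one, map_one] at this
    convert this using 2
    rw [map_mul]; ring
  exact Good.of_inImage hψ hδ hcδ hψF (mul_mem hb₀ hb₁) hgv hp key₀ key₁

end Blowup

section PowerSeriesBasics

/-- Formal power series with complex coefficients. -/
abbrev PS (σ : Type*) : Type _ := MvPowerSeries σ ℂ

variable {σ : Type*}

/-- The maximal ideal of the power series ring, spanned by the variables. -/
def mI (σ : Type*) : Ideal (PS σ) := Ideal.span (Set.range MvPowerSeries.X)

/-- The `i`-th variable. -/
abbrev xx (i : σ) : PS σ := MvPowerSeries.X i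

/-- The constant coefficient. -/
def cst : PS σ →ₐ[ℂ] ℂ :=
  { MvPowerSeries.constantCoeff with commutes' := fun c => by simp [MvPowerSeries.algebraMap_apply] }

theorem cst_apply (f : PS σ) : cst f = MvPowerSeries.constantCoeff f := rfl

@[simp] theorem cst_xx (i : σ) : cst (xx i) = 0 := MvPowerSeries.constantCoeff_X i

theorem xx_mem_mI (i : σ) : xx i ∈ mI σ := Ideal.subset_span ⟨i, rfl⟩

theorem cst_eq_zero_of_mem {f : PS σ} (h : f ∈ mI σ) : cst f = 0 := by
  have : mI σ ≤ RingHom.ker (MvPowerSeries.constantCoeff (σ := σ) (R := ℂ)) := by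
    rw [mI, Ideal.span_le]
    rintro _ ⟨i, rfl⟩
    simp
  exact this h

@[simp] theorem cst_algebraMap (c : ℂ) : cst (algebraMap ℂ (PS σ) c) = c := cst.commutes c

theorem isUnit_iff_cst {f : PS σ} : IsUnit f ↔ cst f ≠ 0 := by
  rw [MvPowerSeries.isUnit_iff_constantCoeff, isUnit_iff_ne_zero, cst_apply]

/-- The inclusion of polynomials in power series. -/
def polyPS : MvPolynomial σ ℂ →ₐ[ℂ] PS σ := MvPolynomial.aeval xx

theorem polyPS_eq (p : MvPolynomial σ ℂ) : polyPS p = (p : PS σ) := by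
  induction p using MvPolynomial.induction_on with
  | C a => simp [polyPS, MvPowerSeries.algebraMap_apply]
  | add p q hp hq => rw [map_add, hp, hq, MvPolynomial.coe_add]
  | mul_X p i hp => rw [map_mul, hp, MvPolynomial.coe_mul, polyPS, aeval_X, MvPolynomial.coe_X]

/-- Elements of a power of the maximal ideal, as combinations of the variables. -/
theorem mI_pow_induction {P : PS σ → Prop} {c : ℕ} (h0 : P 0) (ha : ∀ f g, P f → P g → P (f + g))
    (hX : ∀ i, ∀ g ∈ mI σ ^ c, P (xx i * g)) : ∀ f ∈ mI σ ^ (c + 1), P f := by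
  intro f hf
  rw [pow_succ'] at hf
  refine Submodule.mul_induction_on hf ?_ ha
  intro m hm g hg
  induction hm using Submodule.span_induction generalizing g with
  | mem x hx => obtain ⟨i, rfl⟩ := hx; exact hX i g hg
  | zero => simpa using h0
  | add x y _ _ hx hy => rw [add_mul]; exact ha _ _ (hx g hg) (hy g hg)
  | smul a x _ hx =>
    rw [smul_eq_mul, mul_comm a, mul_assoc]
    exact hx _ (Ideal.mul_mem_left _ _ hg)

variable [Fintype σ]

theorem mem_mI_of_cst {f : PS σ} (h : cst f = 0) : f ∈ mI σ := by
  classical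
  have key : ∀ s : Finset σ, ∃ g : PS σ, f - g ∈ mI σ ∧
      ∀ e : σ →₀ ℕ, (e = 0 ∨ ∃ i ∈ s, e i ≠ 0) → MvPowerSeries.coeff e g = 0 := by
    intro s
    induction s using Finset.induction_on with
    | empty =>
      refine ⟨f, by simp, ?_⟩
      rintro e (rfl | ⟨i, hi, _⟩)
      · simpa [cst_apply] using h
      · simp at hi
    | insert i s hi ih =>
      obtain ⟨g, hg, hg'⟩ := ih
      obtain ⟨g', hg1⟩ : ∃ g' : PS σ, ∀ e, MvPowerSeries.coeff e g' =
          if e i = 0 then MvPowerSeries.coeff e g else 0 :=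
        ⟨fun e => if e i = 0 then MvPowerSeries.coeff e g else 0, fun e => rfl⟩
      refine ⟨g', ?_, ?_⟩
      · rw [← sub_add_sub_cancel f g _]
        refine add_mem hg (Ideal.mem_of_dvd _ (MvPowerSeries.X_dvd_iff.2 fun m hm => ?_) (xx_mem_mI i))
        rw [map_sub, sub_eq_zero, hg1, if_pos hm]
      · intro e he
        rw [hg1]
        split_ifs with h0
        · refine hg' e (he.imp_right ?_)
          rintro ⟨j, hj, hj'⟩
          rcases Finset.mem_insert.1 hj with rfl | hj
          · exact absurd h0 hj'
          · exact ⟨j, hj, hj'⟩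
        · rfl
  obtain ⟨g, hg, hg'⟩ := key Finset.univ
  have : g = 0 := by
    ext e
    by_cases he : e = 0
    · simpa using hg' e (Or.inl he)
    · obtain ⟨i, hi⟩ := Finsupp.ne_iff.1 he
      simpa using hg' e (Or.inr ⟨i, Finset.mem_univ _, hi⟩)
  simpa [this] using hg

theorem mem_mI {f : PS σ} : f ∈ mI σ ↔ cst f = 0 := ⟨cst_eq_zero_of_mem, mem_mI_of_cst⟩

theorem sub_cst_mem (f : PS σ) : f - algebraMap ℂ (PS σ) (cst f) ∈ mI σ := by
  rw [mem_mI, map_sub, cst_algebraMap, sub_self]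

theorem exists_poly (c : ℕ) (f : PS σ) : ∃ p : MvPolynomial σ ℂ, f - polyPS p ∈ mI σ ^ c := by
  induction c generalizing f with
  | zero => exact ⟨0, by simp⟩
  | succ c ih =>
    have key : ∀ g ∈ mI σ ^ (0 + 1), ∃ p : MvPolynomial σ ℂ, g - polyPS p ∈ mI σ ^ (c + 1) := by
      refine mI_pow_induction ⟨0, by simp⟩ ?_ ?_
      · rintro f g ⟨p, hp⟩ ⟨q, hq⟩
        refine ⟨p + q, ?_⟩
        rw [map_add, add_sub_add_comm]
        exact add_mem hp hq
      · intro i g _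
        obtain ⟨p, hp⟩ := ih g
        refine ⟨X i * p, ?_⟩
        rw [map_mul, polyPS, aeval_X, ← mul_sub, pow_succ']
        exact Ideal.mul_mem_mul (xx_mem_mI i) hp
    obtain ⟨p, hp⟩ := key _ (by simpa using sub_cst_mem f)
    refine ⟨C (cst f) + p, ?_⟩
    rw [map_add, polyPS, aeval_C, ← sub_sub]
    exact hp

omit [Fintype σ] in
theorem coeff_eq_zero_of_mem_pow {c : ℕ} : ∀ {f : PS σ}, f ∈ mI σ ^ c → ∀ {e : σ →₀ ℕ}, e.degree < c →
    MvPowerSeries.coeff e f = 0 := by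
  classical
  induction c with
  | zero => intro f _ e he; simp at he
  | succ c ih =>
    refine fun {f} hf => mI_pow_induction (P := fun f => ∀ {e : σ →₀ ℕ}, e.degree < c + 1 →
      MvPowerSeries.coeff e f = 0) (by simp) ?_ ?_ f hf
    · intro f g hf hg e he
      rw [map_add, hf he, hg he, add_zero]
    · intro i g hg e he
      rw [xx, MvPowerSeries.X_def, MvPowerSeries.coeff_monomial_mul]
      split_ifs with h
      · rw [one_mul]
        refine ih hg ?_
        have : (e - Finsupp.single i 1).degree + (Finsupp.single i 1).degree = e.degree := by
          rw [← map_add, tsub_add_cancel_of_le h]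
        rw [Finsupp.degree_single] at this
        omega
      · rfl

omit [Fintype σ] in
theorem mem_idealOfVars_pow {c : ℕ} {p : MvPolynomial σ ℂ} (h : polyPS p ∈ mI σ ^ c) :
    p ∈ idealOfVars σ ℂ ^ c := by
  rw [mem_pow_idealOfVars_iff']
  intro e he
  rw [polyPS_eq] at h
  simpa using coeff_eq_zero_of_mem_pow h he

theorem mI_ne_top : mI σ ≠ ⊤ := by
  rw [Ideal.ne_top_iff_one, mem_mI]
  simp

/-- Ideals of the power series ring are closed. -/
theorem mem_of_forall_mem_sup {I : Ideal (PS σ)} {f : PS σ} (h : ∀ c, f ∈ I ⊔ mI σ ^ c) : f ∈ I := by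
  have := IsHausdorff.of_isLocalRing (I := mI σ) (PS σ ⧸ I) mI_ne_top
  rw [← Ideal.Quotient.eq_zero_iff_mem]
  refine this.haus _ fun c => ?_
  rw [SModEq.zero]
  obtain ⟨x, hx, y, hy, hxy⟩ := Submodule.mem_sup.1 (h c)
  have : (Ideal.Quotient.mk I) f = y • (1 : PS σ ⧸ I) := by
    rw [← hxy, map_add, Ideal.Quotient.eq_zero_iff_mem.2 hx, zero_add]
    exact (mul_one _).symm
  rw [this]
  exact Submodule.smul_mem_smul hy trivial

theorem eq_zero_of_forall_mem_pow {f : PS σ} (h : ∀ c, f ∈ mI σ ^ c) : f = 0 := by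
  have := mem_of_forall_mem_sup (I := ⊥) (f := f) (by simpa using h)
  simpa using this

variable {τ : Type*} [Fintype τ]

omit [Fintype σ] [Fintype τ] in
/-- Homomorphisms of power series rings are local. -/
theorem cst_hom (φ : PS σ →ₐ[ℂ] PS τ) (f : PS σ) : cst (φ f) = cst f := by
  by_contra h
  have hu : IsUnit (f - algebraMap ℂ (PS σ) (cst (φ f))) := by
    rw [isUnit_iff_cst, map_sub, cst_algebraMap]
    exact fun h' => h (sub_eq_zero.1 h').symm
  have := hu.map φ
  rw [map_sub, AlgHom.commutes, isUnit_iff_cst, map_sub, cst_algebraMap] at this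
  simp at this

omit [Fintype σ] in
theorem hom_mem_mI_pow (φ : PS σ →ₐ[ℂ] PS τ) {c : ℕ} {f : PS σ} (h : f ∈ mI σ ^ c) : φ f ∈ mI τ ^ c := by
  have h1 : (mI σ).map φ.toRingHom ≤ mI τ := by
    rw [Ideal.map_le_iff_le_comap]
    intro g hg
    rw [Ideal.mem_comap, mem_mI]
    exact (cst_hom φ g).trans (cst_eq_zero_of_mem hg)
  have h2 := Ideal.pow_right_mono h1 c
  rw [← Ideal.map_pow] at h2
  exact h2 (Ideal.mem_map_of_mem φ.toRingHom h)

theorem hom_sub_mem {φ ψ : PS σ →ₐ[ℂ] PS τ} {I : Ideal (PS τ)} (h : ∀ i, φ (xx i) - ψ (xx i) ∈ I)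
    (f : PS σ) : φ f - ψ f ∈ I := by
  refine mem_of_forall_mem_sup fun c => ?_
  obtain ⟨p, hp⟩ := exists_poly c f
  have h1 : φ (polyPS p) - ψ (polyPS p) ∈ I := by
    rw [← Ideal.Quotient.eq]
    have : ((Ideal.Quotient.mkₐ ℂ I).comp φ).comp polyPS = ((Ideal.Quotient.mkₐ ℂ I).comp ψ).comp polyPS := by
      apply MvPolynomial.algHom_ext
      intro i
      simpa [polyPS, Ideal.Quotient.eq] using h i
    exact DFunLike.congr_fun this p
  have : φ f - ψ f = (φ (polyPS p) - ψ (polyPS p)) + (φ (f - polyPS p) - ψ (f - polyPS p)) := by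
    simp only [map_sub]; ring
  rw [this]
  exact add_mem (Ideal.mem_sup_left h1)
    (Ideal.mem_sup_right (sub_mem (hom_mem_mI_pow φ hp) (hom_mem_mI_pow ψ hp)))

theorem PS.hom_ext {φ ψ : PS σ →ₐ[ℂ] PS τ} (h : ∀ i, φ (xx i) = ψ (xx i)) : φ = ψ := by
  ext1 f
  have := hom_sub_mem (φ := φ) (ψ := ψ) (I := ⊥) (by simpa [sub_eq_zero] using h) f
  simpa [sub_eq_zero] using this

open Classical in
/-- Substitution of power series without constant term. -/
def ev (a : σ → PS τ) : PS σ →ₐ[ℂ] PS τ :=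
  if h : ∀ i, cst (a i) = 0 then
    MvPowerSeries.substAlgHom (R := ℂ) (MvPowerSeries.hasSubst_of_constantCoeff_zero h)
  else (Algebra.ofId ℂ (PS τ)).comp cst

omit [Fintype τ] in
theorem ev_xx {a : σ → PS τ} (h : ∀ i, cst (a i) = 0) (i : σ) : ev a (xx i) = a i := by
  rw [ev, dif_pos h, MvPowerSeries.substAlgHom_X]

/-- A twisted derivation is determined by its values on the variables. -/
theorem twisted_der_eq_zero (φ : PS σ →ₐ[ℂ] PS τ) (Δ : PS σ →ₗ[ℂ] PS τ)
    (hm : ∀ f g, Δ (f * g) = φ f * Δ g + φ g * Δ f) (hX : ∀ i, Δ (xx i) = 0) : Δ = 0 := by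
  have h1 : Δ 1 = 0 := by simpa using hm 1 1
  have hp : ∀ p, Δ (polyPS p) = 0 := by
    intro p
    induction p using MvPolynomial.induction_on with
    | C a => rw [polyPS, aeval_C, Algebra.algebraMap_eq_smul_one, map_smul, h1, smul_zero]
    | add p q hp hq => rw [map_add, map_add, hp, hq, add_zero]
    | mul_X p i hp => rw [map_mul, hm, hp, polyPS, aeval_X, hX, mul_zero, mul_zero, add_zero]
  have hc : ∀ c, ∀ f ∈ mI σ ^ (c + 1), Δ f ∈ mI τ ^ c := by
    intro c
    induction c with
    | zero => intro f _; simp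
    | succ c ih =>
      refine mI_pow_induction (by simp) (fun f g hf hg => by rw [map_add]; exact add_mem hf hg) ?_
      intro i g hg
      rw [hm, hX, mul_zero, add_zero, pow_succ']
      refine Ideal.mul_mem_mul ?_ (ih g hg)
      rw [mem_mI, cst_hom]
      simp
  ext1 f
  refine eq_zero_of_forall_mem_pow fun c => ?_
  obtain ⟨p, hp'⟩ := exists_poly (c + 1) f
  have := hc c _ hp'
  rwa [map_sub, hp, sub_zero] at this

/-- The partial derivatives. -/
abbrev dd (i : σ) : Derivation ℂ (PS σ) (PS σ) := MvPowerSeries.pderiv ℂ i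

omit [Fintype σ] in
theorem dd_xx [DecidableEq σ] (i j : σ) : dd i (xx j) = if i = j then 1 else 0 := by
  rw [MvPowerSeries.pderiv_X]
  simp [Pi.single_apply, eq_comm]

/-- The chain rule. -/
theorem chain_rule (φ : PS σ →ₐ[ℂ] PS τ) (w : τ) (f : PS σ) :
    dd w (φ f) = ∑ l, dd w (φ (xx l)) * φ (dd l f) := by
  classical
  have := twisted_der_eq_zero φ ((dd w).toLinearMap ∘ₗ φ.toLinearMap -
    ∑ l, LinearMap.mulLeft ℂ (dd w (φ (xx l))) ∘ₗ φ.toLinearMap ∘ₗ (dd l).toLinearMap)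
    (fun f g => by
      simp only [LinearMap.sub_apply, LinearMap.comp_apply, LinearMap.sum_apply, AlgHom.toLinearMap_apply,
        Derivation.coeFn_coe, LinearMap.mulLeft_apply, map_mul, Derivation.leibniz, smul_eq_mul, map_add,
        mul_sub, Finset.mul_sum, Finset.sum_add_distrib]
      have h1 : ∀ a b : PS σ, ∑ x, dd w (φ (xx x)) * (φ a * φ (dd x b)) =
          ∑ x, φ a * (dd w (φ (xx x)) * φ (dd x b)) := fun a b =>
        Finset.sum_congr rfl fun x _ => by ring
      rw [h1, h1]
      ring)
    (fun i => by
      simp only [LinearMap.sub_apply, LinearMap.comp_apply, LinearMap.sum_apply, AlgHom.toLinearMap_apply,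
        Derivation.coeFn_coe, LinearMap.mulLeft_apply, dd_xx]
      simp)
  have := LinearMap.congr_fun this f
  simpa [sub_eq_zero] using this

theorem dd_comm (i j : σ) (f : PS σ) : dd i (dd j f) = dd j (dd i f) := by
  classical
  have := twisted_der_eq_zero (AlgHom.id ℂ (PS σ)) ((dd i).toLinearMap ∘ₗ (dd j).toLinearMap -
    (dd j).toLinearMap ∘ₗ (dd i).toLinearMap)
    (fun f g => by
      simp only [LinearMap.sub_apply, LinearMap.comp_apply, Derivation.coeFn_coe, Derivation.leibniz,
        smul_eq_mul, map_add, AlgHom.id_apply]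
      ring) (fun k => by
      simp only [LinearMap.sub_apply, LinearMap.comp_apply, Derivation.coeFn_coe, dd_xx]
      split_ifs <;> simp)
  have := LinearMap.congr_fun this f
  simpa [sub_eq_zero] using this

/-- Contraction mappings of the maximal ideal have fixed points. -/
theorem exists_fixed_point (K : PS σ → PS σ) (S : Set (PS σ)) (h0 : 0 ∈ S) (hS : ∀ x ∈ S, K x ∈ S)
    (hK : ∀ c, ∀ x ∈ S, ∀ y ∈ S, x - y ∈ mI σ ^ c → K x - K y ∈ mI σ ^ (c + 1)) :
    ∃ L, ∀ c, ∃ x ∈ S, L - x ∈ mI σ ^ c ∧ K x - x ∈ mI σ ^ c := by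
  have hs : ∀ n, K^[n] 0 ∈ S := by
    intro n
    induction n with
    | zero => exact h0
    | succ n ih => rw [Function.iterate_succ_apply']; exact hS _ ih
  have h1 : ∀ n, K^[n + 1] 0 - K^[n] 0 ∈ mI σ ^ n := by
    intro n
    induction n with
    | zero => simp
    | succ n ih =>
      have := hK n _ (hs (n + 1)) _ (hs n) ih
      rwa [← Function.iterate_succ_apply' K (n + 1), ← Function.iterate_succ_apply' K n] at this
  have h2 : ∀ m k, K^[m + k] 0 - K^[m] 0 ∈ mI σ ^ m := by
    intro m k
    induction k with
    | zero => simp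
    | succ k ih =>
      rw [← sub_add_sub_cancel _ (K^[m + k] 0)]
      exact add_mem (Ideal.pow_le_pow_right (by omega) (h1 (m + k))) ih
  have hc : IsPrecomplete (mI σ) (PS σ) := by
    have : IsAdicComplete (mI σ) (PS σ) := by unfold mI; infer_instance
    infer_instance
  obtain ⟨L, hL⟩ := hc.prec' (fun n => K^[n] 0) (fun {m n} hmn => by
    rw [SModEq.sub_mem, smul_eq_mul, Ideal.mul_top, ← neg_mem_iff, neg_sub]
    obtain ⟨k, rfl⟩ := Nat.exists_eq_add_of_le hmn
    exact h2 m k)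
  refine ⟨L, fun c => ⟨K^[c] 0, hs c, ?_, ?_⟩⟩
  · have := hL c
    rw [SModEq.sub_mem, smul_eq_mul, Ideal.mul_top, ← neg_mem_iff, neg_sub] at this
    exact this
  · rw [← Function.iterate_succ_apply' K]
    exact h1 c

end PowerSeriesBasics

section Coefficients

variable {σ : Type*} [Fintype σ] [DecidableEq σ]

/-- Setting the variables outside of `T` to zero. -/
def kill (T : Finset σ) : PS σ →ₐ[ℂ] PS σ := ev fun i => if i ∈ T then xx i else 0

theorem kill_xx (T : Finset σ) (i : σ) : kill T (xx i) = if i ∈ T then xx i else 0 :=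
  ev_xx (fun i => by split_ifs <;> simp) i

/-- The power series involving only the variables in `T`. -/
def free (T : Finset σ) : Subalgebra ℂ (PS σ) := AlgHom.equalizer (kill T) (AlgHom.id ℂ (PS σ))

theorem mem_free {T : Finset σ} {f : PS σ} : f ∈ free T ↔ kill T f = f := Iff.rfl

theorem xx_mem_free {T : Finset σ} {i : σ} (h : i ∈ T) : xx i ∈ free T := by
  rw [mem_free, kill_xx, if_pos h]

theorem map_mem_free {φ : PS σ →ₐ[ℂ] PS σ} {T T' : Finset σ} (h : ∀ i ∈ T, φ (xx i) ∈ free T') {f : PS σ}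
    (hf : f ∈ free T) : φ f ∈ free T' := by
  have : ((kill T').comp φ).comp (kill T) = φ.comp (kill T) := by
    apply PS.hom_ext
    intro i
    simp only [AlgHom.comp_apply, kill_xx]
    split_ifs with hi
    · exact h i hi
    · simp
  have := DFunLike.congr_fun this f
  simp only [AlgHom.comp_apply] at this
  rwa [mem_free.1 hf] at this

theorem hom_eq_on_free {φ ψ : PS σ →ₐ[ℂ] PS σ} {T : Finset σ} (h : ∀ i ∈ T, φ (xx i) = ψ (xx i)) {f : PS σ}
    (hf : f ∈ free T) : φ f = ψ f := by
  have : φ.comp (kill T) = ψ.comp (kill T) := by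
    apply PS.hom_ext
    intro i
    simp only [AlgHom.comp_apply, kill_xx]
    split_ifs with hi
    · exact h i hi
    · simp
  have := DFunLike.congr_fun this f
  simpa [mem_free.1 hf] using this

theorem hom_fix_free {φ : PS σ →ₐ[ℂ] PS σ} {T : Finset σ} (h : ∀ i ∈ T, φ (xx i) = xx i) {f : PS σ}
    (hf : f ∈ free T) : φ f = f :=
  hom_eq_on_free (ψ := AlgHom.id ℂ _) h hf

theorem free_mono {T T' : Finset σ} (h : T ⊆ T') : free T ≤ free T' := fun f hf => by
  have := map_mem_free (φ := AlgHom.id ℂ _) (T' := T') (fun i hi => xx_mem_free (h hi)) hf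
  exact this

theorem kill_mem_free (T : Finset σ) (f : PS σ) : kill T f ∈ free T := by
  have : (kill T).comp (kill T) = kill T := by
    apply PS.hom_ext
    intro i
    simp only [AlgHom.comp_apply, kill_xx]
    split_ifs with hi
    · rw [kill_xx, if_pos hi]
    · simp
  exact DFunLike.congr_fun this f

theorem free_univ (f : PS σ) : f ∈ free (Finset.univ : Finset σ) := by
  have : kill (Finset.univ : Finset σ) = AlgHom.id ℂ (PS σ) := by
    apply PS.hom_ext
    intro i
    simp [kill_xx]
  rw [mem_free, this, AlgHom.id_apply]

theorem free_compl {T : Finset σ} {k : σ} (h : k ∉ T) : free T ≤ free {k}ᶜ :=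
  free_mono fun i hi => by
    rw [Finset.mem_compl, Finset.mem_singleton]
    rintro rfl
    exact h hi

theorem mem_free_compl_xx {i k : σ} (h : i ≠ k) : xx i ∈ free ({k}ᶜ : Finset σ) := xx_mem_free (by simpa)

theorem cst_of_mem_free_empty {f : PS σ} (hf : f ∈ free (∅ : Finset σ)) : f = algebraMap ℂ _ (cst f) :=
  (hom_fix_free (φ := (Algebra.ofId ℂ (PS σ)).comp cst) (by simp) hf).symm

theorem kill_compl_self (k : σ) : kill {k}ᶜ (xx k) = 0 := by
  rw [kill_xx, if_neg (by simp)]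

theorem exists_sh (k : σ) (f : PS σ) : ∃ g, f - kill {k}ᶜ f = xx k * g := by
  have := hom_sub_mem (φ := AlgHom.id ℂ (PS σ)) (ψ := kill {k}ᶜ) (I := Ideal.span {xx k}) (fun i => by
    rw [kill_xx]
    split_ifs with h
    · simp
    · rw [Finset.mem_compl, not_not, Finset.mem_singleton] at h
      subst h
      simp) f
  exact Ideal.mem_span_singleton.1 this

/-- The quotient of the division by the `k`-th variable. -/
def sh (k : σ) (f : PS σ) : PS σ := (exists_sh k f).choose

theorem add_xx_mul_sh (k : σ) (f : PS σ) : kill {k}ᶜ f + xx k * sh k f = f := by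
  rw [sh, ← (exists_sh k f).choose_spec]; ring

omit [Fintype σ] in
theorem xx_ne_zero (k : σ) : xx k ≠ 0 := fun h => by
  have := dd_xx k k
  rw [h] at this
  simp at this

theorem kill_sh_unique {k : σ} {c f g : PS σ} (hc : c ∈ free {k}ᶜ) (h : f = c + xx k * g) :
    kill {k}ᶜ f = c ∧ sh k f = g := by
  have h1 : kill {k}ᶜ f = c := by
    rw [h, map_add, map_mul, kill_compl_self, zero_mul, add_zero, mem_free.1 hc]
  refine ⟨h1, mul_left_cancel₀ (xx_ne_zero k) (add_left_cancel (a := kill {k}ᶜ f) ?_)⟩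
  rw [add_xx_mul_sh, h1, h]

theorem xx_dvd_iff {k : σ} {f : PS σ} : xx k ∣ f ↔ kill {k}ᶜ f = 0 := by
  constructor
  · rintro ⟨g, rfl⟩
    rw [map_mul, kill_compl_self, zero_mul]
  · intro h
    have := add_xx_mul_sh k f
    rw [h, zero_add] at this
    exact ⟨_, this.symm⟩

theorem prime_xx (k : σ) : Prime (xx k) := by
  refine ⟨xx_ne_zero k, ?_, ?_⟩
  · rw [isUnit_iff_cst]; simp
  · intro a b h
    rw [xx_dvd_iff, map_mul, mul_eq_zero] at h
    rwa [xx_dvd_iff, xx_dvd_iff]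

theorem sh_add (k : σ) (f g : PS σ) : sh k (f + g) = sh k f + sh k g := by
  refine (kill_sh_unique (add_mem (kill_mem_free _ f) (kill_mem_free _ g)) ?_).2
  nth_rw 1 [← add_xx_mul_sh k f, ← add_xx_mul_sh k g]
  ring

theorem sh_mul {k : σ} {c : PS σ} (hc : c ∈ free {k}ᶜ) (f : PS σ) : sh k (c * f) = c * sh k f := by
  refine (kill_sh_unique (mul_mem hc (kill_mem_free _ f)) ?_).2
  nth_rw 1 [← add_xx_mul_sh k f]
  ring

theorem sh_xx_mul (k : σ) (f : PS σ) : sh k (xx k * f) = f :=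
  (kill_sh_unique (zero_mem _) (zero_add _).symm).2

theorem sh_of_free {k : σ} {c : PS σ} (hc : c ∈ free {k}ᶜ) : sh k c = 0 :=
  (kill_sh_unique hc (by simp)).2

/-- The `l`-th coefficient of `f` as a power series in the `k`-th variable. -/
def cof (k : σ) (l : ℕ) (f : PS σ) : PS σ := kill {k}ᶜ ((sh k)^[l] f)

theorem cof_zero_left (k : σ) (f : PS σ) : cof k 0 f = kill {k}ᶜ f := rfl

theorem cof_succ (k : σ) (l : ℕ) (f : PS σ) : cof k (l + 1) f = cof k l (sh k f) := rfl

theorem cof_mem_free_compl (k : σ) (l : ℕ) (f : PS σ) : cof k l f ∈ free {k}ᶜ := kill_mem_free _ _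

theorem cof_add (k : σ) (l : ℕ) (f g : PS σ) : cof k l (f + g) = cof k l f + cof k l g := by
  induction l generalizing f g with
  | zero => simp [cof_zero_left]
  | succ l ih => rw [cof_succ, sh_add, ih]; rfl

theorem cof_mul {k : σ} {c : PS σ} (hc : c ∈ free {k}ᶜ) (l : ℕ) (f : PS σ) :
    cof k l (c * f) = c * cof k l f := by
  induction l generalizing f with
  | zero => simp [cof_zero_left, mem_free.1 hc]
  | succ l ih => rw [cof_succ, sh_mul hc, ih]; rfl

theorem cof_zero_right (k : σ) (l : ℕ) : cof k l (0 : PS σ) = 0 := by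
  simpa using cof_mul (k := k) (zero_mem _) l (0 : PS σ)

theorem cof_sum {ι : Type*} (s : Finset ι) (k : σ) (l : ℕ) (f : ι → PS σ) :
    cof k l (∑ i ∈ s, f i) = ∑ i ∈ s, cof k l (f i) := by
  classical
  induction s using Finset.induction_on with
  | empty => simp [cof_zero_right]
  | insert i s hi ih => rw [Finset.sum_insert hi, Finset.sum_insert hi, cof_add, ih]

theorem cof_of_free {k : σ} {c : PS σ} (hc : c ∈ free {k}ᶜ) (l : ℕ) :
    cof k l c = if l = 0 then c else 0 := by
  cases l with
  | zero => simpa [cof_zero_left] using mem_free.1 hc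
  | succ l => rw [cof_succ, sh_of_free hc, cof_zero_right]; simp

theorem cof_xx_pow_mul (k : σ) (i l : ℕ) (f : PS σ) :
    cof k l (xx k ^ i * f) = if i ≤ l then cof k (l - i) f else 0 := by
  induction i generalizing l with
  | zero => simp
  | succ i ih =>
    rw [pow_succ', mul_assoc]
    cases l with
    | zero => simp [cof_zero_left, kill_compl_self]
    | succ l => rw [cof_succ, sh_xx_mul, ih]; simp

theorem cof_xx_pow_mul_free {k : σ} {c : PS σ} (hc : c ∈ free {k}ᶜ) (i l : ℕ) :
    cof k l (xx k ^ i * c) = if l = i then c else 0 := by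
  rw [cof_xx_pow_mul]
  split_ifs with h1 h2 h2
  · rw [h2, Nat.sub_self, cof_of_free hc, if_pos rfl]
  · rw [cof_of_free hc, if_neg (by omega)]
  · omega
  · rfl

theorem sum_cof (k : σ) (d : ℕ) (f : PS σ) :
    ∑ i ∈ Finset.range d, xx k ^ i * cof k i f + xx k ^ d * (sh k)^[d] f = f := by
  induction d with
  | zero => simp
  | succ d ih =>
    rw [Finset.sum_range_succ, Function.iterate_succ_apply', add_assoc, pow_succ, mul_assoc, ← mul_add, cof,
      add_xx_mul_sh, ih]

/-- A homomorphism fixing the `k`-th variable, whose values on the other variables do not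
involve it. -/
def FixVar (k : σ) (φ : PS σ →ₐ[ℂ] PS σ) : Prop :=
  φ (xx k) = xx k ∧ ∀ i, i ≠ k → φ (xx i) ∈ free ({k}ᶜ : Finset σ)

theorem FixVar.kill_sh {k : σ} {φ : PS σ →ₐ[ℂ] PS σ} (h : FixVar k φ) (f : PS σ) :
    kill {k}ᶜ (φ f) = φ (kill {k}ᶜ f) ∧ sh k (φ f) = φ (sh k f) := by
  refine kill_sh_unique (map_mem_free (T := {k}ᶜ) (fun i hi => h.2 i (by simpa using hi))
    (kill_mem_free _ f)) ?_
  nth_rw 1 [← add_xx_mul_sh k f]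
  rw [map_add, map_mul, h.1]

theorem FixVar.cof {k : σ} {φ : PS σ →ₐ[ℂ] PS σ} (h : FixVar k φ) (l : ℕ) (f : PS σ) :
    cof k l (φ f) = φ (cof k l f) := by
  induction l generalizing f with
  | zero => rw [cof_zero_left, (h.kill_sh f).1]; rfl
  | succ l ih => rw [cof_succ, (h.kill_sh f).2, ih]; rfl

theorem fixVar_kill {k : σ} {T : Finset σ} (h : k ∈ T) : FixVar k (kill T) := by
  refine ⟨by rw [kill_xx, if_pos h], fun i hi => ?_⟩
  rw [kill_xx]
  split_ifs
  · exact mem_free_compl_xx hi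
  · exact zero_mem _

theorem iterate_sh_mem_free {k : σ} {T : Finset σ} (hk : k ∈ T) {f : PS σ} (hf : f ∈ free T) (l : ℕ) :
    (sh k)^[l] f ∈ free T := by
  induction l generalizing f with
  | zero => exact hf
  | succ l ih =>
    refine ih ?_
    have := ((fixVar_kill hk).kill_sh f).2
    rw [mem_free.1 hf] at this
    exact mem_free.2 this.symm

theorem cof_mem_free {k : σ} {T : Finset σ} {f : PS σ} (hf : f ∈ free (insert k T)) (l : ℕ) :
    cof k l f ∈ free T := by
  refine map_mem_free (T := insert k T) (fun i hi => ?_)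
    (iterate_sh_mem_free (Finset.mem_insert_self k T) hf l)
  rw [kill_xx]
  split_ifs with h
  · rcases Finset.mem_insert.1 hi with rfl | hi
    · simp at h
    · exact xx_mem_free hi
  · exact zero_mem _

theorem dd_of_free {k : σ} {c : PS σ} (hc : c ∈ free ({k}ᶜ : Finset σ)) : dd k c = 0 := by
  rw [← mem_free.1 hc, chain_rule]
  refine Finset.sum_eq_zero fun l _ => ?_
  rw [kill_xx]
  split_ifs with h
  · rw [dd_xx, if_neg (fun h' => by subst h'; simp at h), zero_mul]
  · simp

theorem sh_dd (k : σ) (f : PS σ) : sh k (dd k f) = sh k (sh k f) + dd k (sh k f) := by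
  refine (kill_sh_unique (kill_mem_free _ (sh k f)) ?_).2
  nth_rw 1 [← add_xx_mul_sh k f]
  rw [map_add, dd_of_free (kill_mem_free _ f), Derivation.leibniz, dd_xx, if_pos rfl]
  nth_rw 2 [← add_xx_mul_sh k (sh k f)]
  simp only [smul_eq_mul]
  ring

theorem cof_dd (k : σ) (l : ℕ) (f : PS σ) : cof k l (dd k f) = (l + 1 : ℕ) * cof k (l + 1) f := by
  induction l generalizing f with
  | zero =>
    rw [cof_zero_left, cof_succ, cof_zero_left]
    nth_rw 1 [← add_xx_mul_sh k f]
    rw [map_add, dd_of_free (kill_mem_free _ f), Derivation.leibniz, dd_xx, if_pos rfl]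
    simp [kill_compl_self]
  | succ l ih =>
    rw [cof_succ, sh_dd, cof_add, ih, cof_succ, cof_succ k (l + 1), ← cof_succ k l, cof_succ k l]
    push_cast
    ring

theorem mem_of_cof_mem {k : σ} {I : Ideal (PS σ)} {f : PS σ} (h : ∀ l, cof k l f ∈ I) : f ∈ I := by
  refine mem_of_forall_mem_sup fun n => ?_
  rw [← sum_cof k n f]
  refine add_mem (Ideal.mem_sup_left (sum_mem fun i _ => Ideal.mul_mem_left _ _ (h i)))
    (Ideal.mem_sup_right ?_)
  exact Ideal.mul_mem_right _ _ (Ideal.pow_mem_pow (xx_mem_mI k) n)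

theorem exists_mem_span_cof (k : σ) (f : PS σ) : ∃ M, f ∈ Ideal.span ((fun l => cof k l f) '' Set.Iio M) := by
  obtain ⟨M, hM⟩ := WellFoundedGT.monotone_chain_condition (α := Ideal (PS σ))
    ⟨fun M => Ideal.span ((fun l => cof k l f) '' Set.Iio M), fun M N h =>
      Ideal.span_mono (Set.image_mono (Set.Iio_subset_Iio h))⟩
  refine ⟨M, mem_of_cof_mem (k := k) fun l => ?_⟩
  have h1 : Ideal.span ((fun l => cof k l f) '' Set.Iio M) =
      Ideal.span ((fun l => cof k l f) '' Set.Iio (max M (l + 1))) := hM _ (le_max_left _ _)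
  rw [h1]
  exact Ideal.subset_span ⟨l, lt_of_lt_of_le (Nat.lt_succ_self l) (le_max_right _ _), rfl⟩

end Coefficients

section Monomials

variable {σ : Type*}

/-- Divisors of a product of variables in `T`. -/
def DvdMonomial (T : Finset σ) (f : PS σ) : Prop :=
  ∃ l : List σ, (∀ i ∈ l, i ∈ T) ∧ f ∣ (l.map xx).prod

theorem DvdMonomial.of_dvd {T : Finset σ} {f g : PS σ} (h : DvdMonomial T g) (hf : f ∣ g) : DvdMonomial T f := by
  obtain ⟨l, hl, h⟩ := h
  exact ⟨l, hl, hf.trans h⟩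

theorem DvdMonomial.mul {T : Finset σ} {f g : PS σ} (hf : DvdMonomial T f) (hg : DvdMonomial T g) :
    DvdMonomial T (f * g) := by
  obtain ⟨l, hl, h⟩ := hf
  obtain ⟨l', hl', h'⟩ := hg
  refine ⟨l ++ l', fun i hi => ?_, ?_⟩
  · rcases List.mem_append.1 hi with h | h
    exacts [hl i h, hl' i h]
  · rw [List.map_append, List.prod_append]
    exact mul_dvd_mul h h'

theorem DvdMonomial.of_isUnit {T : Finset σ} {f : PS σ} (hf : IsUnit f) : DvdMonomial T f :=
  ⟨[], by simp, by simpa using isUnit_iff_dvd_one.1 hf⟩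

theorem DvdMonomial.xx {T : Finset σ} {i : σ} (hi : i ∈ T) : DvdMonomial T (xx i) :=
  ⟨[i], by simpa using hi, by simp⟩

theorem DvdMonomial.pow {T : Finset σ} {f : PS σ} (hf : DvdMonomial T f) (n : ℕ) : DvdMonomial T (f ^ n) := by
  induction n with
  | zero => simpa using DvdMonomial.of_isUnit isUnit_one
  | succ n ih => rw [pow_succ]; exact ih.mul hf

theorem DvdMonomial.mono {T T' : Finset σ} {f : PS σ} (hf : DvdMonomial T f) (h : T ⊆ T') : DvdMonomial T' f := by
  obtain ⟨l, hl, hd⟩ := hf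
  exact ⟨l, fun i hi => h (hl i hi), hd⟩

theorem DvdMonomial.ne_zero {T : Finset σ} {f : PS σ} (hf : DvdMonomial T f) : f ≠ 0 := by
  obtain ⟨l, hl, hd⟩ := hf
  refine ne_zero_of_dvd_ne_zero (fun h => ?_) hd
  rw [List.prod_eq_zero_iff, List.mem_map] at h
  obtain ⟨i, -, hi⟩ := h
  have := congrArg (MvPowerSeries.coeff (Finsupp.single i 1)) hi
  simp [MvPowerSeries.coeff_index_single_self_X] at this

theorem DvdMonomial.exists_eq [Fintype σ] [DecidableEq σ] {T : Finset σ} {f : PS σ} (hf : DvdMonomial T f) :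
    ∃ l : List σ, (∀ i ∈ l, i ∈ T) ∧ ∃ u, IsUnit u ∧ f = u * (l.map BernsteinSato.xx).prod := by
  obtain ⟨l, hl, hd⟩ := hf
  induction l generalizing f with
  | nil => exact ⟨[], by simp, f, isUnit_of_dvd_one (by simpa using hd), by simp⟩
  | cons i l ih =>
    have hl' : ∀ i ∈ l, i ∈ T := fun i hi => hl i (List.mem_cons_of_mem _ hi)
    rw [List.map_cons, List.prod_cons] at hd
    rcases (prime_xx i).left_dvd_or_dvd_right_of_dvd_mul hd with h | h
    · obtain ⟨g, rfl⟩ := h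
      obtain ⟨l', h1, u, hu, rfl⟩ := ih hl' ((mul_dvd_mul_iff_left (xx_ne_zero i)).1 hd)
      refine ⟨i :: l', fun j hj => ?_, u, hu, ?_⟩
      · rcases List.mem_cons.1 hj with h | h
        exacts [h ▸ hl i List.mem_cons_self, h1 j h]
      · rw [List.map_cons, List.prod_cons]; ring
    · exact ih hl' h

theorem exists_prod_eq_monomial (l : List σ) :
    ∃ α : σ →₀ ℕ, (l.map (xx (σ := σ))).prod = MvPowerSeries.monomial α 1 := by
  induction l with
  | nil => exact ⟨0, by simp⟩
  | cons i l ih =>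
    obtain ⟨α, hα⟩ := ih
    refine ⟨Finsupp.single i 1 + α, ?_⟩
    rw [List.map_cons, List.prod_cons, hα, xx, MvPowerSeries.X, MvPowerSeries.monomial_mul_monomial, one_mul]

theorem le_of_coeff_ne_zero {α e : σ →₀ ℕ} {u : PS σ}
    (h : MvPowerSeries.coeff e (u * MvPowerSeries.monomial α 1) ≠ 0) : α ≤ e := by
  classical
  rw [MvPowerSeries.coeff_mul_monomial] at h
  by_contra h'
  rw [if_neg h'] at h
  exact h rfl

theorem coeff_self_ne_zero {α : σ →₀ ℕ} {u : PS σ} (hu : IsUnit u) :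
    MvPowerSeries.coeff α (u * MvPowerSeries.monomial α 1) ≠ 0 := by
  classical
  rw [MvPowerSeries.coeff_mul_monomial, if_pos le_rfl, tsub_self, mul_one]
  exact isUnit_iff_cst.1 hu

theorem dvd_of_le {α β : σ →₀ ℕ} {u v : PS σ} (hu : IsUnit u) (h : α ≤ β) :
    u * MvPowerSeries.monomial α 1 ∣ v * MvPowerSeries.monomial β 1 := by
  have : MvPowerSeries.monomial β (1 : ℂ) = MvPowerSeries.monomial α 1 * MvPowerSeries.monomial (β - α) 1 := by
    rw [MvPowerSeries.monomial_mul_monomial, one_mul, add_tsub_cancel_of_le h]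
  rw [this, hu.mul_left_dvd]
  exact (dvd_mul_right _ _).mul_left _

theorem dvd_or_dvd_of_sub [Fintype σ] [DecidableEq σ] {T : Finset σ} {p q : PS σ} (hp : DvdMonomial T p)
    (hq : DvdMonomial T q) (hpq : DvdMonomial T (p - q)) : p ∣ q ∨ q ∣ p := by
  obtain ⟨l1, -, u, hu, h1⟩ := hp.exists_eq
  obtain ⟨l2, -, v, hv, h2⟩ := hq.exists_eq
  obtain ⟨l3, -, w, hw, h3⟩ := hpq.exists_eq
  obtain ⟨α, hα⟩ := exists_prod_eq_monomial l1
  obtain ⟨β, hβ⟩ := exists_prod_eq_monomial l2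
  obtain ⟨γ, hγ⟩ := exists_prod_eq_monomial l3
  rw [hα] at h1
  rw [hβ] at h2
  rw [hγ] at h3
  by_cases hab : α ≤ β
  · left; rw [h1, h2]; exact dvd_of_le hu hab
  by_cases hba : β ≤ α
  · right; rw [h1, h2]; exact dvd_of_le hv hba
  exfalso
  have c1 : γ ≤ α := by
    refine le_of_coeff_ne_zero (u := w) ?_
    rw [← h3, map_sub, h1, h2]
    have : MvPowerSeries.coeff α (v * MvPowerSeries.monomial β 1) = 0 :=
      by_contra fun h => hba (le_of_coeff_ne_zero h)
    rw [this, sub_zero]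
    exact coeff_self_ne_zero hu
  have c2 : γ ≤ β := by
    refine le_of_coeff_ne_zero (u := w) ?_
    rw [← h3, map_sub, h1, h2]
    have : MvPowerSeries.coeff β (u * MvPowerSeries.monomial α 1) = 0 :=
      by_contra fun h => hab (le_of_coeff_ne_zero h)
    rw [this, zero_sub, neg_ne_zero]
    exact coeff_self_ne_zero hv
  have c3 := coeff_self_ne_zero (α := γ) hw
  rw [← h3, map_sub, h1, h2] at c3
  by_cases h : MvPowerSeries.coeff γ (u * MvPowerSeries.monomial α 1) = 0
  · rw [h, zero_sub, neg_ne_zero] at c3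
    exact hba ((le_of_coeff_ne_zero c3).trans c1)
  · exact hab ((le_of_coeff_ne_zero h).trans c2)

/-- `a` is divisible by `p`, `q` and `p - q`, except for those which vanish. -/
def CompareBy (a p q : PS σ) : Prop := (p = 0 ∨ p ∣ a) ∧ (q = 0 ∨ q ∣ a) ∧ (p = q ∨ p - q ∣ a)

theorem CompareBy.dvd_or_dvd [Fintype σ] [DecidableEq σ] {T : Finset σ} {a p q : PS σ} (h : CompareBy a p q)
    (ha : DvdMonomial T a) : p ∣ q ∨ q ∣ p := by
  obtain ⟨h1, h2, h3⟩ := h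
  rcases h1 with rfl | h1
  · right; simp
  rcases h2 with rfl | h2
  · left; simp
  rcases h3 with rfl | h3
  · left; exact dvd_rfl
  exact dvd_or_dvd_of_sub (ha.of_dvd h1) (ha.of_dvd h2) (ha.of_dvd h3)

theorem CompareBy.mul {a p q : PS σ} (h : CompareBy a p q) (b : PS σ) : CompareBy (a * b) p q :=
  ⟨h.1.imp_right fun h => h.mul_right b, h.2.1.imp_right fun h => h.mul_right b,
    h.2.2.imp_right fun h => h.mul_right b⟩

theorem CompareBy.map {a p q : PS σ} (h : CompareBy a p q) (φ : PS σ →ₐ[ℂ] PS σ) :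
    CompareBy (φ a) (φ p) (φ q) :=
  ⟨h.1.imp (fun h => by rw [h, map_zero]) (map_dvd φ), h.2.1.imp (fun h => by rw [h, map_zero]) (map_dvd φ),
    h.2.2.imp (fun h => by rw [h]) fun h => by rw [← map_sub]; exact map_dvd φ h⟩

theorem exists_compareBy {κ : Type*} (s : Finset κ) (e : κ → PS σ) (S : Subalgebra ℂ (PS σ)) (he : ∀ i ∈ s, e i ∈ S) :
    ∃ a ∈ S, a ≠ 0 ∧ ∀ i ∈ s, ∀ j ∈ s, CompareBy a (e i) (e j) := by
  classical
  let nz : PS σ → PS σ := fun p => if p = 0 then 1 else p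
  have hnz : ∀ p, nz p ≠ 0 := fun p => by
    by_cases h : p = 0 <;> simp [nz, h]
  have hnz' : ∀ p, p = 0 ∨ p = nz p := fun p => by
    by_cases h : p = 0 <;> simp [nz, h]
  have hS : ∀ p ∈ S, nz p ∈ S := fun p hp => by
    by_cases h : p = 0
    · simp [nz, h]
    · simpa [nz, h] using hp
  have key : ∀ i ∈ s, ∀ j ∈ s, nz (e i - e j) ∣ ∏ i ∈ s, ∏ j ∈ s, nz (e i - e j) := fun i hi j hj =>
    (Finset.dvd_prod_of_mem (fun j => nz (e i - e j)) hj).trans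
      (Finset.dvd_prod_of_mem (fun i => ∏ j ∈ s, nz (e i - e j)) hi)
  have key1 : ∀ i ∈ s, e i = 0 ∨ e i ∣ (∏ i ∈ s, nz (e i)) * ∏ i ∈ s, ∏ j ∈ s, nz (e i - e j) := fun i hi => by
    refine (hnz' (e i)).imp_right fun h => ?_
    nth_rw 1 [h]
    exact (Finset.dvd_prod_of_mem (fun i => nz (e i)) hi).mul_right _
  refine ⟨(∏ i ∈ s, nz (e i)) * ∏ i ∈ s, ∏ j ∈ s, nz (e i - e j), ?_, ?_, fun i hi j hj => ⟨key1 i hi, key1 j hj, ?_⟩⟩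
  · exact mul_mem (prod_mem fun i hi => hS _ (he i hi))
      (prod_mem fun i hi => prod_mem fun j hj => hS _ (sub_mem (he i hi) (he j hj)))
  · exact mul_ne_zero (Finset.prod_ne_zero_iff.2 fun i _ => hnz _)
      (Finset.prod_ne_zero_iff.2 fun i _ => Finset.prod_ne_zero_iff.2 fun j _ => hnz _)
  · refine (hnz' (e i - e j)).imp (fun h => sub_eq_zero.1 h) fun h => ?_
    rw [h]
    exact (key i hi j hj).mul_left _

theorem exists_dvd_all {κ : Type*} {s : Finset κ} (hs : s.Nonempty) (e : κ → PS σ)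
    (h : ∀ i ∈ s, ∀ j ∈ s, e i ∣ e j ∨ e j ∣ e i) : ∃ i ∈ s, ∀ j ∈ s, e i ∣ e j := by
  induction hs using Finset.Nonempty.cons_induction with
  | singleton a => exact ⟨a, by simp, by simp⟩
  | cons a s ha hs ih =>
    obtain ⟨i, hi, hij⟩ := ih fun i hi j hj => h i (Finset.mem_cons_of_mem hi) j (Finset.mem_cons_of_mem hj)
    rcases h a (Finset.mem_cons_self _ _) i (Finset.mem_cons_of_mem hi) with h' | h'
    · refine ⟨a, Finset.mem_cons_self _ _, fun j hj => ?_⟩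
      rcases Finset.mem_cons.1 hj with rfl | hj
      · exact dvd_rfl
      · exact h'.trans (hij j hj)
    · refine ⟨i, Finset.mem_cons_of_mem hi, fun j hj => ?_⟩
      rcases Finset.mem_cons.1 hj with rfl | hj
      · exact h'
      · exact hij j hj

end Monomials

section CoordinateChanges

variable {σ : Type*} [Fintype σ] [DecidableEq σ] {ι : Type*} [Fintype ι] [DecidableEq ι]

/-- The normal crossing case. -/
theorem Good.of_dvdMonomial {F : ι → PS σ} {a : ι → ℕ} {J : PS σ} (hF : ∀ j, DvdMonomial Finset.univ (F j))
    (hJ : DvdMonomial Finset.univ J) : Good (fun i : σ => dd i) F a J := by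
  have hx : ∀ i k : σ, LogDer (dd i) (xx i) (xx k) := fun i k => by
    by_cases h : i = k
    · subst h; exact ⟨1, 0, by rw [dd_xx, if_pos rfl]; simp⟩
    · exact ⟨0, 0, by rw [dd_xx, if_neg h]; simp⟩
  have hm : ∀ f : PS σ, DvdMonomial Finset.univ f → ∀ i, LogDer (dd i) (xx i) f := fun f hf i => by
    obtain ⟨l, -, u, hu, rfl⟩ := hf.exists_eq
    exact (LogDer.of_isUnit hu).mul (LogDer.list_prod _ (by simpa using fun k _ => hx i k))
  have hp : DvdMonomial Finset.univ (∏ j, F j ^ a j) :=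
    Finset.prod_induction _ (DvdMonomial Finset.univ) (fun _ _ h h' => h.mul h') (DvdMonomial.of_isUnit isUnit_one)
      fun j _ => (hF j).pow _
  obtain ⟨l, -, hl⟩ := hp
  exact Good.of_logDer xx (fun i => by rw [dd_xx, if_pos rfl]) hx (fun i j => hm _ (hF j) i)
    (fun i => hm _ hJ i) l hl

theorem dd_kill (T : Finset σ) {j : σ} (hj : j ∈ T) (f : PS σ) : dd j (kill T f) = kill T (dd j f) := by
  rw [chain_rule, Finset.sum_eq_single j]
  · rw [kill_xx, if_pos hj, dd_xx, if_pos rfl, one_mul]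
  · intro l _ hl
    rw [kill_xx]
    split_ifs
    · rw [dd_xx, if_neg (Ne.symm hl), zero_mul]
    · rw [map_zero, zero_mul]
  · simp

theorem dd_mem_free_compl {j k : σ} {c : PS σ} (hc : c ∈ free ({k}ᶜ : Finset σ)) :
    dd j c ∈ free ({k}ᶜ : Finset σ) := by
  by_cases h : j = k
  · subst h; rw [dd_of_free hc]; exact zero_mem _
  · rw [mem_free, ← dd_kill _ (by simpa using h), mem_free.1 hc]

/-- Translation of the `j`-th variable by `c`. -/
def shift (j : σ) (c : PS σ) : PS σ →ₐ[ℂ] PS σ := ev fun i => if i = j then xx j + c else xx i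

theorem shift_xx {j : σ} {c : PS σ} (hc : cst c = 0) (i : σ) :
    shift j c (xx i) = if i = j then xx j + c else xx i :=
  ev_xx (fun i => by split_ifs <;> simp [hc]) i

theorem shift_fix {j : σ} {c f : PS σ} (hc : cst c = 0) (hf : f ∈ free ({j}ᶜ : Finset σ)) : shift j c f = f :=
  hom_fix_free (fun i hi => by rw [shift_xx hc, if_neg (by simpa using hi)]) hf

theorem shift_shift {j : σ} {c c' : PS σ} (h0 : cst c = 0) (hc : c ∈ free ({j}ᶜ : Finset σ)) (hcc : c + c' = 0)
    (f : PS σ) : shift j c' (shift j c f) = f := by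
  have h0' : cst c' = 0 := by
    have := congrArg cst hcc
    simpa [h0] using this
  have : (shift j c').comp (shift j c) = AlgHom.id ℂ _ := by
    apply PS.hom_ext
    intro i
    rw [AlgHom.comp_apply, shift_xx h0, AlgHom.id_apply]
    split_ifs with h
    · subst h
      rw [map_add, shift_fix h0' hc, shift_xx h0', if_pos rfl]
      linear_combination hcc
    · rw [shift_xx h0', if_neg h]
  exact DFunLike.congr_fun this f

theorem Good.of_shift {F : ι → PS σ} {a : ι → ℕ} {J c : PS σ} {j : σ} (h0 : cst c = 0)
    (hc : c ∈ free ({j}ᶜ : Finset σ))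
    (H : Good (fun i : σ => dd i) (fun l => shift j c (F l)) a (shift j c J * 1)) :
    Good (fun i : σ => dd i) F a J := by
  have hc' : -c ∈ free ({j}ᶜ : Finset σ) := neg_mem hc
  have h0' : cst (-c) = 0 := by rw [map_neg, h0, neg_zero]
  have e1 := shift_shift h0 hc (add_neg_cancel c)
  have e2 := shift_shift h0' hc' (neg_add_cancel c)
  refine Good.push (shift j c) (shift j (-c) : PS σ →+ PS σ) (fun l k => dd l (shift j c (xx k)))
    (fun r m => ?_) (fun l b => chain_rule _ _ _) (fun l m => ?_) (map_one (shift j (-c))) H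
  · simp only [AddMonoidHom.coe_coe]
    rw [map_mul, e1]
  · simp only [AddMonoidHom.coe_coe]
    have h1 : ∀ k, dd k (shift j (-c) (dd l (shift j c (xx k)))) = 0 := fun k => by
      rw [shift_xx h0]
      split_ifs with h
      · subst h
        have : dd l (xx k + c) ∈ free ({k}ᶜ : Finset σ) := by
          rw [map_add, dd_xx]
          exact add_mem (by split_ifs; exacts [one_mem _, zero_mem _]) (dd_mem_free_compl hc)
        rw [shift_fix h0' this, dd_of_free this]
      · rw [dd_xx]; split_ifs <;> simp
    obtain ⟨m', rfl⟩ : ∃ m', m = shift j c m' := ⟨_, (e2 m).symm⟩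
    rw [chain_rule (shift j c), map_sum]
    refine Finset.sum_congr rfl fun k _ => ?_
    rw [map_mul, map_mul, Derivation.leibniz, h1, e1, e1]
    simp

end CoordinateChanges

section Ramification

variable {σ : Type*} [Fintype σ] [DecidableEq σ] {ι : Type*} [Fintype ι] [DecidableEq ι]

/-- The substitution `y_i ↦ y_i ^ n_i`. -/
def ram (n : σ → ℕ) : PS σ →ₐ[ℂ] PS σ := ev fun i => xx i ^ n i

omit [DecidableEq σ] in
theorem ram_xx {n : σ → ℕ} (hn : ∀ i, 0 < n i) (i : σ) : ram n (xx i) = xx i ^ n i :=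
  ev_xx (fun i => by simp [(hn i).ne']) i

/-- The exponents in the image of `ramProj`. -/
def ramExp (n : σ → ℕ) (e : σ →₀ ℕ) : σ →₀ ℕ := Finsupp.equivFunOnFinite.symm fun l => n l * e l + (n l - 1)

/-- The trace-like projection `PS σ → PS σ` associated with a ramified covering. -/
def ramProj (n : σ → ℕ) : PS σ →+ PS σ where
  toFun m := fun e => MvPowerSeries.coeff (ramExp n e) m
  map_zero' := rfl
  map_add' _ _ := rfl

omit [DecidableEq σ] in
theorem coeff_ramProj (n : σ → ℕ) (m : PS σ) (e : σ →₀ ℕ) :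
    MvPowerSeries.coeff e (ramProj n m) = MvPowerSeries.coeff (ramExp n e) m := rfl

omit [Fintype σ] [DecidableEq σ] in
theorem xx_pow_eq (i : σ) (k : ℕ) : (xx i : PS σ) ^ k = MvPowerSeries.monomial (Finsupp.single i k) 1 :=
  MvPowerSeries.X_pow_eq i k

theorem ramProj_xx_mul {n : σ → ℕ} (hn : ∀ i, 0 < n i) (i : σ) (m : PS σ) :
    ramProj n (xx i ^ n i * m) = xx i * ramProj n m := by
  ext e
  rw [coeff_ramProj, xx_pow_eq, ← pow_one (xx i), xx_pow_eq, MvPowerSeries.coeff_monomial_mul,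
    MvPowerSeries.coeff_monomial_mul, coeff_ramProj]
  have h1 : Finsupp.single i (n i) ≤ ramExp n e ↔ Finsupp.single i 1 ≤ e := by
    rw [Finsupp.single_le_iff, Finsupp.single_le_iff]
    simp only [ramExp, Finsupp.equivFunOnFinite_symm_apply_apply]
    have := hn i
    constructor
    · intro h
      by_contra h'
      have : e i = 0 := by omega
      rw [this] at h; omega
    · intro h
      have := Nat.mul_le_mul_left (n i) h
      omega
  by_cases h : Finsupp.single i 1 ≤ e
  · rw [if_pos h, if_pos (h1.2 h)]
    suffices h2 : ramExp n e - Finsupp.single i (n i) = ramExp n (e - Finsupp.single i 1) by rw [h2]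
    ext l
    simp only [ramExp, Finsupp.coe_tsub, Pi.sub_apply, Finsupp.equivFunOnFinite_symm_apply_apply]
    by_cases hl : l = i
    · subst hl
      rw [Finsupp.single_le_iff] at h
      obtain ⟨q, hq⟩ := Nat.exists_eq_add_of_le' h
      have := hn l
      rw [hq, Finsupp.single_eq_same, Finsupp.single_eq_same, Nat.add_sub_cancel, Nat.mul_add, mul_one]
      omega
    · rw [Finsupp.single_eq_of_ne hl, Finsupp.single_eq_of_ne hl]; simp
  · rw [if_neg h, if_neg (h1.not.2 h)]

theorem ramProj_mul_mem {n : σ → ℕ} (hn : ∀ i, 0 < n i) (c : ℕ) :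
    ∀ w ∈ mI σ ^ c, ∀ m, ramProj n (ram n w * m) ∈ mI σ ^ c := by
  induction c with
  | zero => simp
  | succ c ih =>
    refine mI_pow_induction ?_ ?_ ?_
    · intro m; rw [map_zero, zero_mul, map_zero]; exact zero_mem _
    · intro f g hf hg m
      rw [map_add, add_mul, map_add]; exact add_mem (hf m) (hg m)
    · intro i g hg m
      rw [map_mul (ram n), ram_xx hn, mul_assoc, ramProj_xx_mul hn, pow_succ']
      exact Ideal.mul_mem_mul (xx_mem_mI i) (ih g hg m)

theorem ramProj_mul {n : σ → ℕ} (hn : ∀ i, 0 < n i) (r m : PS σ) :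
    ramProj n (ram n r * m) = r * ramProj n m := by
  have hp : ∀ p : MvPolynomial σ ℂ, ∀ m, ramProj n (ram n (polyPS p) * m) = polyPS p * ramProj n m := by
    intro p
    induction p using MvPolynomial.induction_on with
    | C c =>
      intro m
      have : polyPS (C c : MvPolynomial σ ℂ) = algebraMap ℂ (PS σ) c := polyPS.commutes c
      rw [this, AlgHom.commutes]
      ext e
      rw [coeff_ramProj, MvPowerSeries.algebraMap_apply]
      simp [coeff_ramProj]
    | add p q hp hq => intro m; simp only [map_add, add_mul, hp, hq]
    | mul_X p i hp =>
      intro m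
      have : polyPS (X i : MvPolynomial σ ℂ) = xx i := by simp [polyPS]
      rw [map_mul polyPS, map_mul (ram n), this, ram_xx hn, mul_assoc, hp, ramProj_xx_mul hn, mul_assoc]
  rw [← sub_eq_zero]
  refine eq_zero_of_forall_mem_pow fun c => ?_
  obtain ⟨p, hp'⟩ := exists_poly c r
  have : ramProj n (ram n r * m) - r * ramProj n m =
      ramProj n (ram n (r - polyPS p) * m) - (r - polyPS p) * ramProj n m := by
    rw [map_sub, sub_mul, map_sub, hp p]; ring
  rw [this]
  exact sub_mem (ramProj_mul_mem hn c _ hp' m) (Ideal.mul_mem_right _ _ hp')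

theorem ramProj_jac {n : σ → ℕ} (hn : ∀ i, 0 < n i) : ramProj n (∏ l, xx l ^ (n l - 1)) = 1 := by
  have h0 : ramExp n 0 = Finsupp.equivFunOnFinite.symm fun l => n l - 1 := by
    ext l; simp [ramExp]
  have : (∏ l, xx l ^ (n l - 1) : PS σ) = MvPowerSeries.monomial (ramExp n 0) 1 := by
    simp only [xx_pow_eq]
    rw [MvPowerSeries.prod_monomial, Finset.prod_const_one, h0]
    congr 2
    ext l
    rw [Finsupp.finsetSum_apply, Finset.sum_eq_single l]
    · rw [Finsupp.single_eq_same]; rfl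
    · intro i _ hi; rw [Finsupp.single_eq_of_ne hi.symm]
    · simp
  rw [this]
  ext e
  rw [coeff_ramProj, MvPowerSeries.coeff_monomial, MvPowerSeries.coeff_one]
  refine if_congr ⟨fun h => ?_, fun h => by rw [h]⟩ rfl rfl
  ext l
  have := DFunLike.congr_fun h l
  simp only [ramExp, Finsupp.equivFunOnFinite_symm_apply_apply, Finsupp.coe_zero, Pi.zero_apply, mul_zero] at this
  have h2 := hn l
  have : n l * e l = 0 := by omega
  simpa [h2.ne'] using this

theorem dd_ramProj {n : σ → ℕ} (hn : ∀ i, 0 < n i) (j : σ) (m : PS σ) :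
    ramProj n (dd j m) = dd j (ramProj n ((n j : PS σ) * xx j ^ (n j - 1) * m)) := by
  ext e
  rw [coeff_ramProj, dd, MvPowerSeries.coeff_pderiv, MvPowerSeries.coeff_pderiv, coeff_ramProj, xx_pow_eq,
    mul_assoc, ← nsmul_eq_mul, map_nsmul, MvPowerSeries.coeff_monomial_mul]
  have hj := hn j
  have h1 : (ramExp n (e + Finsupp.single j 1)) j = n j * e j + n j + (n j - 1) := by
    simp [ramExp, mul_add]
  rw [if_pos (by rw [Finsupp.single_le_iff, h1]; omega)]
  have h2 : ramExp n (e + Finsupp.single j 1) - Finsupp.single j (n j - 1) = ramExp n e + Finsupp.single j 1 := by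
    ext l
    by_cases hl : l = j
    · subst hl
      rw [Finsupp.tsub_apply, h1, Finsupp.single_eq_same, Finsupp.add_apply, Finsupp.single_eq_same]
      simp only [ramExp, Finsupp.equivFunOnFinite_symm_apply_apply]
      omega
    · simp only [ramExp, Finsupp.coe_tsub, Pi.sub_apply, Finsupp.equivFunOnFinite_symm_apply_apply, Finsupp.add_apply]
      rw [Finsupp.single_eq_of_ne hl, Finsupp.single_eq_of_ne hl]; simp
  rw [h2]
  have h3 : ((ramExp n e j : ℕ) : ℂ) + 1 = n j * (e j + 1) := by
    simp only [ramExp, Finsupp.equivFunOnFinite_symm_apply_apply]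
    rw [← Nat.cast_succ, Nat.succ_eq_add_one, add_assoc, Nat.sub_add_cancel hj]
    push_cast; ring
  rw [h3, nsmul_eq_mul]
  ring

theorem Good.of_ram {F : ι → PS σ} {a : ι → ℕ} {J : PS σ} {n : σ → ℕ} (hn : ∀ i, 0 < n i)
    (H : Good (fun i : σ => dd i) (fun l => ram n (F l)) a (ram n J * ∏ l, xx l ^ (n l - 1))) :
    Good (fun i : σ => dd i) F a J := by
  have hu : ∀ l k, dd l (ram n (xx k)) = if l = k then (n k : PS σ) * xx k ^ (n k - 1) else 0 := fun l k => by
    rw [ram_xx hn, Derivation.leibniz_pow, dd_xx]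
    split_ifs with h
    · simp
    · simp
  refine Good.push (ram n) (ramProj n) (fun l k => dd l (ram n (xx k)))
    (fun r m => ramProj_mul hn r m) (fun l b => chain_rule _ _ _) (fun l m => ?_) (ramProj_jac hn) H
  rw [Finset.sum_eq_single l]
  · rw [hu, if_pos rfl]; exact dd_ramProj hn l m
  · intro k _ hk
    rw [hu, if_neg hk.symm, zero_mul, map_zero, map_zero]
  · simp

end Ramification

section BlowUp

variable {σ : Type*} [Fintype σ] [DecidableEq σ] {ι : Type*} [Fintype ι] [DecidableEq ι]

/-- The chart `y_j ↦ y_i (y_j + ξ)` of the blow-up. -/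
def blow (i j : σ) (ξ : ℂ) : PS σ →ₐ[ℂ] PS σ :=
  ev fun l => if l = j then xx i * (xx j + algebraMap ℂ _ ξ) else xx l

theorem blow_xx (i j : σ) (ξ : ℂ) (l : σ) :
    blow i j ξ (xx l) = if l = j then xx i * (xx j + algebraMap ℂ _ ξ) else xx l :=
  ev_xx (fun l => by split_ifs <;> simp) l

/-- The homomorphism from a chart of the blow-up to the completion at the point `X = ξ`. -/
def chartHom (i j : σ) (ξ : ℂ) : Polynomial (PS σ) →ₐ[ℂ] PS σ :=
  { Polynomial.eval₂RingHom (blow i j ξ : PS σ →+* PS σ) (xx j + algebraMap ℂ _ ξ) with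
    commutes' := fun c => by
      have : algebraMap ℂ (Polynomial (PS σ)) c = Polynomial.C (algebraMap ℂ (PS σ) c) := rfl
      simp [this] }

theorem chartHom_C (i j : σ) (ξ : ℂ) (r : PS σ) : chartHom i j ξ (Polynomial.C r) = blow i j ξ r :=
  Polynomial.eval₂_C _ _

theorem chartHom_X (i j : σ) (ξ : ℂ) : chartHom i j ξ Polynomial.X = xx j + algebraMap ℂ _ ξ :=
  Polynomial.eval₂_X _ _

theorem dd_blow {i j : σ} (hij : i ≠ j) (ξ : ℂ) (k : σ) (r : PS σ) :
    dd k (blow i j ξ r) = if k = i then blow i j ξ (dd i r) + (xx j + algebraMap ℂ _ ξ) * blow i j ξ (dd j r)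
      else if k = j then xx i * blow i j ξ (dd j r) else blow i j ξ (dd k r) := by
  have h1 : ∀ l, dd k (blow i j ξ (xx l)) = if l = j then
      (if k = i then xx j + algebraMap ℂ _ ξ else 0) + (if k = j then xx i else 0) else
      if k = l then 1 else 0 := fun l => by
    rw [blow_xx]
    split_ifs with h1 h2 h3 h4 h5
    · exact absurd (h2.symm.trans h3) hij
    all_goals simp_all [dd_xx, Derivation.leibniz]
  rw [chain_rule]
  simp only [h1]
  rw [← Finset.add_sum_erase _ _ (Finset.mem_univ j), if_pos rfl]
  have h2 : ∑ l ∈ Finset.univ.erase j, (if l = j then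
      ((if k = i then xx j + algebraMap ℂ (PS σ) ξ else 0) + (if k = j then xx i else 0)) else
      if k = l then 1 else 0) * blow i j ξ (dd l r) = if k = j then 0 else blow i j ξ (dd k r) := by
    rw [Finset.sum_congr rfl (g := fun l => if k = l then blow i j ξ (dd l r) else 0) fun l hl => by
      rw [if_neg (Finset.ne_of_mem_erase hl), ite_mul, one_mul, zero_mul]]
    rw [Finset.sum_ite_eq]
    by_cases h : k = j <;> simp [h]
  rw [h2]
  by_cases hki : k = i
  · subst hki; simp [hij, add_comm]
  · by_cases hkj : k = j
    · subst hkj; simp [hki]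
    · simp [hki, hkj]

theorem dd_chartHom {i j : σ} (hij : i ≠ j) (ξ : ℂ) (k : σ) (b : Polynomial (PS σ)) :
    dd k (chartHom i j ξ b) = chartHom i j ξ (chartDer (fun l : σ => dd l) xx i j k b) := by
  refine derivation_hom_eq _ _ _ (fun r => ?_) ?_ b
  · rw [chartHom_C, dd_blow hij]
    unfold chartDer
    split_ifs with h1 h2
    · subst h1; simp only [Derivation.coe_add, Pi.add_apply, Derivation.coe_smul, Pi.smul_apply, map_add, smul_eq_mul,
        polyDer_C, map_mul, chartHom_C, chartHom_X]
    · simp [chartHom_C, blow_xx, hij]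
    · simp [chartHom_C]
  · rw [chartHom_X, map_add, Derivation.map_algebraMap, add_zero, dd_xx]
    unfold chartDer
    split_ifs with h1 h2 h3
    · exact absurd (h2.symm.trans h1) hij
    all_goals simp

/-- Polynomial coordinates near the point `X = ξ` of a chart of the blow-up. -/
def chartPoly (j : σ) (ξ : ℂ) : MvPolynomial σ ℂ →ₐ[ℂ] Polynomial (PS σ) :=
  aeval fun l => if l = j then Polynomial.X - Polynomial.C (algebraMap ℂ _ ξ) else Polynomial.C (xx l)

omit [Fintype σ] in
theorem chartPoly_X (j : σ) (ξ : ℂ) (l : σ) : chartPoly j ξ (X l) =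
    if l = j then Polynomial.X - Polynomial.C (algebraMap ℂ _ ξ) else Polynomial.C (xx l) := aeval_X _ _

theorem chartHom_chartPoly {i j : σ} (ξ : ℂ) (q : MvPolynomial σ ℂ) :
    chartHom i j ξ (chartPoly j ξ q) = polyPS q := by
  have : (chartHom i j ξ).comp (chartPoly j ξ) = polyPS := by
    apply MvPolynomial.algHom_ext
    intro l
    rw [AlgHom.comp_apply, chartPoly_X, polyPS, aeval_X]
    split_ifs with h
    · rw [map_sub, chartHom_X, chartHom_C, AlgHom.commutes, h]; ring
    · rw [chartHom_C, blow_xx, if_neg h]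
  exact DFunLike.congr_fun this q

/-- The maximal ideal of the point `X = ξ` of a chart. -/
def chartIdeal (σ : Type*) (ξ : ℂ) : Ideal (Polynomial (PS σ)) :=
  RingHom.ker (Polynomial.eval₂RingHom ((cst : PS σ →ₐ[ℂ] ℂ) : PS σ →+* ℂ) ξ)

omit [Fintype σ] [DecidableEq σ] in
theorem mem_chartIdeal {ξ : ℂ} {w : Polynomial (PS σ)} :
    w ∈ chartIdeal σ ξ ↔ w.eval₂ ((cst : PS σ →ₐ[ℂ] ℂ) : PS σ →+* ℂ) ξ = 0 := Iff.rfl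

theorem cst_chartHom (i j : σ) (ξ : ℂ) (w : Polynomial (PS σ)) :
    cst (chartHom i j ξ w) = w.eval₂ ((cst : PS σ →ₐ[ℂ] ℂ) : PS σ →+* ℂ) ξ := by
  induction w using Polynomial.induction_on' with
  | add p q hp hq => rw [map_add, map_add, hp, hq, Polynomial.eval₂_add]
  | monomial n a =>
    rw [Polynomial.eval₂_monomial, ← Polynomial.C_mul_X_pow_eq_monomial, map_mul, map_pow, chartHom_C, chartHom_X,
      map_mul, map_pow, cst_hom, map_add, cst_xx, cst_algebraMap, zero_add]
    rfl

theorem chartHom_mem {i j : σ} {ξ : ℂ} {w : Polynomial (PS σ)} {c : ℕ} (h : w ∈ chartIdeal σ ξ ^ c) :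
    chartHom i j ξ w ∈ mI σ ^ c := by
  have h1 : (chartIdeal σ ξ).map (chartHom i j ξ).toRingHom ≤ mI σ := by
    rw [Ideal.map_le_iff_le_comap]
    intro g hg
    rw [Ideal.mem_comap, mem_mI]
    exact (cst_chartHom i j ξ g).trans (mem_chartIdeal.1 hg)
  have h2 := Ideal.pow_right_mono h1 c
  rw [← Ideal.map_pow] at h2
  exact h2 (Ideal.mem_map_of_mem (chartHom i j ξ).toRingHom h)

omit [Fintype σ] in
theorem chartPoly_mem {j : σ} {ξ : ℂ} {q : MvPolynomial σ ℂ} {c : ℕ} (h : q ∈ idealOfVars σ ℂ ^ c) :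
    chartPoly j ξ q ∈ chartIdeal σ ξ ^ c := by
  have h1 : (idealOfVars σ ℂ).map (chartPoly j ξ).toRingHom ≤ chartIdeal σ ξ := by
    rw [idealOfVars, Ideal.map_span, Ideal.span_le]
    rintro _ ⟨_, ⟨l, rfl⟩, rfl⟩
    have : (chartPoly j ξ).toRingHom (X l) = chartPoly j ξ (X l) := rfl
    rw [SetLike.mem_coe, this, chartPoly_X, mem_chartIdeal]
    split_ifs <;> simp
  have h2 := Ideal.pow_right_mono h1 c
  rw [← Ideal.map_pow] at h2
  exact h2 (Ideal.mem_map_of_mem (chartPoly j ξ).toRingHom h)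

omit [Fintype σ] [DecidableEq σ] in
theorem C_mem_chartIdeal_pow {ξ : ℂ} {r : PS σ} {c : ℕ} (h : r ∈ mI σ ^ c) :
    Polynomial.C r ∈ chartIdeal σ ξ ^ c := by
  have h1 : (mI σ).map Polynomial.C ≤ chartIdeal σ ξ := by
    rw [Ideal.map_le_iff_le_comap]
    intro g hg
    rw [Ideal.mem_comap, mem_chartIdeal, Polynomial.eval₂_C]
    exact cst_eq_zero_of_mem hg
  have h2 := Ideal.pow_right_mono h1 c
  rw [← Ideal.map_pow] at h2
  exact h2 (Ideal.mem_map_of_mem _ h)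

theorem exists_chartPoly {i j : σ} (hij : i ≠ j) (ξ : ℂ) (c : ℕ) (w : Polynomial (PS σ)) :
    ∃ q, w - chartPoly j ξ q ∈ chartIdeal σ ξ ^ c ⊔
      Ideal.span {Polynomial.C (xx i) * Polynomial.X - Polynomial.C (xx j)} := by
  set I := chartIdeal σ ξ ^ c ⊔ Ideal.span {Polynomial.C (xx i) * Polynomial.X - Polynomial.C (xx j)} with hI
  let π := Ideal.Quotient.mkₐ ℂ I
  let A := (π.comp (chartPoly j ξ)).range
  have hX : π Polynomial.X ∈ A := (AlgHom.mem_range _).2 ⟨X j + C ξ, by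
    rw [AlgHom.comp_apply, map_add, chartPoly_X, if_pos rfl]
    have : chartPoly j ξ (C ξ : MvPolynomial σ ℂ) = Polynomial.C (algebraMap ℂ _ ξ) := (chartPoly j ξ).commutes ξ
    rw [this, sub_add_cancel]⟩
  have hx : ∀ l ≠ j, π (Polynomial.C (xx l)) ∈ A := fun l hl => (AlgHom.mem_range _).2 ⟨X l, by
    rw [AlgHom.comp_apply, chartPoly_X, if_neg hl]⟩
  have hx' : ∀ l, π (Polynomial.C (xx l)) ∈ A := fun l => by
    by_cases h : l = j
    · subst h
      have : π (Polynomial.C (xx l)) = π (Polynomial.C (xx i)) * π Polynomial.X := by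
        rw [← map_mul, eq_comm]
        exact Ideal.Quotient.eq.2 (Ideal.mem_sup_right (Ideal.mem_span_singleton_self _))
      rw [this]
      exact mul_mem (hx i hij) hX
    · exact hx l h
  have hp : ∀ p : MvPolynomial σ ℂ, π (Polynomial.C (polyPS p)) ∈ A := fun p => by
    induction p using MvPolynomial.induction_on with
    | C c =>
      have h1 : polyPS (C c : MvPolynomial σ ℂ) = algebraMap ℂ (PS σ) c := polyPS.commutes c
      rw [h1]
      refine (AlgHom.mem_range _).2 ⟨C c, ?_⟩
      have : chartPoly j ξ (C c : MvPolynomial σ ℂ) = Polynomial.C (algebraMap ℂ _ c) := (chartPoly j ξ).commutes c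
      rw [AlgHom.comp_apply, this]
    | add p q hp hq => simp only [map_add]; exact add_mem hp hq
    | mul_X p l hp =>
      have : polyPS (X l : MvPolynomial σ ℂ) = xx l := by simp [polyPS]
      rw [map_mul polyPS, this, Polynomial.C_mul, map_mul π]
      exact mul_mem hp (hx' l)
  have hC : ∀ r, π (Polynomial.C r) ∈ A := fun r => by
    obtain ⟨p, hp'⟩ := exists_poly c r
    have : π (Polynomial.C r) = π (Polynomial.C (polyPS p)) := by
      refine Ideal.Quotient.eq.2 (Ideal.mem_sup_left ?_)
      rw [← Polynomial.C_sub]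
      exact C_mem_chartIdeal_pow hp'
    rw [this]
    exact hp p
  have hw : π w ∈ A := by
    induction w using Polynomial.induction_on' with
    | add p q hp hq => rw [map_add]; exact add_mem hp hq
    | monomial n a =>
      rw [← Polynomial.C_mul_X_pow_eq_monomial, map_mul, map_pow]
      exact mul_mem (hC a) (pow_mem hX n)
  obtain ⟨q, hq⟩ := hw
  exact ⟨q, Ideal.Quotient.eq.1 hq.symm⟩

theorem ChartGood.of_good {F : ι → PS σ} {a : ι → ℕ} {J : PS σ} {i j : σ} (hij : i ≠ j) (ξ : ℂ)
    (H : Good (fun k : σ => dd k) (fun l => blow i j ξ (F l)) a (blow i j ξ J * xx i)) :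
    ChartGood (fun k : σ => dd k) xx i j F a J cst ξ := by
  have hκ : ∀ w ∈ Ideal.span {Polynomial.C (xx i) * Polynomial.X - Polynomial.C (xx j)}, chartHom i j ξ w = 0 := by
    intro w hw
    obtain ⟨v, rfl⟩ := Ideal.mem_span_singleton.1 hw
    rw [map_mul, map_sub, map_mul, chartHom_C, chartHom_C, chartHom_X, blow_xx, blow_xx, if_pos rfl, if_neg hij,
      sub_self, zero_mul]
  have H' : Good (fun k : σ => dd k) (fun l => chartHom i j ξ (Polynomial.C (F l))) a
      (chartHom i j ξ (Polynomial.C J * Polynomial.C (xx i))) := by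
    simpa only [map_mul, chartHom_C, blow_xx, if_neg hij] using H
  obtain ⟨b, hb, Λ, φ, hφ, e, he, h⟩ := Good.descend (E := chartDer (fun l : σ => dd l) xx i j)
    (chartHom i j ξ) (fun k b => dd_chartHom hij ξ k b) (chartIdeal σ ξ)
    (Ideal.span {Polynomial.C (xx i) * Polynomial.X - Polynomial.C (xx j)}) (mI σ)
    (fun c w hw => by
      obtain ⟨q, hq⟩ := exists_chartPoly hij ξ c w
      obtain ⟨u, hu, v, hv, huv⟩ := Submodule.mem_sup.1 hq
      have h1 : polyPS q ∈ mI σ ^ c := by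
        rw [← chartHom_chartPoly (i := i) (j := j) ξ]
        have : chartPoly j ξ q = w - (u + v) := by rw [huv]; ring
        rw [this, map_sub, map_add, hκ v hv, add_zero]
        exact sub_mem hw (chartHom_mem hu)
      have h2 := add_mem hq (Ideal.mem_sup_left (chartPoly_mem (j := j) (ξ := ξ) (mem_idealOfVars_pow h1)))
      rwa [sub_add_cancel] at h2)
    (fun c r => by
      obtain ⟨p, hp⟩ := exists_poly c r
      exact ⟨chartPoly j ξ p, by rwa [chartHom_chartPoly]⟩) H'
  refine ⟨b, hb, Λ, φ, ?_, e, he, h⟩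
  rw [mem_chartIdeal, Polynomial.eval₂_sub, Polynomial.eval₂_one, sub_eq_zero] at hφ
  exact hφ

theorem Good.of_blow {F : ι → PS σ} {a : ι → ℕ} {J : PS σ} {i j : σ} (hij : i ≠ j) (hF : ∀ l, F l ≠ 0)
    {p : ℕ} (hp : xx i ∣ (∏ l, F l ^ a l) ^ p)
    (h₀ : ∀ ξ, Good (fun k : σ => dd k) (fun l => blow i j ξ (F l)) a (blow i j ξ J * xx i))
    (h₁ : Good (fun k : σ => dd k) (fun l => blow j i 0 (F l)) a (blow j i 0 J * xx j)) :
    Good (fun k : σ => dd k) F a J :=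
  have : IsDomain (PS σ) := NoZeroDivisors.to_isDomain _
  Good.of_blowup (ρ := cst) (fun _ hr => isUnit_iff_cst.2 hr) (fun i k r => dd_comm i k r)
    (fun k l => dd_xx k l) hij hF hp (fun ξ => ChartGood.of_good hij ξ (h₀ ξ)) (ChartGood.of_good hij.symm 0 h₁)

end BlowUp

section Resolution

variable {σ : Type*} [Fintype σ] [DecidableEq σ]

/-- A homomorphism which only changes the variables in `T`. -/
def BaseHom (T : Finset σ) (φ : PS σ →ₐ[ℂ] PS σ) : Prop :=
  (∀ i ∈ T, φ (xx i) ∈ free T) ∧ ∀ i, i ∉ T → φ (xx i) = xx i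

theorem BaseHom.mem_free {T T' : Finset σ} {φ : PS σ →ₐ[ℂ] PS σ} (h : BaseHom T φ) (hT : T ⊆ T') {f : PS σ}
    (hf : f ∈ free T') : φ f ∈ free T' := by
  refine map_mem_free (fun i hi => ?_) hf
  by_cases hiT : i ∈ T
  · exact free_mono hT (h.1 i hiT)
  · rw [h.2 i hiT]; exact xx_mem_free hi

theorem BaseHom.fixVar {T : Finset σ} {φ : PS σ →ₐ[ℂ] PS σ} (h : BaseHom T φ) {k : σ} (hk : k ∉ T) :
    FixVar k φ := by
  refine ⟨h.2 k hk, fun i hi => ?_⟩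
  by_cases hiT : i ∈ T
  · exact free_compl hk (h.1 i hiT)
  · rw [h.2 i hiT]; exact mem_free_compl_xx hi

/-- The coordinate changes used to resolve a power series, each given by a set of charts with their
Jacobians. -/
inductive Move (T : Finset σ) : Set ((PS σ →ₐ[ℂ] PS σ) × PS σ) → Prop
  | shift (j : σ) (c : PS σ) (hj : j ∈ T) (hc : c ∈ free (T.erase j)) (h0 : cst c = 0) :
      Move T {(BernsteinSato.shift j c, 1)}
  | ram (n : σ → ℕ) (hn : ∀ i, 0 < n i) (h1 : ∀ i, i ∉ T → n i = 1) :
      Move T {(BernsteinSato.ram n, ∏ l, xx l ^ (n l - 1))}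
  | blow (i j : σ) (hi : i ∈ T) (hj : j ∈ T) (hij : i ≠ j) :
      Move T (insert (BernsteinSato.blow j i 0, xx i * xx j)
        (Set.range fun ξ => (BernsteinSato.blow i j ξ, xx i)))

theorem Move.mono {T T' : Finset σ} (h : T ⊆ T') {Φ : Set ((PS σ →ₐ[ℂ] PS σ) × PS σ)} (hΦ : Move T Φ) :
    Move T' Φ := by
  cases hΦ with
  | shift j c hj hc h0 => exact .shift j c (h hj) (free_mono (Finset.erase_subset_erase j h) hc) h0
  | ram n hn h1 => exact .ram n hn fun i hi => h1 i fun h' => hi (h h')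
  | blow i j hi hj hij => exact .blow i j (h hi) (h hj) hij

theorem blow_baseHom {T : Finset σ} {i j : σ} (hi : i ∈ T) (hj : j ∈ T) (ξ : ℂ) : BaseHom T (blow i j ξ) := by
  refine ⟨fun l hl => ?_, fun l hl => ?_⟩
  · rw [blow_xx]
    split_ifs
    · exact mul_mem (xx_mem_free hi) (add_mem (xx_mem_free hj) (algebraMap_mem _ _))
    · exact xx_mem_free hl
  · rw [blow_xx, if_neg (by rintro rfl; exact hl hj)]

theorem ram_baseHom {T : Finset σ} {n : σ → ℕ} (hn : ∀ i, 0 < n i) (h1 : ∀ i, i ∉ T → n i = 1) :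
    BaseHom T (ram n) :=
  ⟨fun i hi => by rw [ram_xx hn]; exact pow_mem (xx_mem_free hi) _,
    fun i hi => by rw [ram_xx hn, h1 i hi, pow_one]⟩

theorem shift_baseHom {T : Finset σ} {j : σ} {c : PS σ} (hj : j ∈ T) (hc : c ∈ free T) (h0 : cst c = 0) :
    BaseHom T (shift j c) := by
  refine ⟨fun i hi => ?_, fun i hi => ?_⟩
  · rw [shift_xx h0]
    split_ifs
    · exact add_mem (xx_mem_free hj) hc
    · exact xx_mem_free hi
  · rw [shift_xx h0, if_neg (by rintro rfl; exact hi hj)]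

theorem Move.baseHom {T : Finset σ} {Φ : Set ((PS σ →ₐ[ℂ] PS σ) × PS σ)} (hΦ : Move T Φ) :
    ∀ p ∈ Φ, BaseHom T p.1 ∧ p.2 ∈ free T := by
  cases hΦ with
  | shift j c hj hc h0 =>
    rintro _ rfl
    exact ⟨shift_baseHom hj (free_mono (Finset.erase_subset j T) hc) h0, one_mem _⟩
  | ram n hn h1 =>
    rintro _ rfl
    refine ⟨ram_baseHom hn h1, prod_mem fun l _ => ?_⟩
    by_cases hl : l ∈ T
    · exact pow_mem (xx_mem_free hl) _
    · simp only [h1 l hl]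
      exact one_mem _
  | blow i j hi hj hij =>
    rintro _ (rfl | ⟨ξ, rfl⟩)
    · exact ⟨blow_baseHom hj hi 0, mul_mem (xx_mem_free hi) (xx_mem_free hj)⟩
    · exact ⟨blow_baseHom hi hj ξ, xx_mem_free hi⟩

theorem Move.nonempty {T : Finset σ} {Φ : Set ((PS σ →ₐ[ℂ] PS σ) × PS σ)} (hΦ : Move T Φ) : Φ.Nonempty := by
  cases hΦ with
  | shift => exact ⟨_, rfl⟩
  | ram => exact ⟨_, rfl⟩
  | blow => exact ⟨_, Or.inl rfl⟩

/-- `h` becomes a divisor of a monomial after finitely many moves and enlargements. -/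
inductive Res (T : Finset σ) : PS σ → Prop
  | leaf {h : PS σ} (hh : DvdMonomial T h) : Res T h
  | enlarge {h h' : PS σ} (hh : h' ∈ free T) (H : Res T (h * h')) : Res T h
  | move {h : PS σ} {Φ : Set ((PS σ →ₐ[ℂ] PS σ) × PS σ)} (hΦ : Move T Φ)
      (H : ∀ p ∈ Φ, Res T (p.1 h * p.2)) : Res T h

theorem Res.ne_zero {T : Finset σ} {h : PS σ} (H : Res T h) : h ≠ 0 := by
  induction H with
  | leaf hh => exact hh.ne_zero
  | enlarge _ _ ih => exact left_ne_zero_of_mul ih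
  | move hΦ _ ih =>
    obtain ⟨p, hp⟩ := hΦ.nonempty
    rintro rfl
    exact ih p hp (by rw [map_zero, zero_mul])

theorem Res.transport {T : Finset σ} {k : σ} {S : PS σ → PS σ → Prop}
    (hS : ∀ φ, BaseHom T φ → ∀ a h, S a h → S (φ a) (φ h))
    (hmul : ∀ a h, ∀ a' ∈ free T, S a h → S (a * a') h)
    (hJ : ∀ a h, ∀ t ∈ free T, S a h → S (a * t) (h * t))
    (hleaf : ∀ a h, DvdMonomial T a → S a h → Res (insert k T) h) {a : PS σ} (ha : Res T a) :
    ∀ h, S a h → Res (insert k T) h := by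
  induction ha with
  | leaf ha => exact fun h => hleaf _ h ha
  | enlarge ha' _ ih => exact fun h hh => ih h (hmul _ _ _ ha' hh)
  | move hΦ _ ih =>
    intro h hh
    refine .move (hΦ.mono (Finset.subset_insert k T)) fun p hp => ?_
    obtain ⟨h1, h2⟩ := hΦ.baseHom p hp
    exact ih p hp _ (hJ _ _ _ h2 (hS _ h1 _ _ hh))

omit [Fintype σ] [DecidableEq σ] in
theorem map_dvd_mul_pow {φ : PS σ →ₐ[ℂ] PS σ} {f h : PS σ} {N : ℕ} (hf : f ∣ h ^ N) (t : PS σ) :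
    φ f ∣ (φ h * t) ^ (N + 1) := by
  refine (map_dvd φ hf).trans ?_
  rw [map_pow φ, mul_pow]
  exact (pow_dvd_pow _ (Nat.le_succ N)).mul_right _

omit [Fintype σ] [DecidableEq σ] in
theorem map_mul_dvd_mul_pow {φ : PS σ →ₐ[ℂ] PS σ} {f h : PS σ} {N : ℕ} (hf : f ∣ h ^ N) {t t' : PS σ}
    (ht : t' ∣ t) : φ f * t' ∣ (φ h * t) ^ (N + 1) := by
  rw [mul_pow]
  refine mul_dvd_mul ?_ (ht.trans (dvd_pow_self _ (Nat.succ_ne_zero N)))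
  refine (map_dvd φ hf).trans ?_
  rw [map_pow φ]
  exact pow_dvd_pow _ (Nat.le_succ N)

theorem Res.good {T : Finset σ} {h : PS σ} (H : Res T h) : ∀ {ι : Type} [Fintype ι] [DecidableEq ι]
    (F : ι → PS σ) (a : ι → ℕ) (J : PS σ) (N : ℕ), (∀ j, F j ∣ h ^ N) → J ∣ h ^ N →
    Good (fun k : σ => dd k) F a J := by
  induction H with
  | leaf hh =>
    intro ι _ _ F a J N hF hJ
    have := (hh.pow N).mono (Finset.subset_univ T)
    exact Good.of_dvdMonomial (fun j => this.of_dvd (hF j)) (this.of_dvd hJ)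
  | @enlarge h h' _ H ih =>
    intro ι _ _ F a J N hF hJ
    have : h ^ N ∣ (h * h') ^ N := by rw [mul_pow]; exact dvd_mul_right _ _
    exact ih F a J N (fun j => (hF j).trans this) (hJ.trans this)
  | @move h Φ hΦ H ih =>
    intro ι _ _ F a J N hF hJ
    have : IsDomain (PS σ) := NoZeroDivisors.to_isDomain _
    have hne : h ^ N ≠ 0 := pow_ne_zero _ (Res.ne_zero (.move hΦ H))
    cases hΦ with
    | shift j c hj hc h0 =>
      refine Good.of_shift h0 (free_compl (Finset.notMem_erase j T) hc) ?_
      exact ih _ rfl _ a _ (N + 1) (fun l => map_dvd_mul_pow (hF l) _) (map_mul_dvd_mul_pow hJ dvd_rfl)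
    | ram n hn h1 =>
      refine Good.of_ram hn ?_
      exact ih _ rfl _ a _ (N + 1) (fun l => map_dvd_mul_pow (hF l) _) (map_mul_dvd_mul_pow hJ dvd_rfl)
    | blow i j hi hj hij =>
      refine Good.of_enlarge (h := xx i) (xx_ne_zero i) (a₀ := 1) ?_
      refine Good.of_blow hij ?_ (p := 1) ?_ (fun ξ => ?_) ?_
      · rintro (_ | l)
        · exact xx_ne_zero i
        · exact ne_zero_of_dvd_ne_zero hne (hF l)
      · rw [pow_one, Fintype.prod_option]
        simp
      · refine ih _ (Or.inr ⟨ξ, rfl⟩) _ _ _ (N + 1) ?_ (map_mul_dvd_mul_pow hJ dvd_rfl)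
        rintro (_ | l)
        · simp only [Option.elim]
          rw [blow_xx, if_neg hij]
          exact (dvd_mul_left _ _).trans (dvd_pow_self _ (Nat.succ_ne_zero N))
        · exact map_dvd_mul_pow (hF l) _
      · refine ih _ (Or.inl rfl) _ _ _ (N + 1) ?_ (map_mul_dvd_mul_pow hJ (dvd_mul_left _ _))
        rintro (_ | l)
        · simp only [Option.elim]
          rw [blow_xx, if_pos rfl, map_zero, add_zero, mul_comm (xx j)]
          exact (dvd_mul_left _ _).trans (dvd_pow_self _ (Nat.succ_ne_zero N))
        · exact map_dvd_mul_pow (hF l) _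

omit [Fintype σ] [DecidableEq σ] in
theorem DvdMonomial.map {T T' : Finset σ} {φ : PS σ →ₐ[ℂ] PS σ} (h : ∀ i ∈ T, DvdMonomial T' (φ (BernsteinSato.xx i)))
    {f : PS σ} (hf : DvdMonomial T f) : DvdMonomial T' (φ f) := by
  obtain ⟨l, hl, hd⟩ := hf
  refine DvdMonomial.of_dvd ?_ (map_dvd φ hd)
  clear hd
  induction l with
  | nil => simpa using DvdMonomial.of_isUnit isUnit_one
  | cons i l ih =>
    rw [List.map_cons, List.prod_cons, map_mul]
    exact (h i (hl i List.mem_cons_self)).mul (ih fun j hj => hl j (List.mem_cons_of_mem _ hj))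

theorem mem_free_of_mul_mem {T : Finset σ} {c x : PS σ} (hc : c ∈ free T) (h0 : c ≠ 0) (h : c * x ∈ free T) :
    x ∈ free T := by
  rw [mem_free, map_mul, mem_free.1 hc] at h
  exact mem_free.2 (mul_left_cancel₀ h0 h)

end Resolution

section Tschirnhaus

variable {σ : Type*} [Fintype σ] [DecidableEq σ]

theorem dd_shift {k : σ} {c : PS σ} (h0 : cst c = 0) (hc : c ∈ free ({k}ᶜ : Finset σ)) (f : PS σ) :
    dd k (shift k c f) = shift k c (dd k f) := by
  rw [chain_rule, Finset.sum_eq_single k]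
  · rw [shift_xx h0, if_pos rfl, map_add, dd_xx, if_pos rfl, dd_of_free hc, add_zero, one_mul]
  · intro l _ hl
    rw [shift_xx h0, if_neg hl, dd_xx, if_neg (Ne.symm hl), zero_mul]
  · simp

theorem iterate_dd_shift {k : σ} {c : PS σ} (h0 : cst c = 0) (hc : c ∈ free ({k}ᶜ : Finset σ)) (n : ℕ) (f : PS σ) :
    (dd k)^[n] (shift k c f) = shift k c ((dd k)^[n] f) := by
  induction n generalizing f with
  | zero => rfl
  | succ n ih => rw [Function.iterate_succ_apply, dd_shift h0 hc, ih]; rfl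

theorem exists_cof_iterate_dd (k : σ) (n l : ℕ) :
    ∃ N : ℕ, N ≠ 0 ∧ ∀ f : PS σ, cof k l ((dd k)^[n] f) = N * cof k (l + n) f := by
  induction n with
  | zero => exact ⟨1, one_ne_zero, fun f => by simp⟩
  | succ n ih =>
    obtain ⟨N, hN, h⟩ := ih
    refine ⟨N * (l + n + 1), mul_ne_zero hN (Nat.succ_ne_zero _), fun f => ?_⟩
    rw [Function.iterate_succ_apply, h, cof_dd, Nat.cast_mul, mul_assoc, add_assoc l n 1]

theorem kill_singleton_of_free {T : Finset σ} {k : σ} (hk : k ∉ T) {f : PS σ} (hf : f ∈ free T) :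
    kill {k} f = algebraMap ℂ _ (cst f) :=
  hom_eq_on_free (ψ := (Algebra.ofId ℂ (PS σ)).comp cst) (fun i hi => by
    rw [kill_xx, if_neg (by rw [Finset.mem_singleton]; rintro rfl; exact hk hi)]
    simp) hf

theorem cst_cof_kill (k : σ) (m : ℕ) (f : PS σ) : cst (cof k m (kill {k} f)) = cst (cof k m f) := by
  rw [(fixVar_kill (Finset.mem_singleton_self k)).cof, cst_hom]

theorem cst_cof_shift {T : Finset σ} {k : σ} (hk : k ∉ T) {c : PS σ} (h0 : cst c = 0) (hc : c ∈ free T) (m : ℕ)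
    (q : PS σ) : cst (cof k m (shift k c q)) = cst (cof k m q) := by
  rw [← cst_cof_kill, ← cst_cof_kill k m q]
  have : (kill {k}).comp (shift k c) = kill {k} := by
    apply PS.hom_ext
    intro i
    rw [AlgHom.comp_apply, shift_xx h0]
    split_ifs with h
    · rw [map_add, kill_singleton_of_free hk hc, h0, map_zero, add_zero, h]
    · rfl
  have := DFunLike.congr_fun this q
  rw [AlgHom.comp_apply] at this
  rw [this]

/-- Substitution of `x` for the `k`-th variable. -/
def subst (k : σ) (x : PS σ) : PS σ →ₐ[ℂ] PS σ := (kill {k}ᶜ).comp (shift k x)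

theorem subst_xx {k : σ} {x : PS σ} (h0 : cst x = 0) (hx : x ∈ free ({k}ᶜ : Finset σ)) (i : σ) :
    subst k x (xx i) = if i = k then x else xx i := by
  rw [subst, AlgHom.comp_apply, shift_xx h0]
  split_ifs with h
  · rw [map_add, kill_compl_self, zero_add, mem_free.1 hx]
  · exact mem_free.1 (mem_free_compl_xx h)

theorem subst_of_free {k : σ} {x c : PS σ} (h0 : cst x = 0) (hc : c ∈ free ({k}ᶜ : Finset σ)) :
    subst k x c = c := by
  rw [subst, AlgHom.comp_apply, shift_fix h0 hc, mem_free.1 hc]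

theorem subst_sub_mem {k : σ} {x y : PS σ} (hx0 : cst x = 0) (hx : x ∈ free ({k}ᶜ : Finset σ))
    (hy0 : cst y = 0) (hy : y ∈ free ({k}ᶜ : Finset σ)) {I : Ideal (PS σ)} (h : x - y ∈ I) (f : PS σ) :
    subst k x f - subst k y f ∈ I := by
  refine hom_sub_mem (fun i => ?_) f
  rw [subst_xx hx0 hx, subst_xx hy0 hy]
  split_ifs
  · exact h
  · simp

/-- A form of the implicit function theorem. -/
theorem exists_subst_eq_zero {T : Finset σ} {k : σ} (hk : k ∉ T) {G : PS σ} (hG : G ∈ free (insert k T))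
    (h0 : cst (cof k 0 G) = 0) (h1 : cst (cof k 1 G) ≠ 0) :
    ∃ c ∈ free T, cst c = 0 ∧ subst k c G = 0 := by
  have hT : free T ≤ free ({k}ᶜ : Finset σ) := free_compl hk
  obtain ⟨v, hv⟩ : ∃ v : PS σ, v = algebraMap ℂ _ (cst (cof k 1 G)) := ⟨_, rfl⟩
  obtain ⟨u, hu⟩ : ∃ u : PS σ, u = algebraMap ℂ _ (cst (cof k 1 G))⁻¹ := ⟨_, rfl⟩
  have hvu : v * u = 1 := by rw [hv, hu, ← map_mul, mul_inv_cancel₀ h1, map_one]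
  have hsub : ∀ x ∈ free T, cst x = 0 → subst k x G ∈ free T := fun x hx hx0 => by
    refine map_mem_free (fun i hi => ?_) hG
    rw [subst_xx hx0 (hT hx)]
    split_ifs with h
    · exact hx
    · exact xx_mem_free (Finset.mem_of_mem_insert_of_ne hi h)
  have hcG : cst G = 0 := by rw [← h0, cof_zero_left, cst_hom]
  have hdec := sum_cof k 2 G
  rw [Finset.sum_range_succ, Finset.sum_range_one, pow_zero, one_mul, pow_one] at hdec
  obtain ⟨L, hL⟩ := exists_fixed_point (fun x => x - u * subst k x G) {x : PS σ | x ∈ free T ∧ cst x = 0}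
    ⟨zero_mem _, map_zero _⟩
    (fun x hx => ⟨sub_mem hx.1 (mul_mem (hu ▸ algebraMap_mem _ _) (hsub x hx.1 hx.2)), by
      rw [map_sub, map_mul, cst_hom, hcG, hx.2, mul_zero, sub_zero]⟩)
    (fun c x hx y hy hxy => by
      have e : ∀ z ∈ free T, cst z = 0 → subst k z G =
          cof k 0 G + z * cof k 1 G + z ^ 2 * subst k z ((sh k)^[2] G) := fun z hz hz0 => by
        conv_lhs => rw [← hdec]
        rw [map_add, map_add, map_mul, map_mul, map_pow, subst_of_free hz0 (cof_mem_free_compl _ _ _),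
          subst_of_free hz0 (cof_mem_free_compl _ _ _), subst_xx hz0 (hT hz), if_pos rfl]
      rw [e x hx.1 hx.2, e y hy.1 hy.2]
      have hx' : x ∈ mI σ := mem_mI.2 hx.2
      have hy' : y ∈ mI σ := mem_mI.2 hy.2
      have h3 : 1 - u * cof k 1 G ∈ mI σ := by
        rw [mem_mI, map_sub, map_mul, map_one, hu]
        simp [h1]
      have h4 := subst_sub_mem hx.2 (hT hx.1) hy.2 (hT hy.1) hxy ((sh k)^[2] G)
      have : x - u * (cof k 0 G + x * cof k 1 G + x ^ 2 * subst k x ((sh k)^[2] G)) -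
          (y - u * (cof k 0 G + y * cof k 1 G + y ^ 2 * subst k y ((sh k)^[2] G))) =
          (x - y) * ((1 - u * cof k 1 G) - u * subst k x ((sh k)^[2] G) * (x + y)) +
            (subst k x ((sh k)^[2] G) - subst k y ((sh k)^[2] G)) * (-u * y * y) := by ring
      rw [this, pow_succ]
      exact add_mem (Ideal.mul_mem_mul hxy (sub_mem h3 (Ideal.mul_mem_left _ _ (add_mem hx' hy'))))
        (Ideal.mul_mem_mul h4 (Ideal.mul_mem_left _ _ hy')))
  have hLT : L ∈ free T := by
    rw [mem_free, ← sub_eq_zero]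
    refine eq_zero_of_forall_mem_pow fun c => ?_
    obtain ⟨x, hx, h, -⟩ := hL c
    have e : kill T L - L = kill T (L - x) - (L - x) := by rw [map_sub, mem_free.1 hx.1]; ring
    rw [e]
    exact sub_mem (hom_mem_mI_pow _ h) h
  have hL0 : cst L = 0 := by
    obtain ⟨x, hx, h, -⟩ := hL 1
    rw [pow_one, mem_mI, map_sub, hx.2, sub_zero] at h
    exact h
  refine ⟨L, hLT, hL0, eq_zero_of_forall_mem_pow fun c => ?_⟩
  obtain ⟨x, hx, h, h'⟩ := hL c
  have h4 := subst_sub_mem hL0 (hT hLT) hx.2 (hT hx.1) h G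
  have e : subst k L G = (subst k L G - subst k x G) + (-v) * (x - u * subst k x G - x) := by
    linear_combination (-subst k x G) * hvu
  rw [e]
  exact add_mem h4 (Ideal.mul_mem_left _ _ h')

theorem exists_tschirnhaus {T : Finset σ} {k : σ} (hk : k ∉ T) {q : PS σ} (hq : q ∈ free (insert k T)) {d : ℕ}
    (hd : 0 < d) (h0 : cst (cof k (d - 1) q) = 0) (h1 : cst (cof k d q) ≠ 0) :
    ∃ c ∈ free T, cst c = 0 ∧ cof k (d - 1) (shift k c q) = 0 := by
  obtain ⟨N, hN, hN'⟩ := exists_cof_iterate_dd k (d - 1) 0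
  obtain ⟨N₁, hN₁, hN₁'⟩ := exists_cof_iterate_dd k (d - 1) 1
  have hmem : ∀ n, ∀ f ∈ free (insert k T), (dd k)^[n] f ∈ free (insert k T) := by
    intro n
    induction n with
    | zero => exact fun f hf => hf
    | succ n ih =>
      intro f hf
      rw [Function.iterate_succ_apply]
      refine ih _ ?_
      rw [mem_free, ← dd_kill _ (Finset.mem_insert_self k T), mem_free.1 hf]
  obtain ⟨c, hc, hc0, h⟩ := exists_subst_eq_zero hk (hmem (d - 1) q hq)
    (by rw [hN', zero_add, map_mul, h0, mul_zero])
    (by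
      rw [hN₁', show 1 + (d - 1) = d by omega, map_mul, map_natCast]
      exact mul_ne_zero (Nat.cast_ne_zero.2 hN₁) h1)
  refine ⟨c, hc, hc0, ?_⟩
  have e := hN' (shift k c q)
  rw [iterate_dd_shift hc0 (free_compl hk hc), cof_zero_left, zero_add] at e
  rw [subst, AlgHom.comp_apply, e, mul_eq_zero] at h
  refine h.resolve_left fun h => ?_
  have := congrArg cst h
  rw [map_natCast, map_zero] at this
  exact hN (Nat.cast_eq_zero.1 this)

theorem cst_cof_aeval (k : σ) (m : ℕ) (P : Polynomial ℂ) :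
    cst (cof k m (Polynomial.aeval (xx k) P)) = P.coeff m := by
  induction P using Polynomial.induction_on' with
  | add p q hp hq => rw [map_add, cof_add, map_add, hp, hq, Polynomial.coeff_add]
  | monomial n a =>
    rw [Polynomial.aeval_monomial, mul_comm, cof_xx_pow_mul_free (algebraMap_mem _ _), Polynomial.coeff_monomial]
    by_cases h : m = n
    · rw [if_pos h, if_pos h.symm]; simp
    · rw [if_neg h, if_neg (Ne.symm h), map_zero]

theorem cst_cof_translate_ne_zero {T : Finset σ} {k : σ} (hk : k ∉ T) {d : ℕ} (hd : 0 < d) {p : ℕ → PS σ}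
    (hp : ∀ i, p i ∈ free T) (hp1 : p (d - 1) = 0) {w : PS σ} {w₀ ξ : ℂ} (hw : kill {k} w = algebraMap ℂ _ w₀)
    (hw₀ : w₀ ≠ 0) (hξ : ξ ≠ 0) :
    cst (cof k (d - 1) (∑ i ∈ Finset.range d, p i * (xx k + algebraMap ℂ _ ξ) ^ i +
      (xx k + algebraMap ℂ _ ξ) ^ d * w)) ≠ 0 := by
  rw [← cst_cof_kill]
  have e : kill {k} (∑ i ∈ Finset.range d, p i * (xx k + algebraMap ℂ _ ξ) ^ i +
      (xx k + algebraMap ℂ _ ξ) ^ d * w) = Polynomial.aeval (xx k)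
        (∑ i ∈ Finset.range d, Polynomial.C (cst (p i)) * (Polynomial.X + Polynomial.C ξ) ^ i +
          Polynomial.C w₀ * (Polynomial.X + Polynomial.C ξ) ^ d) := by
    have h1 : kill {k} (xx k + algebraMap ℂ _ ξ) = xx k + algebraMap ℂ _ ξ := by
      rw [map_add, kill_xx, if_pos (Finset.mem_singleton_self k), AlgHom.commutes]
    simp only [map_add (kill _), map_add (Polynomial.aeval _), map_sum, map_mul, map_pow, hw,
      kill_singleton_of_free hk (hp _), Polynomial.aeval_C, Polynomial.aeval_X]
    rw [← map_add (kill _), h1, mul_comm _ (algebraMap ℂ (PS σ) w₀)]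
  rw [e, cst_cof_aeval, Polynomial.coeff_add, Polynomial.finsetSum_coeff, Finset.sum_eq_zero, zero_add,
    Polynomial.coeff_C_mul, Polynomial.coeff_X_add_C_pow]
  · have h2 : d.choose (d - 1) = d := by
      rw [Nat.choose_symm_of_eq_add (show d = d - 1 + 1 by omega), Nat.choose_one_right]
    rw [h2]
    exact mul_ne_zero hw₀ (mul_ne_zero (pow_ne_zero _ hξ) (Nat.cast_ne_zero.2 hd.ne'))
  · intro i hi
    rw [Polynomial.coeff_C_mul, Polynomial.coeff_X_add_C_pow]
    by_cases h : i = d - 1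
    · rw [h, hp1, map_zero, zero_mul]
    · rw [Nat.choose_eq_zero_of_lt (by have := Finset.mem_range.1 hi; omega)]
      simp

end Tschirnhaus

section Induction

variable {σ : Type*} [Fintype σ] [DecidableEq σ]

theorem move_shift {T : Finset σ} {k : σ} (hk : k ∉ T) {c : PS σ} (hc : c ∈ free T) (h0 : cst c = 0) :
    Move (insert k T) {(shift k c, 1)} :=
  .shift k c (Finset.mem_insert_self k T) (by rwa [Finset.erase_insert hk]) h0

theorem cof_sum_mul_pow {k : σ} {p : ℕ → PS σ} (hp : ∀ i, p i ∈ free ({k}ᶜ : Finset σ)) (w : PS σ) {d m : ℕ}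
    (hm : m < d) : cof k m (∑ i ∈ Finset.range d, p i * xx k ^ i + xx k ^ d * w) = p m := by
  rw [cof_add, cof_sum, cof_xx_pow_mul, if_neg (by omega), add_zero, Finset.sum_eq_single m]
  · rw [mul_comm, cof_xx_pow_mul_free (hp m), if_pos rfl]
  · intro i _ hi
    rw [mul_comm, cof_xx_pow_mul_free (hp i), if_neg (Ne.symm hi)]
  · intro h
    exact absurd (Finset.mem_range.2 hm) h

omit [Fintype σ] [DecidableEq σ] in
theorem isUnit_sum_add {d : ℕ} {M : PS σ} (hM : cst M = 0) (p : ℕ → PS σ) {w : PS σ} (hw : IsUnit w) :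
    IsUnit (∑ i ∈ Finset.range d, M ^ (d - i) * p i + w) := by
  rw [isUnit_iff_cst, map_add, map_sum, Finset.sum_eq_zero, zero_add]
  · exact isUnit_iff_cst.1 hw
  · intro i hi
    rw [map_mul, map_pow, hM, zero_pow (by have := Finset.mem_range.1 hi; omega), zero_mul]

/-- Repeatedly blowing up the intersections of `y_k = 0` with the components of a monomial divisor. -/
theorem res_blow_up {T : Finset σ} {k : σ} (hk : k ∉ T) {d : ℕ} (hd : 0 < d)
    (IH : ∀ m < d, ∀ a ∈ free T, a ≠ 0 → ∀ q ∈ free (insert k T), cst (cof k m q) ≠ 0 →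
      Res (insert k T) (a * q)) {p : ℕ → PS σ} (hp : ∀ i, p i ∈ free T) (hp1 : p (d - 1) = 0)
    (hpu : ∃ i < d, IsUnit (p i)) :
    ∀ l : List σ, (∀ i ∈ l, i ∈ T) → ∀ A ∈ free T, DvdMonomial T A → ∀ w ∈ free (insert k T), IsUnit w →
      Res (insert k T) (A * (∑ i ∈ Finset.range d, (l.map xx).prod ^ (d - i) * p i * xx k ^ i +
        xx k ^ d * w)) := by
  have : IsDomain (PS σ) := NoZeroDivisors.to_isDomain _
  have hkT : k ∈ insert k T := Finset.mem_insert_self k T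
  have hTT : T ⊆ insert k T := Finset.subset_insert k T
  intro l
  induction l with
  | nil =>
    intro _ A hA hA' w hw _
    obtain ⟨i, hi, hpi⟩ := hpu
    simp only [List.map_nil, List.prod_nil, one_pow, one_mul]
    refine IH i hi A hA hA'.ne_zero _ ?_ ?_
    · exact add_mem (sum_mem fun i _ => mul_mem (free_mono hTT (hp i)) (pow_mem (xx_mem_free hkT) i))
        (mul_mem (pow_mem (xx_mem_free hkT) d) hw)
    · rw [cof_sum_mul_pow (fun i => free_compl hk (hp i)) _ hi]
      exact isUnit_iff_cst.1 hpi
  | cons j l ih =>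
    intro hl A hA hA' w hw hwu
    have hjT : j ∈ T := hl j List.mem_cons_self
    have hlT : ∀ i ∈ l, i ∈ T := fun i hi => hl i (List.mem_cons_of_mem _ hi)
    have hjk : j ≠ k := fun h => hk (h ▸ hjT)
    have hM : (l.map (xx (σ := σ))).prod ∈ free T :=
      list_prod_mem fun x hx => by
        obtain ⟨i, hi, rfl⟩ := List.mem_map.1 hx
        exact xx_mem_free (hlT i hi)
    obtain ⟨M, hMe⟩ : ∃ M, M = (l.map (xx (σ := σ))).prod := ⟨_, rfl⟩
    rw [List.map_cons, List.prod_cons, ← hMe]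
    rw [← hMe] at hM ih
    refine .move (.blow j k (hTT hjT) hkT hjk) ?_
    rintro _ (rfl | ⟨ξ, rfl⟩)
    · refine .leaf ?_
      have e1 : blow k j 0 (xx j) = xx k * xx j := by rw [blow_xx, if_pos rfl, map_zero, add_zero]
      have e2 : blow k j 0 (xx k) = xx k := by rw [blow_xx, if_neg hjk.symm]
      have e : blow k j 0 (∑ i ∈ Finset.range d, (xx j * M) ^ (d - i) * p i * xx k ^ i + xx k ^ d * w) =
          xx k ^ d * (∑ i ∈ Finset.range d, (xx j * blow k j 0 M) ^ (d - i) * blow k j 0 (p i) +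
            blow k j 0 w) := by
        rw [map_add, map_sum, mul_add, Finset.mul_sum, map_mul, map_pow, e2]
        congr 1
        refine Finset.sum_congr rfl fun i hi => ?_
        have hi' := Finset.mem_range.1 hi
        rw [map_mul, map_mul, map_pow, map_pow, map_mul, e1, e2,
          show xx k ^ d = xx k ^ (d - i) * xx k ^ i by rw [← pow_add]; congr 1; omega]
        ring
      simp only [map_mul (blow k j 0) A, e]
      refine ((hA'.map (T' := insert k T) fun i hi => ?_).mul (((DvdMonomial.xx hkT).pow d).mul
        (.of_isUnit (isUnit_sum_add (by rw [map_mul]; simp) _ (hwu.map _))))).mul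
          ((DvdMonomial.xx (hTT hjT)).mul (.xx hkT))
      by_cases h : i = j
      · rw [h, e1]; exact (DvdMonomial.xx hkT).mul (.xx (hTT hjT))
      · rw [blow_xx, if_neg h]; exact .xx (hTT hi)
    · have hfix : ∀ f ∈ free T, blow j k ξ f = f := fun f hf => hom_fix_free (fun i hi => by
        rw [blow_xx, if_neg (by rintro rfl; exact hk hi)]) hf
      have e1 : blow j k ξ (xx j) = xx j := by rw [blow_xx, if_neg hjk]
      have e2 : blow j k ξ (xx k) = xx j * (xx k + algebraMap ℂ _ ξ) := by rw [blow_xx, if_pos rfl]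
      have hw' : blow j k ξ w ∈ free (insert k T) := (blow_baseHom (hTT hjT) hkT ξ).mem_free subset_rfl hw
      have e : blow j k ξ (∑ i ∈ Finset.range d, (xx j * M) ^ (d - i) * p i * xx k ^ i + xx k ^ d * w) =
          xx j ^ d * (∑ i ∈ Finset.range d, M ^ (d - i) * p i * (xx k + algebraMap ℂ _ ξ) ^ i +
            (xx k + algebraMap ℂ _ ξ) ^ d * blow j k ξ w) := by
        rw [map_add, map_sum, mul_add, Finset.mul_sum, map_mul, map_pow, e2]
        congr 1
        · refine Finset.sum_congr rfl fun i hi => ?_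
          have hi' := Finset.mem_range.1 hi
          rw [map_mul, map_mul, map_pow, map_pow, map_mul, e1, e2, hfix M hM, hfix _ (hp i),
            show xx j ^ d = xx j ^ (d - i) * xx j ^ i by rw [← pow_add]; congr 1; omega,
            mul_pow (xx j) (xx k + _)]
          ring
        · rw [mul_pow (xx j) (xx k + _)]
          ring
      have e3 : ∀ Q : PS σ, A * (xx j ^ d * Q) * xx j = A * xx j ^ (d + 1) * Q := fun Q => by ring
      simp only [map_mul (blow j k ξ) A, e, hfix A hA, e3]
      have hA1 : A * xx j ^ (d + 1) ∈ free T := mul_mem hA (pow_mem (xx_mem_free hjT) _)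
      have hA2 : DvdMonomial T (A * xx j ^ (d + 1)) := hA'.mul ((DvdMonomial.xx hjT).pow _)
      have hxk : xx k + algebraMap ℂ _ ξ ∈ free (insert k T) :=
        add_mem (xx_mem_free hkT) (algebraMap_mem _ _)
      by_cases hξ : ξ = 0
      · subst hξ
        simp only [map_zero, add_zero]
        exact ih hlT _ hA1 hA2 _ hw' (hwu.map _)
      have hξu : cst (xx k + algebraMap ℂ (PS σ) ξ) = ξ := by
        rw [map_add, AlgHom.commutes, cst_eq_zero_of_mem (xx_mem_mI k), zero_add]; rfl
      cases l with
      | nil =>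
        rw [List.map_nil, List.prod_nil] at hMe
        simp only [hMe, one_pow, one_mul]
        refine IH (d - 1) (by omega) _ hA1 hA2.ne_zero _ ?_ ?_
        · exact add_mem (sum_mem fun i _ => mul_mem (free_mono hTT (hp i)) (pow_mem hxk i))
            (mul_mem (pow_mem hxk d) hw')
        · refine cst_cof_translate_ne_zero hk hd hp hp1 (w₀ := cst w) ?_ (isUnit_iff_cst.1 hwu) hξ
          refine hom_eq_on_free (φ := (kill {k}).comp (blow j k ξ))
            (ψ := (Algebra.ofId ℂ (PS σ)).comp cst) (fun i hi => ?_) hw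
          have h0 : kill {k} (xx j) = 0 := by rw [kill_xx, if_neg (by simpa using hjk)]
          have h1 : (Algebra.ofId ℂ (PS σ)).comp cst (xx i) = 0 := by simp
          rw [h1, AlgHom.comp_apply]
          by_cases h : i = k
          · rw [h, e2, map_mul, h0, zero_mul]
          · rw [blow_xx, if_neg h, kill_xx, if_neg (by simpa using h)]
      | cons i l =>
        refine .leaf ((hA2.mono hTT).mul (.of_isUnit ?_))
        have hM0 : cst M = 0 := by
          rw [hMe, List.map_cons, List.prod_cons, map_mul]
          simp
        have := isUnit_sum_add (d := d) hM0 (fun i => p i * (xx k + algebraMap ℂ _ ξ) ^ i)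
          (w := (xx k + algebraMap ℂ _ ξ) ^ d * blow j k ξ w)
          (((isUnit_iff_cst.2 (by rwa [hξu])).pow d).mul (hwu.map _))
        simpa only [mul_assoc] using this

theorem associated_ram {T : Finset σ} {n : σ → ℕ} (hn : ∀ i, 0 < n i) {L : ℕ} (hL : ∀ i ∈ T, n i = L) {f : PS σ}
    (hf : DvdMonomial T f) : Associated (f ^ L) (ram n f) := by
  obtain ⟨l, hl, u, hu, rfl⟩ := hf.exists_eq
  have e : ram n (l.map xx).prod = (l.map xx).prod ^ L := by
    clear hf
    induction l with
    | nil => simp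
    | cons i l ih =>
      rw [List.map_cons, List.prod_cons, map_mul, ram_xx hn, hL i (hl i List.mem_cons_self),
        ih fun j hj => hl j (List.mem_cons_of_mem _ hj), mul_pow]
  rw [mul_pow, map_mul, e]
  exact Associated.mul_mul ((associated_one_iff_isUnit.2 (hu.pow L)).trans
    (associated_one_iff_isUnit.2 (hu.map _)).symm) (Associated.refl _)

theorem exists_newton {T : Finset σ} {k : σ} {d : ℕ} {A q : PS σ} (hA : DvdMonomial T A)
    (hq : q ∈ free (insert k T)) (hd1 : cof k (d - 1) q = 0)
    (hc : ∀ i < d, ∀ j < d, CompareBy A (cof k i q ^ (d.factorial / (d - i)))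
      (cof k j q ^ (d.factorial / (d - j)))) {n : σ → ℕ} (hn : ∀ i, 0 < n i) (hnT : ∀ i ∈ T, n i = d.factorial)
    (hq0 : ∃ i < d, cof k i q ≠ 0) :
    ∃ l : List σ, (∀ i ∈ l, i ∈ T) ∧ ∃ p : ℕ → PS σ, (∀ i, p i ∈ free T) ∧ p (d - 1) = 0 ∧
      (∃ i < d, IsUnit (p i)) ∧ ∀ i < d, ram n (cof k i q) = (l.map xx).prod ^ (d - i) * p i := by
  have : IsDomain (PS σ) := NoZeroDivisors.to_isDomain _
  obtain ⟨i₁, hi₁, hne₁⟩ := hq0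
  have hdvd : ∀ i < d, d - i ∣ d.factorial := fun i hi => Nat.dvd_factorial (by omega) (by omega)
  have hpos : ∀ i < d, d.factorial / (d - i) ≠ 0 := fun i hi =>
    (Nat.div_pos (Nat.le_of_dvd (Nat.factorial_pos d) (hdvd i hi)) (by omega)).ne'
  have hcA : ∀ i < d, cof k i q ≠ 0 → DvdMonomial T (cof k i q ^ (d.factorial / (d - i))) := fun i hi h =>
    hA.of_dvd ((hc i hi i hi).1.resolve_left (pow_ne_zero _ h))
  obtain ⟨i₀, hi₀, hmin⟩ := exists_dvd_all ⟨i₁, Finset.mem_range.2 hi₁⟩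
    (fun i => cof k i q ^ (d.factorial / (d - i)))
    (fun i hi j hj => (hc i (Finset.mem_range.1 hi) j (Finset.mem_range.1 hj)).dvd_or_dvd hA)
  rw [Finset.mem_range] at hi₀
  have hne₀ : cof k i₀ q ≠ 0 := fun h => by
    have := hmin i₁ (Finset.mem_range.2 hi₁)
    rw [h, zero_pow (hpos i₀ hi₀), zero_dvd_iff] at this
    exact hne₁ (pow_eq_zero_iff (hpos i₁ hi₁) |>.1 this)
  obtain ⟨l, hl, u, hu, he⟩ := (hcA i₀ hi₀ hne₀).exists_eq
  have hass : ∀ i < d, cof k i q ≠ 0 →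
      Associated ((cof k i q ^ (d.factorial / (d - i))) ^ (d - i)) (ram n (cof k i q)) := fun i hi h => by
    rw [← pow_mul, Nat.div_mul_cancel (hdvd i hi)]
    exact associated_ram hn hnT ((hcA i hi h).of_dvd (dvd_pow_self _ (hpos i hi)))
  have hram : ∀ f ∈ free T, ram n f ∈ free T := fun f hf =>
    map_mem_free (fun i hi => by rw [ram_xx hn]; exact pow_mem (xx_mem_free hi) _) hf
  have hMT : (l.map (xx (σ := σ))).prod ∈ free T := list_prod_mem fun x hx => by
    obtain ⟨i, hi, rfl⟩ := List.mem_map.1 hx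
    exact xx_mem_free (hl i hi)
  have hM0 : (l.map (xx (σ := σ))).prod ≠ 0 := fun h => by
    rw [h, mul_zero] at he
    exact pow_ne_zero _ hne₀ he
  have hMass : Associated (l.map (xx (σ := σ))).prod (cof k i₀ q ^ (d.factorial / (d - i₀))) := by
    rw [he]
    obtain ⟨v, rfl⟩ := hu
    exact ⟨v, mul_comm _ _⟩
  have hex : ∀ i, ∃ p, i < d → ram n (cof k i q) = (l.map xx).prod ^ (d - i) * p := fun i => by
    by_cases hi : i < d
    · by_cases h : cof k i q = 0
      · exact ⟨0, fun _ => by rw [h, map_zero, mul_zero]⟩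
      · obtain ⟨p, hp⟩ := (pow_dvd_pow_of_dvd (hMass.dvd.trans (hmin i (Finset.mem_range.2 hi))) (d - i)).trans
          (hass i hi h).dvd
        exact ⟨p, fun _ => hp⟩
    · exact ⟨0, fun h => absurd h hi⟩
  choose p hp using hex
  refine ⟨l, hl, fun i => if i < d then p i else 0, fun i => ?_, ?_, ⟨i₀, hi₀, ?_⟩, fun i hi => ?_⟩
  · dsimp only
    split_ifs with hi
    · refine mem_free_of_mul_mem (pow_mem hMT (d - i)) (pow_ne_zero _ hM0) ?_
      rw [← hp i hi]
      exact hram _ (cof_mem_free hq i)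
    · exact zero_mem _
  · dsimp only
    split_ifs with hi
    · have := hp _ hi
      rw [hd1, map_zero, zero_eq_mul] at this
      exact this.resolve_left (pow_ne_zero _ hM0)
    · rfl
  · dsimp only
    rw [if_pos hi₀]
    have h1 := ((hMass.pow_pow (n := d - i₀)).trans (hass i₀ hi₀ hne₀))
    rw [hp i₀ hi₀] at h1
    have h2 : Associated ((l.map (xx (σ := σ))).prod ^ (d - i₀) * 1) ((l.map xx).prod ^ (d - i₀) * p i₀) := by
      rwa [mul_one]
    exact associated_one_iff_isUnit.1 (h2.of_mul_left (Associated.refl _) (pow_ne_zero _ hM0)).symm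
  · dsimp only
    rw [if_pos hi, hp i hi]

/-- The inductive step on the order of a power series which is regular in the variable `y_k`. -/
theorem res_of_order {T : Finset σ} {k : σ} (hk : k ∉ T) (hT : ∀ h ∈ free T, h ≠ 0 → Res T h) (d : ℕ) :
    ∀ a ∈ free T, a ≠ 0 → ∀ q ∈ free (insert k T), cst (cof k d q) ≠ 0 → Res (insert k T) (a * q) := by
  have : IsDomain (PS σ) := NoZeroDivisors.to_isDomain _
  have hkT : k ∈ insert k T := Finset.mem_insert_self k T
  have hTT : T ⊆ insert k T := Finset.subset_insert k T
  induction d using Nat.strong_induction_on with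
  | _ d IH =>
  intro a ha ha0 q hq hqd
  by_cases hm : ∃ m < d, cst (cof k m q) ≠ 0
  · obtain ⟨m, hm, hqm⟩ := hm
    exact IH m hm a ha ha0 q hq hqm
  push Not at hm
  rcases Nat.eq_zero_or_pos d with rfl | hd
  · have hqu : IsUnit q := isUnit_iff_cst.2 (by rwa [cof_zero_left, cst_hom] at hqd)
    refine Res.transport (k := k) (S := fun A h => h ∣ A) (fun φ _ a h hh => map_dvd φ hh)
      (fun a h a' _ hh => hh.mul_right a') (fun a h t _ hh => mul_dvd_mul_right hh t)
      (fun a h hA hh => .leaf ((hA.of_dvd hh).mono hTT)) (hT a ha ha0) _ (hqu.mul_right_dvd.2 dvd_rfl)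
  obtain ⟨c, hc, hc0, hcq⟩ := exists_tschirnhaus hk hq hd (hm (d - 1) (by omega)) hqd
  refine .move (move_shift hk hc hc0) ?_
  rintro _ rfl
  simp only [map_mul (shift k c), mul_one]
  rw [shift_fix hc0 (free_compl hk ha)]
  replace hqd : cst (cof k d (shift k c q)) ≠ 0 := by rwa [cst_cof_shift hk hc0 hc]
  replace hq : shift k c q ∈ free (insert k T) :=
    (shift_baseHom hkT (free_mono hTT hc) hc0).mem_free subset_rfl hq
  generalize shift k c q = q at hq hqd hcq
  clear hm hc hc0 c
  obtain ⟨A₀, hA₀, hA₀ne, hcmp⟩ := exists_compareBy (Finset.range d)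
    (fun i => cof k i q ^ (d.factorial / (d - i))) (free T) (fun i _ => pow_mem (cof_mem_free hq i) _)
  refine Res.transport (k := k) (S := fun A h => ∃ a q, h = a * q ∧ a ∣ A ∧ a ∈ free T ∧
      q ∈ free (insert k T) ∧ cst (cof k d q) ≠ 0 ∧ cof k (d - 1) q = 0 ∧ ∀ i < d, ∀ j < d,
      CompareBy A (cof k i q ^ (d.factorial / (d - i))) (cof k j q ^ (d.factorial / (d - j))))
    ?_ ?_ ?_ ?_ (hT (a * A₀) (mul_mem ha hA₀) (mul_ne_zero ha0 hA₀ne)) _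
    ⟨a, q, rfl, dvd_mul_right _ _, ha, hq, hqd, hcq, fun i hi j hj => by
      rw [mul_comm]
      exact (hcmp i (Finset.mem_range.2 hi) j (Finset.mem_range.2 hj)).mul a⟩
  · rintro φ hφ A _ ⟨a, q, rfl, haA, ha, hq, hqd, hcq, hcmp⟩
    have hcof : ∀ l, cof k l (φ q) = φ (cof k l q) := fun l => (hφ.fixVar hk).cof l q
    refine ⟨φ a, φ q, map_mul _ _ _, map_dvd φ haA, hφ.mem_free subset_rfl ha, hφ.mem_free hTT hq, ?_, ?_,
      fun i hi j hj => ?_⟩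
    · rwa [hcof, cst_hom]
    · rw [hcof, hcq, map_zero]
    · rw [hcof, hcof, ← map_pow φ, ← map_pow φ]
      exact (hcmp i hi j hj).map φ
  · rintro A _ A' - ⟨a, q, rfl, haA, ha, hq, hqd, hcq, hcmp⟩
    exact ⟨a, q, rfl, haA.mul_right A', ha, hq, hqd, hcq, fun i hi j hj => (hcmp i hi j hj).mul A'⟩
  · rintro A _ t ht ⟨a, q, rfl, haA, ha, hq, hqd, hcq, hcmp⟩
    exact ⟨a * t, q, by ring, mul_dvd_mul_right haA t, mul_mem ha ht, hq, hqd, hcq,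
      fun i hi j hj => (hcmp i hi j hj).mul t⟩
  · rintro A _ hA ⟨a, q, rfl, haA, ha, hq, hqd, hcq, hcmp⟩
    have haM : DvdMonomial T a := hA.of_dvd haA
    have hw : IsUnit ((sh k)^[d] q) := by rwa [cof, cst_hom, ← isUnit_iff_cst] at hqd
    by_cases hq0 : ∃ i < d, cof k i q ≠ 0
    · let n : σ → ℕ := fun i => if i ∈ T then d.factorial else 1
      have hn : ∀ i, 0 < n i := fun i => by
        simp only [n]; split_ifs; exacts [Nat.factorial_pos d, one_pos]
      have hnT : ∀ i ∈ T, n i = d.factorial := fun i hi => if_pos hi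
      have hnT' : ∀ i, i ∉ T → n i = 1 := fun i hi => if_neg hi
      obtain ⟨l, hl, p, hp, hp1, hpu, hpc⟩ := exists_newton hA hq hcq hcmp hn hnT hq0
      have hmv : Move T {(ram n, ∏ l, xx l ^ (n l - 1))} := .ram n hn hnT'
      have hb := ram_baseHom hn hnT'
      refine .move (hmv.mono hTT) ?_
      rintro _ rfl
      have e : ram n q = ∑ i ∈ Finset.range d, (l.map xx).prod ^ (d - i) * p i * xx k ^ i +
          xx k ^ d * ram n ((sh k)^[d] q) := by
        nth_rw 1 [← sum_cof k d q]
        rw [map_add, map_sum, map_mul, map_pow, hb.2 k hk]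
        congr 1
        refine Finset.sum_congr rfl fun i hi => ?_
        rw [map_mul, map_pow, hb.2 k hk, hpc i (Finset.mem_range.1 hi), mul_comm]
      have hJ : DvdMonomial T (∏ l, xx l ^ (n l - 1)) := by
        refine Finset.prod_induction _ (DvdMonomial T) (fun _ _ h h' => h.mul h') (.of_isUnit isUnit_one)
          fun l _ => ?_
        by_cases h : l ∈ T
        · exact (DvdMonomial.xx h).pow _
        · rw [hnT' l h]; exact .of_isUnit (by simp)
      have := res_blow_up hk hd IH hp hp1 hpu l hl (ram n a * ∏ l, xx l ^ (n l - 1))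
        (mul_mem (hb.mem_free subset_rfl ha) (hmv.baseHom _ rfl).2)
        ((haM.map fun i hi => by rw [ram_xx hn]; exact (DvdMonomial.xx hi).pow _).mul hJ)
        (ram n ((sh k)^[d] q)) (hb.mem_free hTT (iterate_sh_mem_free hkT hq d)) (hw.map _)
      rw [← e] at this
      rwa [map_mul (ram n), mul_right_comm]
    · push Not at hq0
      refine .leaf ((haM.mono hTT).mul ?_)
      rw [← sum_cof k d q, Finset.sum_eq_zero, zero_add]
      · exact ((DvdMonomial.xx hkT).pow d).mul (.of_isUnit hw)
      · intro i hi
        rw [hq0 i (Finset.mem_range.1 hi), mul_zero]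

theorem exists_eq_sum_cof (k : σ) (f : PS σ) :
    ∃ (M : ℕ) (g : ℕ → PS σ), f = ∑ l ∈ Finset.range M, g l * cof k l f := by
  obtain ⟨M, hM⟩ := exists_mem_span_cof k f
  rw [← Finset.coe_range] at hM
  obtain ⟨g, hg⟩ := Submodule.mem_span_image_finset_iff_exists_fun _ |>.1 hM
  refine ⟨M, fun l => if hl : l ∈ Finset.range M then g ⟨l, hl⟩ else 0, ?_⟩
  rw [← Finset.sum_coe_sort]
  exact (hg.symm.trans (Finset.sum_congr rfl fun l _ => by simp))

omit [Fintype σ] [DecidableEq σ] in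
theorem CompareBy.mul_mul {a p q : PS σ} (h : CompareBy a p q) (t : PS σ) :
    CompareBy (a * t) (p * t) (q * t) :=
  ⟨h.1.imp (fun h => by rw [h, zero_mul]) (mul_dvd_mul_right · t),
    h.2.1.imp (fun h => by rw [h, zero_mul]) (mul_dvd_mul_right · t),
    h.2.2.imp (fun h => by rw [h]) fun h => by rw [← sub_mul]; exact mul_dvd_mul_right h t⟩

/-- Every nonzero power series can be turned into a divisor of a monomial. -/
theorem res_of_ne_zero (T : Finset σ) : ∀ h ∈ free T, h ≠ 0 → Res T h := by
  have : IsDomain (PS σ) := NoZeroDivisors.to_isDomain _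
  induction T using Finset.induction_on with
  | empty =>
    intro h hh h0
    refine .leaf (.of_isUnit (isUnit_iff_cst.2 fun h1 => h0 ?_))
    rw [cst_of_mem_free_empty hh, h1, map_zero]
  | insert k T hk hT =>
    intro h hh h0
    obtain ⟨M, g, hg⟩ := exists_eq_sum_cof k h
    obtain ⟨a, ha, ha0, hcmp⟩ := exists_compareBy (Finset.range M) (fun l => cof k l h) (free T)
      fun l _ => cof_mem_free hh l
    have hex : ∃ l ∈ Finset.range M, cof k l h ≠ 0 := by
      by_contra! hz
      refine h0 (hg.trans (Finset.sum_eq_zero fun l hl => ?_))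
      rw [hz l hl, mul_zero]
    obtain ⟨l₀, hl₀, hl₀ne⟩ := hex
    refine Res.transport (k := k) (S := fun a h => h ∈ free (insert k T) ∧
      (∀ i ∈ Finset.range M, ∀ j ∈ Finset.range M, CompareBy a (cof k i h) (cof k j h)) ∧
      (∃ l ∈ Finset.range M, cof k l h ∣ a) ∧ ∃ g : ℕ → PS σ, h = ∑ l ∈ Finset.range M, g l * cof k l h)
      ?_ ?_ ?_ ?_ (hT a ha ha0) h
      ⟨hh, hcmp, ⟨l₀, hl₀, (hcmp l₀ hl₀ l₀ hl₀).1.resolve_left hl₀ne⟩, g, hg⟩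
    · rintro φ hφ a h ⟨hh, hcmp, ⟨l, hl, hla⟩, g, hg⟩
      have hcof : ∀ l, cof k l (φ h) = φ (cof k l h) := fun l => (hφ.fixVar hk).cof l h
      refine ⟨hφ.mem_free (Finset.subset_insert k T) hh, fun i hi j hj => ?_, ⟨l, hl, ?_⟩, fun l => φ (g l), ?_⟩
      · rw [hcof, hcof]; exact (hcmp i hi j hj).map φ
      · rw [hcof]; exact map_dvd φ hla
      · nth_rw 1 [hg]
        rw [map_sum]
        exact Finset.sum_congr rfl fun l _ => by rw [map_mul, hcof]
    · rintro a h a' - ⟨hh, hcmp, ⟨l, hl, hla⟩, g, hg⟩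
      exact ⟨hh, fun i hi j hj => (hcmp i hi j hj).mul a', ⟨l, hl, hla.mul_right a'⟩, g, hg⟩
    · rintro a h t ht ⟨hh, hcmp, ⟨l, hl, hla⟩, g, hg⟩
      have hcof : ∀ l, cof k l (h * t) = cof k l h * t := fun l => by
        rw [mul_comm, cof_mul (free_compl hk ht), mul_comm]
      refine ⟨mul_mem hh (free_mono (Finset.subset_insert k T) ht), fun i hi j hj => ?_, ⟨l, hl, ?_⟩, g, ?_⟩
      · rw [hcof, hcof]; exact (hcmp i hi j hj).mul_mul t
      · rw [hcof]; exact mul_dvd_mul_right hla t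
      · nth_rw 1 [hg]
        rw [Finset.sum_mul]
        exact Finset.sum_congr rfl fun l _ => by rw [hcof, mul_assoc]
    · rintro a h hA ⟨hh, hcmp, ⟨l, hl, hla⟩, g, hg⟩
      obtain ⟨i, hi, hmin⟩ := exists_dvd_all ⟨l, hl⟩ (fun l => cof k l h)
        fun i hi j hj => (hcmp i hi j hj).dvd_or_dvd hA
      have hi0 : cof k i h ≠ 0 := ne_zero_of_dvd_ne_zero hA.ne_zero ((hmin l hl).trans hla)
      have hiT : cof k i h ∈ free T := cof_mem_free hh i
      obtain ⟨h', hh'⟩ : cof k i h ∣ h := by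
        nth_rw 2 [hg]
        exact Finset.dvd_sum fun l hl => (hmin l hl).mul_left _
      have hh'T : h' ∈ free (insert k T) :=
        mem_free_of_mul_mem (free_mono (Finset.subset_insert k T) hiT) hi0 (hh' ▸ hh)
      have h1 : cof k i h' = 1 := by
        refine mul_left_cancel₀ hi0 ?_
        rw [mul_one, ← cof_mul (free_compl hk hiT), ← hh']
      rw [hh']
      exact res_of_order hk hT i _ hiT hi0 h' hh'T (by rw [h1, map_one]; exact one_ne_zero)

theorem Good.of_dvd {ι : Type} [Fintype ι] [DecidableEq ι] {h : PS σ} (h0 : h ≠ 0) {F : ι → PS σ}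
    (a : ι → ℕ) {J : PS σ} (hF : ∀ j, F j ∣ h) (hJ : J ∣ h) : Good (fun k : σ => dd k) F a J :=
  (res_of_ne_zero Finset.univ h (free_univ h) h0).good F a J 1 (by simpa using hF) (by simpa using hJ)

end Induction

section Global

variable {σ : Type*} [Fintype σ] [DecidableEq σ]

/-- The Taylor expansion of a polynomial at a point. -/
def taylor (ξ : σ → ℂ) : MvPolynomial σ ℂ →ₐ[ℂ] PS σ := polyPS.comp (translate ξ)

omit [Fintype σ] [DecidableEq σ] in
theorem taylor_X (ξ : σ → ℂ) (i : σ) : taylor ξ (X i) = xx i + algebraMap ℂ _ (ξ i) := by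
  simp [taylor, translate, polyPS, ← algebraMap_eq]

omit [Fintype σ] in
theorem dd_taylor (ξ : σ → ℂ) (k : σ) (p : MvPolynomial σ ℂ) :
    dd k (taylor ξ p) = taylor ξ (pderiv k p) := by
  induction p using MvPolynomial.induction_on with
  | C c => rw [← algebraMap_eq, AlgHom.commutes, Derivation.map_algebraMap, Derivation.map_algebraMap, map_zero]
  | add p q hp hq => rw [map_add, map_add, hp, hq, map_add, map_add]
  | mul_X p i hp =>
    rw [map_mul, Derivation.leibniz, hp, taylor_X, map_add, Derivation.map_algebraMap, add_zero, dd_xx,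
      Derivation.leibniz, pderiv_X, smul_eq_mul, smul_eq_mul, smul_eq_mul, smul_eq_mul, map_add, map_mul, map_mul,
      taylor_X]
    congr 2
    by_cases h : k = i
    · subst h; simp
    · simp [h]

/-- The maximal ideal of a point. -/
def pointIdeal (ξ : σ → ℂ) : Ideal (MvPolynomial σ ℂ) := (idealOfVars σ ℂ).map (translate (-ξ))

omit [Fintype σ] [DecidableEq σ] in
theorem eval_of_mem_pointIdeal {ξ : σ → ℂ} {p : MvPolynomial σ ℂ} (h : p ∈ pointIdeal ξ) : eval ξ p = 0 := by
  have : pointIdeal ξ ≤ RingHom.ker (eval ξ) := by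
    refine Ideal.map_le_iff_le_comap.2 (Ideal.span_le.2 ?_)
    rintro _ ⟨i, rfl⟩
    change translate (-ξ) (X i) ∈ RingHom.ker (eval ξ)
    rw [RingHom.mem_ker, translate, aeval_X]
    simp
  exact this h

omit [Fintype σ] [DecidableEq σ] in
theorem taylor_injective (ξ : σ → ℂ) : Function.Injective (taylor ξ) := by
  intro p q h
  have h' : polyPS (translate ξ p) = polyPS (translate ξ q) := h
  rw [polyPS_eq, polyPS_eq] at h'
  rw [← translate_translate ξ p, ← translate_translate ξ q, MvPolynomial.coe_injective _ _ h']

variable {ι : Type} [Fintype ι] [DecidableEq ι]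

/-- Local solution of the global problem at a point. -/
theorem exists_local (ξ : σ → ℂ) {F : ι → MvPolynomial σ ℂ} (hF : ∀ j, F j ≠ 0) (a : ι → ℕ) :
    ∃ b ∈ linForms ι, ∃ Λ, ∃ φ, eval ξ φ ≠ 0 ∧
      GenP (fun k : σ => pderiv k) F a 1 Λ (C (φ * (∏ j, F j) ^ Λ) * map (algebraMap ℂ _) b) := by
  have : IsDomain (PS σ) := NoZeroDivisors.to_isDomain _
  have H : Good (fun k : σ => dd k) (fun j => taylor ξ (F j)) a (taylor ξ 1) := by
    rw [map_one]
    refine Good.of_dvd (h := ∏ j, taylor ξ (F j)) (Finset.prod_ne_zero_iff.2 fun j _ => ?_) a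
      (fun j => Finset.dvd_prod_of_mem _ (Finset.mem_univ j)) (one_dvd _)
    rw [Ne, map_eq_zero_iff _ (taylor_injective ξ)]
    exact hF j
  obtain ⟨b, hb, Λ, φ, hφ, e, he, h⟩ := Good.descend (E := fun k : σ => pderiv k) (taylor ξ) (dd_taylor ξ)
    (pointIdeal ξ) ⊥ (mI σ)
    (fun c w hw => by
      rw [sup_bot_eq, pointIdeal, ← Ideal.map_pow, ← translate_translate ξ w]
      exact Ideal.mem_map_of_mem _ (mem_idealOfVars_pow hw))
    (fun c r => by
      obtain ⟨p, hp⟩ := exists_poly c r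
      refine ⟨translate (-ξ) p, ?_⟩
      have := translate_translate (-ξ) p
      rw [neg_neg] at this
      rwa [taylor, AlgHom.comp_apply, this]) H
  refine ⟨b, hb, Λ, φ, ?_, ?_⟩
  · have := eval_of_mem_pointIdeal hφ
    rw [map_sub, map_one, sub_eq_zero] at this
    rw [this]; exact one_ne_zero
  · have : C (φ * ((∏ j, F j) ^ Λ * 1)) * map (algebraMap ℂ _) b = e := by
      ext t : 1
      have := h t
      rwa [Ideal.mem_bot, coeff_sub, sub_eq_zero] at this
    rw [mul_one] at this
    rwa [this]

/-- Multipliers for which the global problem is solvable. -/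
def multiplierIdeal (F : ι → MvPolynomial σ ℂ) (a : ι → ℕ) : Ideal (MvPolynomial σ ℂ) where
  carrier := {φ | ∃ b ∈ linForms ι, ∃ Λ,
    GenP (fun k : σ => pderiv k) F a 1 Λ (C (φ * (∏ j, F j) ^ Λ) * map (algebraMap ℂ _) b)}
  zero_mem' := ⟨1, one_mem _, 0, by rw [zero_mul, C_0, zero_mul]; exact Gen.zero⟩
  add_mem' := by
    rintro φ φ' ⟨b, hb, Λ, h⟩ ⟨b', hb', Λ', h'⟩
    refine ⟨b * b', mul_mem hb hb', Λ + Λ', ?_⟩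
    have h1 := (h.pow_mul Λ').smul (map (algebraMap ℂ _) b')
    have h2 := (h'.pow_mul Λ).smul (map (algebraMap ℂ _) b)
    rw [add_comm Λ' Λ] at h2
    convert h1.add h2 using 1
    simp only [map_mul, map_add, map_pow]
    ring
  smul_mem' := by
    rintro c φ ⟨b, hb, Λ, h⟩
    refine ⟨b, hb, Λ, ?_⟩
    rw [smul_eq_mul, mul_assoc, map_mul C, mul_assoc]
    exact h.smul _

theorem good_pderiv {F : ι → MvPolynomial σ ℂ} (hF : ∀ j, F j ≠ 0) (a : ι → ℕ) :
    Good (fun k : σ => pderiv k) F a 1 := by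
  have h1 : (1 : MvPolynomial σ ℂ) ∈ multiplierIdeal F a := by
    rw [← Ideal.eq_top_iff_one]
    by_contra hne
    obtain ⟨m, hm, hle⟩ := Ideal.exists_le_maximal _ hne
    obtain ⟨ξ, rfl⟩ := isMaximal_iff_eq_vanishingIdeal_singleton.1 hm
    obtain ⟨b, hb, Λ, φ, hφ, h⟩ := exists_local ξ hF a
    have := hle (show φ ∈ multiplierIdeal F a from ⟨b, hb, Λ, h⟩)
    exact hφ (by simpa using (mem_vanishingIdeal_singleton_iff _ _).1 this)
  obtain ⟨b, hb, Λ, h⟩ := h1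
  exact ⟨b, hb, Λ, by rwa [one_mul, ← mul_one ((∏ j, F j) ^ Λ)] at h⟩

end Global

section Final

variable {n r : ℕ}

/-- Flattening of polynomials in the exponents over polynomials in the coordinates. -/
def flat (n r : ℕ) : MvPolynomial (Fin r) (MvPolynomial (Fin n) ℂ) →+* XS ℂ n r :=
  eval₂Hom (rename Sum.inl : MvPolynomial (Fin n) ℂ →ₐ[ℂ] XS ℂ n r).toRingHom fun j => X (Sum.inr j)

theorem flat_C (p : MvPolynomial (Fin n) ℂ) : flat n r (C p) = px ℂ n r p := eval₂Hom_C _ _ _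

theorem flat_X (j : Fin r) : flat n r (X j) = X (Sum.inr j) := eval₂Hom_X' _ _ _

theorem flat_map (b : MvPolynomial (Fin r) ℂ) : flat n r (map (algebraMap ℂ _) b) = ps ℂ n r b := by
  induction b using MvPolynomial.induction_on with
  | C c => rw [map_C, flat_C, ps, rename_C, algebraMap_eq, px, rename_C]
  | add p q hp hq => rw [map_add, map_add, hp, hq, ps, ps, ps, map_add]
  | mul_X p i hp => rw [map_mul, map_mul, hp, map_X, flat_X, ps, ps, map_mul, rename_X]

theorem pderiv_px (i : Fin n) (p : MvPolynomial (Fin n) ℂ) :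
    pderiv (Sum.inl i) (px ℂ n r p) = px ℂ n r (pderiv i p) := pderiv_rename Sum.inl_injective _ _

theorem pderiv_flat (i : Fin n) (m : MvPolynomial (Fin r) (MvPolynomial (Fin n) ℂ)) :
    pderiv (Sum.inl i) (flat n r m) = flat n r (coeffDer (pderiv i) m) := by
  induction m using MvPolynomial.induction_on with
  | C b => rw [flat_C, coeffDer_C, flat_C, pderiv_px]
  | add p q hp hq => simp only [map_add, hp, hq]
  | mul_X p i hp =>
    simp only [map_mul, Derivation.leibniz, coeffDer_X, flat_X, smul_eq_mul, hp, mul_zero, zero_add]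
    rw [pderiv_X_of_ne (by simp), mul_zero, zero_add]

theorem DX_div (i : Fin n) (p : XS ℂ n r) {q : XS ℂ n r} (hq : q ≠ 0) :
    DX ℂ n r i (toF ℂ n r p / toF ℂ n r q) =
      (toF ℂ n r (pderiv (Sum.inl i) p) * toF ℂ n r q - toF ℂ n r p * toF ℂ n r (pderiv (Sum.inl i) q)) /
        toF ℂ n r q ^ 2 := by
  have h := IsFractionRing.div_surjective (A := XS ℂ n r) (toF ℂ n r p / toF ℂ n r q)
  exact quotient_rule_congr (pderiv (Sum.inl i))
    (by simpa using nonZeroDivisors.ne_zero h.choose_spec.choose_spec.1)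
    (by simpa using hq) h.choose_spec.choose_spec.2

theorem twist_mul {f : Fin r → MvPolynomial (Fin n) ℂ} (hf : ∀ j, f j ≠ 0) (i : Fin n) :
    twist ℂ n r f i * toF ℂ n r (flat n r (C (∏ j, f j))) =
      toF ℂ n r (flat n r (tw (fun k : Fin n => pderiv k) f i)) := by
  simp only [twist, tw, map_sum, map_mul, toF, Finset.sum_mul, flat_C, flat_X]
  refine Finset.sum_congr rfl fun j _ => ?_
  have h : algebraMap (XS ℂ n r) (Frac ℂ n r) (px ℂ n r (f j)) ≠ 0 := by
    simpa [px, map_eq_zero_iff _ (rename_injective _ Sum.inl_injective)] using hf j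
  have e (p q : MvPolynomial (Fin n) ℂ) : px ℂ n r (p * q) = px ℂ n r p * px ℂ n r q := map_mul _ _ _
  rw [← Finset.mul_prod_erase _ _ (Finset.mem_univ j), e, map_mul]
  field_simp

theorem mem_Na_of_genP {f : Fin r → MvPolynomial (Fin n) ℂ} (hf : ∀ j, f j ≠ 0) {a : Fin r → ℕ} {Λ : ℕ}
    {m : MvPolynomial (Fin r) (MvPolynomial (Fin n) ℂ)} (h : GenP (fun k : Fin n => pderiv k) f a 1 Λ m) :
    toF ℂ n r (flat n r m) / toF ℂ n r (flat n r (C (∏ j, f j)) ^ Λ) ∈ Na ℂ n r f a := by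
  have hP : flat n r (C (∏ j, f j)) ≠ 0 := by
    rw [flat_C, px, Ne, map_eq_zero_iff _ (rename_injective _ Sum.inl_injective), Finset.prod_eq_zero_iff]
    rintro ⟨j, -, hj⟩
    exact hf j hj
  set P := flat n r (C (∏ j, f j)) with hPdef
  have hP' : algebraMap (XS ℂ n r) (Frac ℂ n r) P ≠ 0 := by simpa using hP
  refine Submodule.mem_sInf.2 fun N hN => ?_
  induction h with
  | base =>
    convert hN.1 using 1
    rw [pow_zero, mul_one, flat_C, Fsa, toF, toF, map_one, div_one, px, map_prod]
    simp only [map_pow, px, toF]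
  | smul c _ ih =>
    have := N.smul_mem (flat n r c) ih
    rwa [Algebra.smul_def, ← mul_div_assoc, toF, ← map_mul, ← map_mul] at this
  | add _ _ ih ih' =>
    have := N.add_mem ih ih'
    rwa [← add_div, toF, toF, ← map_add, ← map_add] at this
  | clear _ ih =>
    convert ih using 1
    simp only [map_mul, ← hPdef, toF, map_pow, pow_succ']
    exact mul_div_mul_left _ _ hP'
  | @nabla Λ m i _ ih =>
    convert hN.2 i _ ih using 1
    rw [nabla, DX_div i _ (pow_ne_zero _ hP)]
    have ht := twist_mul hf i
    have hpow : pderiv (Sum.inl i) (P ^ Λ) * P = Λ * P ^ Λ * pderiv (Sum.inl i) P := by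
      rw [Derivation.leibniz_pow]
      cases Λ with
      | zero => simp
      | succ k => simp; ring
    have hpow' := congrArg (algebraMap (XS ℂ n r) (Frac ℂ n r)) hpow
    rw [← hPdef] at ht
    simp only [toF, map_mul, map_add, map_sub, map_natCast, map_pow, ← hPdef, ← pderiv_flat] at ht hpow' ⊢
    rw [← ht, ← mul_div_right_comm, div_add_div _ _ (pow_ne_zero _ (pow_ne_zero _ hP')) (pow_ne_zero _ hP'),
      div_eq_div_iff (pow_ne_zero _ hP') (mul_ne_zero (pow_ne_zero _ (pow_ne_zero _ hP')) (pow_ne_zero _ hP'))]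
    generalize algebraMap (XS ℂ n r) (Frac ℂ n r) (pderiv (Sum.inl i) (P ^ Λ)) = u at hpow' ⊢
    linear_combination (algebraMap (XS ℂ n r) (Frac ℂ n r) (flat n r m)) *
      algebraMap (XS ℂ n r) (Frac ℂ n r) P ^ (2 * Λ) * hpow'

theorem exists_linForms_mem_BS {f : Fin r → MvPolynomial (Fin n) ℂ} (hf : ∀ j, f j ≠ 0) (a : Fin r → ℕ) :
    ∃ b ∈ linForms (Fin r), b ∈ BS ℂ n r f a := by
  obtain ⟨b, hb, Λ, h⟩ := good_pderiv hf a
  refine ⟨b, hb, ?_⟩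
  have := mem_Na_of_genP hf h
  have hP : flat n r (C (∏ j, f j)) ≠ 0 := by
    rw [flat_C, px, Ne, map_eq_zero_iff _ (rename_injective _ Sum.inl_injective), Finset.prod_eq_zero_iff]
    rintro ⟨j, -, hj⟩
    exact hf j hj
  rwa [mul_one, map_mul, flat_map, map_pow C, map_pow (flat n r), toF, map_mul, toF, mul_div_cancel_left₀] at this
  exact fun h => pow_ne_zero Λ hP ((map_eq_zero_iff _ (IsFractionRing.injective _ _)).1 h)

/-- An irreducible set on which a product of linear forms vanishes lies in one of their zero loci. -/
theorem exists_subset_of_linForms {V : Set (Fin r → ℂ)} (hV : irredSet r V) {b : MvPolynomial (Fin r) ℂ}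
    (hb : b ∈ linForms (Fin r)) (h : ∀ α ∈ V, eval α b = 0) :
    ∃ (l : Fin r → ℕ) (c : ℕ), 0 < c ∧ ∀ α ∈ V, eval α (∑ j, C (l j : ℂ) * X j + C (c : ℂ)) = 0 := by
  obtain ⟨α, hα⟩ := hV.1
  induction hb using Submonoid.closure_induction with
  | one => exact absurd (h α hα) (by simp)
  | mem x hx =>
    obtain ⟨c, hc, rfl⟩ | ⟨l, c, hc, rfl⟩ := hx
    · exact absurd (h α hα) (by simpa using hc)
    · exact ⟨l, c, hc, h⟩
  | mul x y _ _ ihx ihy =>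
    refine (hV.2 {α | eval α x = 0} {α | eval α y = 0} ⟨{x}, by simp⟩ ⟨{y}, by simp⟩ fun α hα => ?_).elim ihx ihy
    have := h α hα
    rwa [map_mul, mul_eq_zero] at this

theorem dvd_of_vanishes {p q : MvPolynomial (Fin r) ℂ} (hp : Irreducible p)
    (h : ∀ α, eval α p = 0 → eval α q = 0) : p ∣ q := by
  have h1 : q ∈ vanishingIdeal ℂ (zeroLocus ℂ (Ideal.span {p})) := by
    rw [mem_vanishingIdeal_iff]
    intro α hα
    have := mem_zeroLocus_iff.1 hα p (Ideal.mem_span_singleton_self p)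
    simpa using h α (by simpa using this)
  rw [vanishingIdeal_zeroLocus_eq_radical,
    ((Ideal.span_singleton_prime hp.ne_zero).2 hp.prime).radical, Ideal.mem_span_singleton] at h1
  exact h1

theorem irreducible_linForm {l : Fin r → ℕ} (c : ℕ) (hl : ∃ j, l j ≠ 0) :
    Irreducible (∑ j, C (l j : ℂ) * X j + C (c : ℂ) : MvPolynomial (Fin r) ℂ) := by
  obtain ⟨j, hj⟩ := hl
  have hco : coeff (Finsupp.single j 1) (∑ j, C (l j : ℂ) * X j + C (c : ℂ) : MvPolynomial (Fin r) ℂ) = l j := by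
    have h0 : (0 : Fin r →₀ ℕ) ≠ Finsupp.single j 1 := fun h => by simpa using DFunLike.congr_fun h j
    rw [coeff_add, coeff_sum, coeff_C, if_neg h0, add_zero, Finset.sum_eq_single j]
    · rw [coeff_C_mul, coeff_X, if_pos rfl, mul_one]
    · intro k _ hk
      rw [coeff_C_mul, coeff_X, if_neg (fun h => hk (Finsupp.single_left_injective one_ne_zero h)), mul_zero]
    · simp
  have hj' : (l j : ℂ) ≠ 0 := Nat.cast_ne_zero.2 hj
  refine irreducible_of_totalDegree_eq_one (le_antisymm ?_ ?_) fun x hx => ?_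
  · refine (totalDegree_add _ _).trans (max_le ((totalDegree_finsetSum _ _).trans (Finset.sup_le fun i _ => ?_)) ?_)
    · refine (totalDegree_mul _ _).trans ?_
      rw [totalDegree_C, totalDegree_X]
    · rw [totalDegree_C]; exact Nat.zero_le _
  · have := le_totalDegree (mem_support_iff.2 (hco.trans_ne hj'))
    simpa using this
  · refine isUnit_iff_ne_zero.2 fun h => hj' ?_
    rw [← hco, ← zero_dvd_iff, ← h]
    exact hx _

end Final

end BernsteinSato

/-- Every irreducible component of codimension one of `Z(B_F^a)` (i.e. an irreducible component
which is the zero locus of a single irreducible polynomial) is a hyperplane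
`l₁s₁ + ⋯ + l_r s_r + c = 0` with `l_j ∈ ℕ` not all zero and `c ∈ ℤ_{>0}`. -/
theorem stmt0 (n r : ℕ) (hn : 1 ≤ n) (hr : 1 ≤ r)
    (f : Fin r → MvPolynomial (Fin n) ℂ) (hf : ∀ j, f j ≠ 0)
    (a : Fin r → ℕ) (hfa : ∀ c : ℂ, (∏ j, f j ^ a j) ≠ C c)
    (V : Set (Fin r → ℂ)) (p : MvPolynomial (Fin r) ℂ) (hp : Irreducible p)
    (hVp : V = {α | eval α p = 0})
    (hVsub : V ⊆ ZBS n r f a)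
    (hVirr : irredSet r V)
    (hVmax : ∀ W : Set (Fin r → ℂ), irredSet r W → W ⊆ ZBS n r f a → V ⊆ W → W = V) :
    ∃ (l : Fin r → ℕ) (c : ℕ), (∃ j, l j ≠ 0) ∧ 0 < c ∧
      V = {α : Fin r → ℂ | (∑ j, (l j : ℂ) * α j) + (c : ℂ) = 0} := by
  obtain ⟨b, hb, hbBS⟩ := BernsteinSato.exists_linForms_mem_BS hf a
  obtain ⟨l, c, hc, hl⟩ := BernsteinSato.exists_subset_of_linForms hVirr hb fun α hα => hVsub hα b hbBS
  have hl0 : ∃ j, l j ≠ 0 := by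
    by_contra! h
    obtain ⟨α, hα⟩ := hVirr.1
    have := hl α hα
    simp [h, hc.ne'] at this
  have hdvd := BernsteinSato.dvd_of_vanishes hp fun α hα => hl α (by rw [hVp]; exact hα)
  have hass := hp.associated_of_dvd (BernsteinSato.irreducible_linForm c hl0) hdvd
  refine ⟨l, c, hl0, hc, Set.Subset.antisymm (fun α hα => ?_) fun α hα => ?_⟩
  · simpa using hl α hα
  · rw [hVp]
    obtain ⟨u, hu⟩ := hass.symm.dvd
    have h := congrArg (eval α) hu
    rw [map_mul] at h
    refine h.trans ?_
    have h0 : eval α (∑ j, C (l j : ℂ) * X j + C (c : ℂ)) = 0 := by simpa using hα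
    rw [h0, zero_mul]

end
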